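/- arXiv:1207.2031 — 2 statements merged into one kernel-verified Lean document; each statement's English description precedes it below -/
import Mathlib

section
/- Let Ω ⊆ ℝ^N be a nonempty open set, λ > 0, 0 ≤ α < ∞, and f(u) = −λ|u|^α u (repulsive single power). Set E = H¹₀(Ω) ∩ L^{α+2}(Ω) and E* = H⁻¹(Ω) + L^{(α+2)/(α+1)}(Ω). Let u₀ ∈ H¹₀(Ω), u₀ ≠ 0, and let u ∈ L^∞(ℝ;E) ∩ W^{1,∞}(ℝ;E*) be a weak solution of i∂ₜu + Δu − λ|u|^α u = 0 with Dirichlet boundary condition and u(0) = u₀, satisfying conservation of charge and, for all t ∈ ℝ, E(u(t)) ≤ E(u₀), where E(u₀) = (1/2)‖∇u₀‖²_{L²(Ω)} + (λ/(α+2))‖u₀‖^{α+2}_{L^{α+2}(Ω)}. Then for every 0 < ε < ‖u₀‖_{L²(Ω)}, setting M₀ = 2‖u₀‖_{L²(Ω)}√(2E(u₀))/(‖u₀‖²_{L²(Ω)} − ε²), one has for every c ∈ Ω and r ∈ [2,∞]: liminf_{t→±∞} |t|^{N(1/2−1/r)} ‖u(t)‖_{L^r(Ω ∩ {|x−c| <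 M₀|t|})} ≥ ε · |B(0,M₀)|^{−(1/2−1/r)}. -/
noncomputable section

abbrev EucSp (N : ℕ) : Type := EuclideanSpace ℝ (Fin N)

/-- `W^{1,∞}(Ω;ℝ)`: bounded Lipschitz real-valued functions on `Ω`. -/
def IsW1inf {N : ℕ} (Ω : Set (EucSp N)) (a : EucSp N → ℝ) : Prop :=
  (∃ L : NNReal, LipschitzOnWith L a Ω) ∧ (∃ C : ℝ, ∀ x ∈ Ω, |a x| ≤ C)

/-- A realization of the Sobolev space `H¹₀(Ω)` for a nonempty open set `Ω ⊆ ℝ^N`: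
a complex normed space `H`, injectively embedded in `L²(Ω)`, with a gradient operator
valued in `L²(Ω;ℂ^N)`, carrying the `H¹` norm, in which the test functions `C_c^∞(Ω)`
are dense (with the gradient extending the classical one), and which is stable under
multiplication by `W^{1,∞}(Ω;ℝ)` functions. Its elements are the elements of `H¹₀(Ω)`. -/
structure DirichletSetting (N : ℕ) where
  Ω : Set (EucSp N)
  hopen : IsOpen Ω
  hne : Ω.Nonempty
  H : Type
  [normedAddCommGroup : NormedAddCommGroup H]
  [normedSpace : NormedSpace ℂ H]
  toL2 : H →ₗ[ℂ] MeasureTheory.Lp ℂ 2 (MeasureTheory.volume.restrict Ω)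
  toL2_injective : Function.Injective toL2
  grad : H →ₗ[ℂ] MeasureTheory.Lp (EuclideanSpace ℂ (Fin N)) 2 (MeasureTheory.volume.restrict Ω)
  norm_eq : ∀ u : H, ‖u‖ ^ 2 = ‖toL2 u‖ ^ 2 + ‖grad u‖ ^ 2
  dense_test : ∀ u : H, ∀ δ : ℝ, 0 < δ → ∃ (v : H) (φ : EucSp N → ℂ),
      ‖u - v‖ < δ ∧ ContDiff ℝ (⊤ : ℕ∞) φ ∧ HasCompactSupport φ ∧ tsupport φ ⊆ Ω ∧
      Filter.EventuallyEq (MeasureTheory.ae (MeasureTheory.volume.restrict Ω)) (toL2 v) φ ∧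
      Filter.EventuallyEq (MeasureTheory.ae (MeasureTheory.volume.restrict Ω)) (grad v)
        (fun x => (WithLp.equiv 2 (Fin N → ℂ)).symm
          (fun j => fderiv ℝ φ x (EuclideanSpace.single j (1 : ℝ))))
  smul_W1inf_mem : ∀ a : EucSp N → ℝ, IsW1inf Ω a → ∀ u : H,
      ∃ v : H, Filter.EventuallyEq (MeasureTheory.ae (MeasureTheory.volume.restrict Ω))
        (toL2 v) (fun x => (a x : ℂ) * (toL2 u : EucSp N → ℂ) x)

attribute [instance] DirichletSetting.normedAddCommGroup DirichletSetting.normedSpace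

open MeasureTheory Filter Metric Set Complex ENNReal NNReal

variable {N : ℕ}

/-- The `L²(Ω)` measure. -/
def DirichletSetting.μ (S : DirichletSetting N) : Measure (EucSp N) :=
  volume.restrict S.Ω

/-- The real `H⁻¹–H¹₀` duality pairing `⟨Δu, φ⟩ = -Re ∫_Ω ∇u · ∇φ̄`. -/
def deltaPair (S : DirichletSetting N) (u φ : S.H) : ℝ :=
  -(inner ℂ (S.grad u) (S.grad φ) : ℂ).re

/-- The real `L²–L²` duality pairing `⟨v, w⟩ = Re ∫_Ω v w̄`. -/
def l2Pair (S : DirichletSetting N) (v w : S.H) : ℝ :=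
  (inner ℂ (S.toL2 w) (S.toL2 v) : ℂ).re

/-- `u` is a weak solution on `(0,∞)` of `i∂ₜu + Δu + f(u) = 0`, `u(0) = u₀`,
bounded in `H¹₀(Ω)`, with `f(u) ∈ L^∞((0,T);H⁻¹(Ω))` for every `T > 0`. -/
def IsWeakSolutionPos (S : DirichletSetting N) (f : S.H → (S.H →L[ℝ] ℝ))
    (u : ℝ → S.H) (u₀ : S.H) : Prop :=
  u 0 = u₀ ∧
  (∃ C : ℝ, ∀ t ∈ Set.Ioi (0 : ℝ), ‖u t‖ ≤ C) ∧
  (∀ T : ℝ, 0 < T → ∃ C : ℝ, ∀ t ∈ Set.Ioo (0 : ℝ) T, ‖f (u t)‖ ≤ C) ∧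
  (∀ (φ : S.H) (ψ : ℝ → ℝ), ContDiff ℝ (⊤ : ℕ∞) ψ → HasCompactSupport ψ →
    tsupport ψ ⊆ Set.Ioi (0 : ℝ) →
    ∫ t in Set.Ioi (0 : ℝ),
        (-(l2Pair S (Complex.I • u t) φ) * deriv ψ t
          + (deltaPair S (u t) φ + f (u t) φ) * ψ t) = 0)

/-- `‖∇u‖_{L^∞(I;L²(Ω))}` for a family `u : ℝ → H¹₀(Ω)`. -/
def gradSup (S : DirichletSetting N) (u : ℝ → S.H) (I : Set ℝ) : ℝ :=
  sSup ((fun t => ‖S.grad (u t)‖) '' I)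


/-- The two-sided conclusion of Bégout's Theorem 2.3: for every `r ∈ [2,∞]` and
every `c ∈ Ω`,
`liminf_{t→±∞} |t|^{N(1/2-1/r)} ‖u(t)‖_{L^r(Ω∩{|x-c|<M₀|t|})} ≥ ε |B(0,M₀)|^{-(1/2-1/r)}`. -/
def lowerBoundTwoSided (S : DirichletSetting N) (u : ℝ → S.H) (ε M₀ : ℝ) : Prop :=
  ∀ r : ℝ≥0∞, 2 ≤ r → ∀ c ∈ S.Ω,
    (ENNReal.ofReal ε * (volume (Metric.ball (0 : EucSp N) M₀)) ^ (-((1:ℝ)/2 - (1/r).toReal))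
      ≤ Filter.liminf (fun t : ℝ =>
          ENNReal.ofReal (|t| ^ ((N : ℝ) * ((1:ℝ)/2 - (1/r).toReal))) *
            eLpNorm (S.toL2 (u t)) r (volume.restrict (S.Ω ∩ Metric.ball c (M₀ * |t|))))
        Filter.atTop) ∧
    (ENNReal.ofReal ε * (volume (Metric.ball (0 : EucSp N) M₀)) ^ (-((1:ℝ)/2 - (1/r).toReal))
      ≤ Filter.liminf (fun t : ℝ =>
          ENNReal.ofReal (|t| ^ ((N : ℝ) * ((1:ℝ)/2 - (1/r).toReal))) *
            eLpNorm (S.toL2 (u t)) r (volume.restrict (S.Ω ∩ Metric.ball c (M₀ * |t|))))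
        Filter.atBot)
/-- The energy for the repulsive single power nonlinearity:
`E(v) = (1/2)‖∇v‖²_{L²(Ω)} + (λ/(α+2))‖v‖^{α+2}_{L^{α+2}(Ω)}`. -/
def repulsiveEnergy (S : DirichletSetting N) (lam α : ℝ) (v : S.H) : ℝ :=
  (1 / 2) * ‖S.grad v‖ ^ 2 +
    (lam / (α + 2)) * ((eLpNorm (S.toL2 v) (ENNReal.ofReal (α + 2)) S.μ).toReal) ^ (α + 2)

open scoped Topology in
lemma aux_weak_to_deriv (p q : ℝ → ℝ) (C : ℝ) (hp : ∀ s t, |p t - p s| ≤ C * |t - s|)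
    (hq : Continuous q)
    (hw : ∀ (ψ : ℝ → ℝ), ContDiff ℝ (⊤ : ℕ∞) ψ → HasCompactSupport ψ →
      tsupport ψ ⊆ {t : ℝ | t ≠ 0} → ∫ t : ℝ, (-(p t) * deriv ψ t + q t * ψ t) = 0) (t : ℝ) :
    HasDerivAt p (-q t) t := by
  have hLip : LipschitzWith (Real.nnabs C) p := by
    refine LipschitzWith.of_dist_le_mul fun x y => ?_
    rw [Real.dist_eq, Real.dist_eq]
    refine (hp y x).trans ?_
    simp only [Real.coe_nnabs]
    exact mul_le_mul_of_nonneg_right (le_abs_self C) (abs_nonneg _)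
  have hbd : ∀ x, ‖deriv p x‖ ≤ Real.nnabs C := fun x => norm_deriv_le_of_lipschitz hLip
  have hloc : LocallyIntegrable (deriv p) := by
    have : LocallyIntegrable (fun _ : ℝ => ((Real.nnabs C : NNReal) : ℝ)) :=
      locallyIntegrable_const _
    refine this.mono (measurable_deriv p).aestronglyMeasurable ?_
    filter_upwards with x
    simpa using hbd x
  have hae : ∀ᵐ x : ℝ, x ∈ {t : ℝ | t ≠ 0} → deriv p x + q x = 0 := by
    refine IsOpen.ae_eq_zero_of_integral_contDiff_smul_eq_zero isOpen_ne
      ((hloc.add hq.locallyIntegrable).locallyIntegrableOn _) ?_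
    intro g hg hgc hgs
    have h0 := hw g hg hgc hgs
    have hg1 : ContDiff ℝ 1 g := hg.of_le (by exact_mod_cast le_top)
    obtain ⟨D, hD⟩ := hg1.lipschitzWith_of_hasCompactSupport hgc (by simp)
    have h1 := hLip.integral_lineDeriv_mul_eq (μ := volume) hD hgc 1
    have e1 : ∀ x, lineDeriv ℝ p x 1 = deriv p x := by
      intro x
      unfold lineDeriv
      simp only [smul_eq_mul, mul_one]
      simpa using deriv_comp_const_add p x 0
    have e2 : ∀ x, lineDeriv ℝ g x (-1) = - deriv g x := by
      intro x
      rw [((hg1.differentiable (by simp)) x).lineDeriv_eq_fderiv]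
      simp
    simp only [e1, e2] at h1
    have i1 : Integrable (fun x => g x * deriv p x) := by
      have := hloc.integrable_smul_left_of_hasCompactSupport hg.continuous hgc
      simpa using this
    have i2 : Integrable (fun x => g x * q x) :=
      (hg.continuous.mul hq).integrable_of_hasCompactSupport hgc.mul_right
    have i3 : Integrable (fun x => -(p x) * deriv g x) := by
      refine (Continuous.mul hLip.continuous.neg
        (hg1.continuous_deriv le_rfl)).integrable_of_hasCompactSupport ?_
      exact hgc.deriv.mul_left
    rw [integral_add i3 (by simpa [mul_comm] using i2)] at h0
    simp only [smul_eq_mul, mul_add]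
    rw [integral_add i1 i2]
    calc _ = (∫ x, deriv p x * g x) + ∫ x, q x * g x := by simp only [mul_comm]
      _ = _ := by
        rw [h1, ← h0]; congr 1
        refine integral_congr_ae (Eventually.of_forall fun x => ?_); simp [mul_comm]
  have hae' : ∀ᵐ x : ℝ, deriv p x = - q x := by
    have : ∀ᵐ x : ℝ, x ≠ 0 := by
      simp [ae_iff]
    filter_upwards [hae, this] with x hx hx0
    have := hx hx0
    linarith
  have hint : ∀ s, p s = p 0 + ∫ x in (0:ℝ)..s, - q x := by
    intro s
    have hac : AbsolutelyContinuousOnInterval p 0 s :=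
      (hLip.lipschitzOnWith (s := uIcc 0 s)).absolutelyContinuousOnInterval
    have := hac.integral_deriv_eq_sub
    rw [← intervalIntegral.integral_congr_ae (f := deriv p) (by
      filter_upwards [hae'] with x hx _ using hx), this]
    ring
  have : p = fun s => p 0 + ∫ x in (0:ℝ)..s, - q x := funext hint
  rw [this]
  refine HasDerivAt.const_add _ ?_
  exact intervalIntegral.integral_hasDerivAt_right (hq.neg.intervalIntegrable _ _)
    (hq.neg.stronglyMeasurableAtFilter _ _) hq.neg.continuousAt
open scoped Topology in
lemma aux_time_pos (G D : ℝ → ℝ → ℝ) (C K : ℝ) (hC : 0 ≤ C)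
    (hsymm : ∀ s t, G s t = G t s)
    (hL : ∀ s s' t, |G s t - G s' t| ≤ C * |s - s'|)
    (hD : ∀ s t, HasDerivAt (fun x => G x t) (D s t) s)
    (hlim : ∀ s, ∀ η > 0, ∀ᶠ t in 𝓝 s, D s t + D t s ≤ K + η)
    (T : ℝ) (hT : 0 ≤ T) : G T T - G 0 0 ≤ K * T := by
  have hL2 : ∀ s t t', |G s t - G s t'| ≤ C * |t - t'| := by
    intro s t t'; rw [hsymm s t, hsymm s t']; exact hL _ _ _
  have hcont2 : ∀ s, Continuous (G s) := by
    intro s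
    have : LipschitzWith (Real.nnabs C) (G s) := LipschitzWith.of_dist_le_mul fun x y => by
      rw [Real.dist_eq, Real.dist_eq]
      simpa [abs_of_nonneg hC] using hL2 s x y
    exact this.continuous
  have hDb : ∀ s t, |D s t| ≤ C := by
    intro s t
    have hl : LipschitzWith (Real.nnabs C) (fun x => G x t) :=
      LipschitzWith.of_dist_le_mul fun x y => by
        rw [Real.dist_eq, Real.dist_eq]
        simpa [abs_of_nonneg hC] using hL x y t
    have := norm_deriv_le_of_lipschitz (x₀ := s) hl
    rw [(hD s t).deriv] at this
    simpa [abs_of_nonneg hC] using this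
  -- measurability
  have hDm1 : ∀ t, Measurable (fun s => D s t) := by
    intro t
    have : (fun s => D s t) = deriv (fun x => G x t) := by
      ext s; rw [(hD s t).deriv]
    rw [this]; exact measurable_deriv _
  have hDm2 : ∀ s, Measurable (fun t => D s t) := by
    intro s
    refine measurable_of_tendsto_metrizable
      (f := fun (n : ℕ) t => ((n:ℝ) + 1) * (G (s + 1 / ((n:ℝ) + 1)) t - G s t)) ?_ ?_
    · intro n
      exact (((hcont2 _).sub (hcont2 _)).const_mul _ |>.measurable)
    · rw [tendsto_pi_nhds]
      intro t
      have h1 := (hD s t).tendsto_slope_zero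
      have h2 : Tendsto (fun n : ℕ => 1 / ((n:ℝ) + 1)) atTop (𝓝[≠] 0) := by
        refine tendsto_nhdsWithin_iff.2 ⟨tendsto_one_div_add_atTop_nhds_zero_nat, ?_⟩
        filter_upwards with n
        have : (0:ℝ) < 1 / ((n:ℝ) + 1) := by positivity
        exact this.ne'
      have := h1.comp h2
      refine this.congr fun n => ?_
      simp
  have hii : ∀ (f : ℝ → ℝ), Measurable f → (∀ x, |f x| ≤ C) → ∀ a b, IntervalIntegrable f volume a b := by
    intro f hf hb a b
    rw [intervalIntegrable_iff]
    refine Measure.integrableOn_of_bounded (M := C) ?_ hf.aestronglyMeasurable ?_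
    · rw [uIoc]; simp
    · filter_upwards with x using by simpa using hb x
  -- derivative of M
  have hM : ∀ h : ℝ, ∀ t, HasDerivAt (fun t => ∫ τ in t..(t+h), G t τ)
      (∫ τ in t..(t+h), (D t τ + D τ t)) t := by
    intro h t0
    have e : (fun t => ∫ τ in t..(t+h), G t τ) = fun t =>
        (∫ τ in t..(t+h), G t0 τ) + (∫ τ in t0..(t0+h), G t τ) - (∫ τ in t0..(t0+h), G t0 τ)
        + ((∫ τ in (t0+h)..(t+h), (G t τ - G t0 τ)) - ∫ τ in t0..t, (G t τ - G t0 τ)) := by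
      ext t
      have I : ∀ s a b, IntervalIntegrable (G s) volume a b :=
        fun s a b => (hcont2 s).intervalIntegrable a b
      rw [intervalIntegral.integral_sub (I _ _ _) (I _ _ _),
        intervalIntegral.integral_sub (I _ _ _) (I _ _ _)]
      have a1 := intervalIntegral.integral_add_adjacent_intervals (I t t0 t) (I t t (t+h))
      have a2 := intervalIntegral.integral_add_adjacent_intervals (I t t0 (t0+h)) (I t (t0+h) (t+h))
      have b1 := intervalIntegral.integral_add_adjacent_intervals (I t0 t0 t) (I t0 t (t+h))
      have b2 := intervalIntegral.integral_add_adjacent_intervals (I t0 t0 (t0+h)) (I t0 (t0+h) (t+h))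
      linarith
    have d1 : HasDerivAt (fun t => ∫ τ in t..(t+h), G t0 τ) (G t0 (t0+h) - G t0 t0) t0 := by
      have hP : ∀ s, HasDerivAt (fun t => ∫ τ in (0:ℝ)..t, G t0 τ) (G t0 s) s := fun s =>
        intervalIntegral.integral_hasDerivAt_right ((hcont2 t0).intervalIntegrable _ _)
          ((hcont2 t0).stronglyMeasurableAtFilter _ _) (hcont2 t0).continuousAt
      have := ((hP (t0+h)).comp_add_const t0 h).sub (hP t0)
      refine this.congr_of_eventuallyEq (Eventually.of_forall fun t => ?_)
      simp only [Pi.sub_apply]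
      rw [intervalIntegral.integral_interval_sub_left]
      · exact (hcont2 t0).intervalIntegrable _ _
      · exact (hcont2 t0).intervalIntegrable _ _
    have d2 : HasDerivAt (fun t => ∫ τ in t0..(t0+h), G t τ) (∫ τ in t0..(t0+h), D t0 τ) t0 := by
      refine (intervalIntegral.hasDerivAt_integral_of_dominated_loc_of_lip (bound := fun _ => C)
        (s := univ) univ_mem
        (Eventually.of_forall fun s => (hcont2 s).aestronglyMeasurable)
        ((hcont2 t0).intervalIntegrable _ _) (hDm2 t0).aestronglyMeasurable ?_ (by simp) ?_).2
      · filter_upwards with t _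
        refine LipschitzWith.lipschitzOnWith ?_
        exact LipschitzWith.of_dist_le_mul fun x y => by
          rw [Real.dist_eq, Real.dist_eq]
          simpa [abs_of_nonneg hC] using hL x y t
      · filter_upwards with t _ using hD t0 t
    have d3 : HasDerivAt (fun t => (∫ τ in (t0+h)..(t+h), (G t τ - G t0 τ))
        - ∫ τ in t0..t, (G t τ - G t0 τ)) 0 t0 := by
      have hb : ∀ t, |(∫ τ in (t0+h)..(t+h), (G t τ - G t0 τ))
        - ∫ τ in t0..t, (G t τ - G t0 τ)| ≤ (2 * C) * |t - t0| ^ 2 := by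
        intro t
        have x1 := intervalIntegral.norm_integral_le_of_norm_le_const (a := t0+h) (b := t+h)
          (f := fun τ => G t τ - G t0 τ) (C := C * |t - t0|) (fun τ _ => hL t t0 τ)
        have x2 := intervalIntegral.norm_integral_le_of_norm_le_const (a := t0) (b := t)
          (f := fun τ => G t τ - G t0 τ) (C := C * |t - t0|) (fun τ _ => hL t t0 τ)
        have : t + h - (t0 + h) = t - t0 := by ring
        rw [this] at x1
        refine (abs_sub _ _).trans ?_
        rw [Real.norm_eq_abs] at x1 x2
        nlinarith
      rw [hasDerivAt_iff_isLittleO]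
      simp only [smul_zero, sub_zero, intervalIntegral.integral_same]
      have : (fun t => (2 * C) * |t - t0| ^ 2) =o[𝓝 t0] fun t => t - t0 := by
        have h1 : (fun t : ℝ => (t - t0) ^ 2) =o[𝓝 t0] fun t => (t - t0) := by
          have := Asymptotics.isLittleO_pow_id (𝕜 := ℝ) (n := 2) (by norm_num)
          refine (this.comp_tendsto (k := fun t : ℝ => t - t0) ?_)
          have : Tendsto (fun t : ℝ => t - t0) (𝓝 t0) (𝓝 (t0 - t0)) :=
            (continuous_id.sub continuous_const).tendsto t0
          simpa using this
        simpa using h1.const_mul_left (2 * C)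
      refine Asymptotics.IsBigO.trans_isLittleO (Asymptotics.IsBigO.of_bound 1 ?_) this
      filter_upwards with t
      rw [one_mul, Real.norm_eq_abs, Real.norm_eq_abs]
      exact (hb t).trans (le_abs_self _)
    have hsplit : ∫ τ in t0..(t0+h), (D t0 τ + D τ t0) =
        (∫ τ in t0..(t0+h), D t0 τ) + (G t0 (t0+h) - G t0 t0) := by
      rw [intervalIntegral.integral_add (hii _ (hDm2 t0) (hDb t0) _ _)
        (hii _ (hDm1 t0) (fun x => hDb x t0) _ _)]
      congr 1
      rw [intervalIntegral.integral_eq_sub_of_hasDerivAt (f := fun x => G x t0)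
        (fun x _ => hD x t0) (hii _ (hDm1 t0) (fun x => hDb x t0) _ _), hsymm t0 (t0+h)]
    rw [e, hsplit]
    have := ((d1.add d2).sub_const (∫ τ in t0..(t0+h), G t0 τ)).add d3
    rw [add_zero, add_comm (G t0 (t0 + h) - G t0 t0)] at this
    exact this
  set f : ℕ → ℝ → ℝ := fun n t => ((n:ℝ)+1) * ∫ τ in t..(t+1/((n:ℝ)+1)), (D t τ + D τ t) with hf
  set M : ℕ → ℝ → ℝ := fun n t => ((n:ℝ)+1) * ∫ τ in t..(t+1/((n:ℝ)+1)), G t τ with hMdef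
  have hMd : ∀ n t, HasDerivAt (M n) (f n t) t := fun n t => (hM _ t).const_mul _
  have hfm : ∀ n, Measurable (f n) := by
    intro n
    have : f n = deriv (M n) := by ext s; rw [(hMd n s).deriv]
    rw [this]; exact measurable_deriv _
  have key : ∀ (n : ℕ) (t B : ℝ) (k : ℝ → ℝ), (∀ τ ∈ Icc t (t + 1/((n:ℝ)+1)), k τ ≤ B) →
      IntervalIntegrable k volume t (t+1/((n:ℝ)+1)) →
      ((n:ℝ)+1) * ∫ τ in t..(t+1/((n:ℝ)+1)), k τ ≤ B := by
    intro n t B k hk hki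
    have hn : (0:ℝ) < (n:ℝ) + 1 := by positivity
    have h0 : t ≤ t + 1/((n:ℝ)+1) := by simp; positivity
    have := intervalIntegral.integral_mono_on h0 hki intervalIntegrable_const hk
    simp only [intervalIntegral.integral_const, add_sub_cancel_left, smul_eq_mul] at this
    calc _ ≤ ((n:ℝ)+1) * (1 / ((n:ℝ)+1) * B) := by gcongr
      _ = B := by field_simp
  have hDDi : ∀ t a b, IntervalIntegrable (fun τ => D t τ + D τ t) volume a b := fun t a b =>
    (hii _ (hDm2 t) (hDb t) _ _).add (hii _ (hDm1 t) (fun x => hDb x t) _ _)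
  have hfb : ∀ n t, |f n t| ≤ 2 * C := by
    intro n t
    rw [abs_le]
    constructor
    · have := key n t (2 * C) (fun τ => -(D t τ + D τ t)) (fun τ _ => by
        have h1 := abs_le.1 (hDb t τ); have h2 := abs_le.1 (hDb τ t); linarith) (hDDi t _ _).neg
      rw [intervalIntegral.integral_neg] at this
      simp only [hf]; linarith
    · exact key n t (2 * C) (fun τ => (D t τ + D τ t)) (fun τ _ => by
        have h1 := abs_le.1 (hDb t τ); have h2 := abs_le.1 (hDb τ t); linarith) (hDDi t _ _)
  have hfl : ∀ t, ∀ η > 0, ∀ᶠ n in atTop, f n t ≤ K + η := by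
    intro t η hη
    obtain ⟨δ, hδ, hball⟩ := Metric.eventually_nhds_iff.1 (hlim t η hη)
    have := (tendsto_one_div_add_atTop_nhds_zero_nat (𝕜 := ℝ)).eventually (gt_mem_nhds hδ)
    filter_upwards [this] with n hn
    refine key n t _ _ (fun τ hτ => hball ?_) (hDDi t _ _)
    rw [Real.dist_eq, abs_of_nonneg (by linarith [hτ.1])]
    linarith [hτ.2]
  have hfi : ∀ n, ∫ t in (0:ℝ)..T, f n t = M n T - M n 0 := by
    intro n
    refine intervalIntegral.integral_eq_sub_of_hasDerivAt (fun x _ => hMd n x) ?_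
    rw [intervalIntegrable_iff]
    refine Measure.integrableOn_of_bounded (M := 2 * C) ?_ (hfm n).aestronglyMeasurable ?_
    · rw [uIoc]; simp
    · filter_upwards with x using by simpa using hfb n x
  have hMl : ∀ t, Tendsto (fun n => M n t) atTop (𝓝 (G t t)) := by
    intro t
    rw [tendsto_order]
    have hlim0 := (tendsto_one_div_add_atTop_nhds_zero_nat (𝕜 := ℝ))
    have hb : ∀ n : ℕ, |M n t - G t t| ≤ C * (1 / ((n:ℝ)+1)) := by
      intro n
      have hn : (0:ℝ) < (n:ℝ) + 1 := by positivity
      have aux : ∀ τ ∈ Icc t (t + 1/((n:ℝ)+1)), |G t τ - G t t| ≤ C * (1 / ((n:ℝ)+1)) := by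
        intro τ hτ
        refine (hL2 t τ t).trans ?_
        rw [abs_of_nonneg (by linarith [hτ.1])]
        have := hτ.2
        gcongr; linarith
      rw [abs_le]
      constructor
      · have := key n t (-(G t t) + C * (1 / ((n:ℝ)+1))) (fun τ => - G t τ) (fun τ hτ => by
          have := abs_le.1 (aux τ hτ); linarith) ((hcont2 t).neg.intervalIntegrable _ _)
        rw [intervalIntegral.integral_neg] at this
        simp only [hMdef]; linarith
      · have := key n t (G t t + C * (1 / ((n:ℝ)+1))) (fun τ => G t τ) (fun τ hτ => by
          have := abs_le.1 (aux τ hτ); linarith) ((hcont2 t).intervalIntegrable _ _)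
        simp only [hMdef]; linarith
    have : Tendsto (fun n => M n t) atTop (𝓝 (G t t)) := by
      rw [tendsto_iff_dist_tendsto_zero]
      refine squeeze_zero (g := fun n : ℕ => C * (1 / ((n:ℝ)+1))) (fun _ => dist_nonneg)
        (fun n => hb n) ?_
      simpa using hlim0.const_mul C
    exact (tendsto_order.1 this)
  -- dominated convergence
  have hdom : Tendsto (fun n => ∫ t in (0:ℝ)..T, max (f n t - K) 0) atTop
      (𝓝 (∫ t in (0:ℝ)..T, (0:ℝ))) := by
    refine intervalIntegral.tendsto_integral_filter_of_dominated_convergence (fun _ => 2 * C + |K|)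
      (Eventually.of_forall fun n => (((hfm n).sub_const K).max measurable_const).aestronglyMeasurable)
      (Eventually.of_forall fun n => Eventually.of_forall fun t _ => ?_) (by simp)
      (Eventually.of_forall fun t _ => ?_)
    · rw [Real.norm_eq_abs, abs_of_nonneg (le_max_right _ _)]
      have := abs_le.1 (hfb n t)
      have := neg_abs_le K
      have := abs_nonneg K
      refine max_le (by linarith) (by linarith)
    · rw [Metric.tendsto_nhds]
      intro η hη
      filter_upwards [hfl t (η/2) (by positivity)] with n hn
      rw [Real.dist_eq, sub_zero, abs_of_nonneg (le_max_right _ _)]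
      exact max_lt (by linarith) hη
  rw [intervalIntegral.integral_zero] at hdom
  have hle : ∀ n, M n T - M n 0 ≤ (∫ t in (0:ℝ)..T, max (f n t - K) 0) + K * T := by
    intro n
    rw [← hfi n]
    have : (∫ t in (0:ℝ)..T, max (f n t - K) 0) + K * T =
        ∫ t in (0:ℝ)..T, (max (f n t - K) 0 + K) := by
      rw [intervalIntegral.integral_add _ intervalIntegrable_const]
      · simp [mul_comm]
      · rw [intervalIntegrable_iff]
        refine Measure.integrableOn_of_bounded (M := 2 * C + |K|) (by rw [uIoc]; simp)
          (((hfm n).sub_const K).max measurable_const).aestronglyMeasurable ?_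
        filter_upwards with t
        rw [Real.norm_eq_abs, abs_of_nonneg (le_max_right _ _)]
        have := abs_le.1 (hfb n t)
        have := neg_abs_le K
        have := abs_nonneg K
        refine max_le (by linarith) (by linarith)
    rw [this]
    refine intervalIntegral.integral_mono_on hT ?_ ?_ (fun t _ => ?_)
    · rw [intervalIntegrable_iff]
      refine Measure.integrableOn_of_bounded (M := 2 * C) (by rw [uIoc]; simp)
        (hfm n).aestronglyMeasurable ?_
      filter_upwards with x using by simpa using hfb n x
    · refine IntervalIntegrable.add ?_ intervalIntegrable_const
      rw [intervalIntegrable_iff]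
      refine Measure.integrableOn_of_bounded (M := 2 * C + |K|) (by rw [uIoc]; simp)
        (((hfm n).sub_const K).max measurable_const).aestronglyMeasurable ?_
      filter_upwards with t
      rw [Real.norm_eq_abs, abs_of_nonneg (le_max_right _ _)]
      have := abs_le.1 (hfb n t)
      have := neg_abs_le K
      have := abs_nonneg K
      refine max_le (by linarith) (by linarith)
    · have := le_max_left (f n t - K) 0
      linarith
  have := le_of_tendsto_of_tendsto' ((hMl T).sub (hMl 0)) (hdom.add_const (K * T)) hle
  linarith

open scoped Topology in
lemma aux_time (G D : ℝ → ℝ → ℝ) (C K : ℝ) (hC : 0 ≤ C)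
    (hsymm : ∀ s t, G s t = G t s)
    (hL : ∀ s s' t, |G s t - G s' t| ≤ C * |s - s'|)
    (hD : ∀ s t, HasDerivAt (fun x => G x t) (D s t) s)
    (hlim : ∀ s, ∀ η > 0, ∀ᶠ t in 𝓝 s, |D s t + D t s| ≤ K + η)
    (T : ℝ) : G T T - G 0 0 ≤ K * |T| := by
  rcases le_total 0 T with hT | hT
  · rw [abs_of_nonneg hT]
    exact aux_time_pos G D C K hC hsymm hL hD
      (fun s η hη => (hlim s η hη).mono fun t ht => (le_abs_self _).trans ht) T hT
  · have := aux_time_pos (fun s t => G (-s) (-t)) (fun s t => - D (-s) (-t)) C K hC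
      (fun s t => hsymm _ _)
      (fun s s' t => by
        refine (hL (-s) (-s') (-t)).trans (le_of_eq ?_)
        rw [← abs_neg (s - s')]; congr 2; ring)
      (fun s t => by
        have := (hD (-s) (-t)).scomp s (hasDerivAt_neg s)
        simpa [Function.comp_def] using this)
      (fun s η hη => by
        have h2 : Tendsto (fun t : ℝ => -t) (𝓝 s) (𝓝 (-s)) := continuous_neg.tendsto s
        filter_upwards [h2.eventually (hlim (-s) η hη)] with t ht
        have := neg_abs_le (D (-s) (-t) + D (-t) (-s))
        linarith) (-T) (by linarith)
    rw [abs_of_nonpos hT]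
    simpa using this
def powF (α : ℝ) (x : ℂ) : ℂ := ((‖x‖ ^ α : ℝ) : ℂ) * x

lemma norm_powF {α : ℝ} (hα : 0 ≤ α) (x : ℂ) : ‖powF α x‖ = ‖x‖ ^ (α + 1) := by
  unfold powF
  rw [norm_mul, Complex.norm_real, Real.norm_eq_abs, abs_of_nonneg (by positivity)]
  rw [Real.rpow_add_one' (norm_nonneg _) (by linarith)]

lemma powF_lip_aux {α : ℝ} (hα : 0 ≤ α) (x y : ℂ) (hxy : ‖y‖ ≤ ‖x‖) :
    ‖powF α x - powF α y‖ ≤ (α + 1) * ‖x‖ ^ α * ‖x - y‖ := by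
  rcases eq_or_lt_of_le (norm_nonneg x) with h0 | h0
  · have hx : x = 0 := norm_eq_zero.1 h0.symm
    have hy : y = 0 := by rw [← norm_le_zero_iff]; linarith
    simp [hx, hy]
  have e : powF α x - powF α y = ((‖x‖ ^ α : ℝ) : ℂ) * (x - y)
      + ((‖x‖ ^ α - ‖y‖ ^ α : ℝ) : ℂ) * y := by
    unfold powF; push_cast; ring
  have hm : ‖y‖ ^ α ≤ ‖x‖ ^ α := Real.rpow_le_rpow (norm_nonneg _) hxy hα
  have hB : 1 + (α + 1) * (‖y‖ / ‖x‖ - 1) ≤ (1 + (‖y‖ / ‖x‖ - 1)) ^ (α + 1) :=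
    one_add_mul_self_le_rpow_one_add (by have : 0 ≤ ‖y‖ / ‖x‖ := by positivity
                                         linarith) (by linarith)
  have e2 : 1 + (‖y‖ / ‖x‖ - 1) = ‖y‖ / ‖x‖ := by ring
  rw [e2, Real.div_rpow (norm_nonneg _) (norm_nonneg _),
    Real.rpow_add_one' (norm_nonneg _) (by linarith),
    Real.rpow_add_one' (norm_nonneg _) (by linarith)] at hB
  have hxa : 0 < ‖x‖ ^ α := Real.rpow_pos_of_pos h0 _
  have hB2 : (‖x‖ ^ α - ‖y‖ ^ α) * ‖y‖ ≤ α * ‖x‖ ^ α * (‖x‖ - ‖y‖) := by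
    have h3 : ‖y‖ ^ α * ‖y‖ / (‖x‖ ^ α * ‖x‖) * (‖x‖ ^ α * ‖x‖) = ‖y‖ ^ α * ‖y‖ := by
      field_simp
    have h4 := mul_le_mul_of_nonneg_right hB (by positivity : 0 ≤ ‖x‖ ^ α * ‖x‖)
    rw [h3] at h4
    have h5 : (1 + (α + 1) * (‖y‖ / ‖x‖ - 1)) * (‖x‖ ^ α * ‖x‖)
        = ‖x‖ ^ α * ‖x‖ + (α + 1) * ‖x‖ ^ α * (‖y‖ - ‖x‖) := by
      field_simp
    rw [h5] at h4
    nlinarith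
  have hs : ‖x‖ - ‖y‖ ≤ ‖x - y‖ := norm_sub_norm_le x y
  rw [e]
  refine (norm_add_le _ _).trans ?_
  rw [norm_mul, norm_mul, Complex.norm_real, Complex.norm_real, Real.norm_eq_abs, Real.norm_eq_abs,
    abs_of_pos hxa, abs_of_nonneg (by linarith)]
  have : α * ‖x‖ ^ α * (‖x‖ - ‖y‖) ≤ α * ‖x‖ ^ α * ‖x - y‖ := by gcongr
  nlinarith

lemma powF_lip {α : ℝ} (hα : 0 ≤ α) (x y : ℂ) (ρ : ℝ) (hx : ‖x‖ ≤ ρ) (hy : ‖y‖ ≤ ρ) :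
    ‖powF α x - powF α y‖ ≤ (α + 1) * ρ ^ α * ‖x - y‖ := by
  rcases le_total ‖y‖ ‖x‖ with h | h
  · refine (powF_lip_aux hα x y h).trans ?_
    gcongr
  · rw [norm_sub_rev, norm_sub_rev x y]
    refine (powF_lip_aux hα y x h).trans ?_
    gcongr

lemma rpow_bd {p : ℝ} (hp : 0 ≤ p) {a b c : ℝ} (ha : 0 ≤ a) (hb : 0 ≤ b) (hc : 0 ≤ c)
    (h : c ≤ max a b) : c ^ p ≤ a ^ p + b ^ p := by
  rcases max_cases a b with ⟨h1, _⟩ | ⟨h1, _⟩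
  · have := Real.rpow_le_rpow hc (h1 ▸ h) hp
    have := Real.rpow_nonneg hb p
    linarith
  · have := Real.rpow_le_rpow hc (h1 ▸ h) hp
    have := Real.rpow_nonneg ha p
    linarith

lemma powF_P1 {α : ℝ} (hα : 0 ≤ α) (x y w : ℂ) (δ M : ℝ) (hδ : 0 < δ) (hM : 0 ≤ M) :
    ‖powF α x - powF α y‖ * ‖w‖ ≤ 2 * δ * (‖x‖ ^ (α + 2) + ‖y‖ ^ (α + 2))
      + (α + 1) * (M / δ) ^ α * (‖x - y‖ * ‖w‖)
      + 2 * (δ⁻¹) ^ (α + 1) * ({w : ℂ | M < ‖w‖}.indicator (fun w => ‖w‖ ^ (α + 2)) w) := by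
  set Z := max ‖x‖ ‖y‖ with hZ
  have hZ0 : 0 ≤ Z := (norm_nonneg x).trans (le_max_left _ _)
  have hind : 0 ≤ {w : ℂ | M < ‖w‖}.indicator (fun w => ‖w‖ ^ (α + 2)) w :=
    indicator_nonneg (fun _ _ => by positivity) _
  have hT : ‖powF α x - powF α y‖ ≤ 2 * Z ^ (α + 1) := by
    refine (norm_sub_le _ _).trans ?_
    rw [norm_powF hα, norm_powF hα]
    have h1 := Real.rpow_le_rpow (norm_nonneg x) (le_max_left ‖x‖ ‖y‖) (by linarith : 0 ≤ α + 1)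
    have h2 := Real.rpow_le_rpow (norm_nonneg y) (le_max_right ‖x‖ ‖y‖) (by linarith : 0 ≤ α + 1)
    rw [← hZ] at h1 h2
    linarith
  have hsplit : ∀ a : ℝ, 0 ≤ a → a ^ (α + 2) = a ^ (α + 1) * a := by
    intro a ha
    rw [← Real.rpow_add_one' ha (by linarith)]; congr 1; ring
  by_cases h1 : ‖w‖ ≤ δ * Z
  · have h2 : ‖powF α x - powF α y‖ * ‖w‖ ≤ 2 * Z ^ (α + 1) * (δ * Z) := by gcongr
    have h3 : Z ^ (α + 2) ≤ ‖x‖ ^ (α + 2) + ‖y‖ ^ (α + 2) :=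
      rpow_bd (by linarith) (norm_nonneg _) (norm_nonneg _) hZ0 le_rfl
    have h4 : 2 * Z ^ (α + 1) * (δ * Z) = 2 * δ * Z ^ (α + 2) := by rw [hsplit Z hZ0]; ring
    have h5 : 2 * δ * Z ^ (α + 2) ≤ 2 * δ * (‖x‖ ^ (α + 2) + ‖y‖ ^ (α + 2)) := by gcongr
    have h6 : 0 ≤ (α + 1) * (M / δ) ^ α * (‖x - y‖ * ‖w‖) := by positivity
    have h7 : 0 ≤ 2 * (δ⁻¹) ^ (α + 1) * ({w : ℂ | M < ‖w‖}.indicator (fun w => ‖w‖ ^ (α + 2)) w) := by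
      positivity
    linarith
  · push Not at h1
    have hZw : Z ≤ ‖w‖ / δ := by rw [le_div_iff₀ hδ]; linarith
    have h8 : 0 ≤ 2 * δ * (‖x‖ ^ (α + 2) + ‖y‖ ^ (α + 2)) := by positivity
    by_cases hw : M < ‖w‖
    · have : ({w : ℂ | M < ‖w‖}.indicator (fun w => ‖w‖ ^ (α + 2)) w) = ‖w‖ ^ (α + 2) :=
        indicator_of_mem (s := {w : ℂ | M < ‖w‖}) hw _
      rw [this]
      have h9 : ‖powF α x - powF α y‖ * ‖w‖ ≤ 2 * (‖w‖ / δ) ^ (α + 1) * ‖w‖ := by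
        refine mul_le_mul_of_nonneg_right (hT.trans ?_) (norm_nonneg _)
        gcongr
      have h10 : 2 * (‖w‖ / δ) ^ (α + 1) * ‖w‖ = 2 * (δ⁻¹) ^ (α + 1) * ‖w‖ ^ (α + 2) := by
        rw [hsplit _ (norm_nonneg w), div_eq_mul_inv, Real.mul_rpow (norm_nonneg _) (by positivity)]
        ring
      have h6 : 0 ≤ (α + 1) * (M / δ) ^ α * (‖x - y‖ * ‖w‖) := by positivity
      linarith
    · push Not at hw
      have hZM : Z ≤ M / δ := hZw.trans (by gcongr)
      have := powF_lip hα x y (M / δ) ((le_max_left _ _).trans hZM) ((le_max_right _ _).trans hZM)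
      have h9 := mul_le_mul_of_nonneg_right this (norm_nonneg w)
      have h7 : 0 ≤ 2 * (δ⁻¹) ^ (α + 1) * ({w : ℂ | M < ‖w‖}.indicator (fun w => ‖w‖ ^ (α + 2)) w) := by
        positivity
      rw [mul_assoc] at h9
      linarith

lemma powF_P2 {α : ℝ} (hα : 0 ≤ α) (y z : ℂ) (δ M : ℝ) (hδ : 0 < δ) (hδ1 : δ ≤ 1) (hM : 0 ≤ M) :
    ‖powF α y‖ * ‖z‖ ≤ δ * ‖z‖ ^ (α + 2) + M ^ α * (‖z‖ * ‖y‖)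
      + δ⁻¹ * ({w : ℂ | M < ‖w‖}.indicator (fun w => ‖w‖ ^ (α + 2)) y) := by
  have hind : 0 ≤ {w : ℂ | M < ‖w‖}.indicator (fun w => ‖w‖ ^ (α + 2)) y :=
    indicator_nonneg (fun _ _ => by positivity) _
  have hsplit : ∀ a : ℝ, 0 ≤ a → a ^ (α + 2) = a ^ (α + 1) * a := by
    intro a ha
    rw [← Real.rpow_add_one' ha (by linarith)]; congr 1; ring
  rw [norm_powF hα]
  have t1 : 0 ≤ δ * ‖z‖ ^ (α + 2) := by positivity
  have t2 : 0 ≤ M ^ α * (‖z‖ * ‖y‖) := by positivity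
  have t3 : 0 ≤ δ⁻¹ * ({w : ℂ | M < ‖w‖}.indicator (fun w => ‖w‖ ^ (α + 2)) y) := by positivity
  by_cases h1 : ‖y‖ ≤ δ * ‖z‖
  · have : ‖y‖ ^ (α + 1) * ‖z‖ ≤ (δ * ‖z‖) ^ (α + 1) * ‖z‖ := by gcongr
    rw [Real.mul_rpow hδ.le (norm_nonneg _), mul_assoc, ← hsplit _ (norm_nonneg z)] at this
    have h2 : δ ^ (α + 1) ≤ δ := by
      calc δ ^ (α + 1) ≤ δ ^ (1:ℝ) := Real.rpow_le_rpow_of_exponent_ge hδ hδ1 (by linarith)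
        _ = δ := Real.rpow_one δ
    have h3 : δ ^ (α + 1) * ‖z‖ ^ (α + 2) ≤ δ * ‖z‖ ^ (α + 2) := by gcongr
    linarith
  · push Not at h1
    by_cases hy : M < ‖y‖
    · have : ({w : ℂ | M < ‖w‖}.indicator (fun w => ‖w‖ ^ (α + 2)) y) = ‖y‖ ^ (α + 2) :=
        indicator_of_mem (s := {w : ℂ | M < ‖w‖}) hy _
      rw [this] at t3 ⊢
      have hz : ‖z‖ ≤ δ⁻¹ * ‖y‖ := by
        rw [inv_mul_eq_div, le_div_iff₀ hδ]; linarith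
      have : ‖y‖ ^ (α + 1) * ‖z‖ ≤ ‖y‖ ^ (α + 1) * (δ⁻¹ * ‖y‖) := by gcongr
      have h2 : ‖y‖ ^ (α + 1) * (δ⁻¹ * ‖y‖) = δ⁻¹ * ‖y‖ ^ (α + 2) := by
        rw [hsplit _ (norm_nonneg y)]; ring
      linarith
    · push Not at hy
      have h2 : ‖y‖ ^ (α + 1) * ‖z‖ = ‖y‖ ^ α * (‖z‖ * ‖y‖) := by
        rw [Real.rpow_add_one' (norm_nonneg _) (by linarith)]; ring
      have h3 : ‖y‖ ^ α * (‖z‖ * ‖y‖) ≤ M ^ α * (‖z‖ * ‖y‖) := by gcongr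
      linarith
lemma aux_tail {X : Type*} [MeasurableSpace X] {μ : Measure X} (w : X → ℂ)
    (hwm : AEStronglyMeasurable w μ) (p : ℝ)
    (hw : Integrable (fun x => ‖w x‖ ^ p) μ) (η : ℝ) (hη : 0 < η) :
    ∃ M : ℝ, 0 ≤ M ∧ ∫ x, {w : ℂ | M < ‖w‖}.indicator (fun w => ‖w‖ ^ p) (w x) ∂μ < η := by
  have hms : ∀ M : ℝ, MeasurableSet {w : ℂ | M < ‖w‖} := fun M =>
    measurableSet_lt measurable_const measurable_norm
  have : Tendsto (fun n : ℕ => ∫ x, {w : ℂ | (n:ℝ) < ‖w‖}.indicator (fun w => ‖w‖ ^ p) (w x) ∂μ)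
      atTop (nhds (∫ _, (0:ℝ) ∂μ)) := by
    refine tendsto_integral_of_dominated_convergence (fun x => ‖w x‖ ^ p) ?_ hw ?_ ?_
    · intro n
      have : Measurable (fun w : ℂ => {w : ℂ | (n:ℝ) < ‖w‖}.indicator (fun w => ‖w‖ ^ p) w) :=
        (measurable_norm.pow_const p).indicator (hms n)
      exact (this.comp_aemeasurable hwm.aemeasurable).aestronglyMeasurable
    · intro n
      filter_upwards with x
      refine (norm_indicator_le_norm_self _ _).trans ?_
      rw [Real.norm_eq_abs, abs_of_nonneg (by positivity)]
    · filter_upwards with x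
      refine tendsto_const_nhds.congr' ?_
      filter_upwards [eventually_ge_atTop ⌈‖w x‖⌉₊] with n hn
      rw [indicator_of_notMem]
      simp only [mem_ofPred_eq, not_lt]
      exact (Nat.le_ceil _).trans (by exact_mod_cast hn)
  rw [integral_zero] at this
  obtain ⟨n, hn⟩ := (this.eventually (gt_mem_nhds hη)).exists
  exact ⟨n, by positivity, hn⟩

lemma aux_tail_int {X : Type*} [MeasurableSpace X] {μ : Measure X} (w : X → ℂ)
    (hwm : AEStronglyMeasurable w μ) (p M : ℝ)
    (hw : Integrable (fun x => ‖w x‖ ^ p) μ) :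
    Integrable (fun x => {w : ℂ | M < ‖w‖}.indicator (fun w => ‖w‖ ^ p) (w x)) μ := by
  refine hw.mono ?_ ?_
  · have : Measurable (fun w : ℂ => {w : ℂ | M < ‖w‖}.indicator (fun w => ‖w‖ ^ p) w) :=
      (measurable_norm.pow_const p).indicator (measurableSet_lt measurable_const measurable_norm)
    exact (this.comp_aemeasurable hwm.aemeasurable).aestronglyMeasurable
  · filter_upwards with x
    exact norm_indicator_le_norm_self _ _

lemma aux_L2_int {X E F : Type*} [MeasurableSpace X] {μ : Measure X} [NormedAddCommGroup E]
    [NormedAddCommGroup F] (f : Lp E 2 μ) (g : Lp F 2 μ) :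
    Integrable (fun x => ‖f x‖ * ‖g x‖) μ :=
  (Lp.memLp f).norm.integrable_mul (Lp.memLp g).norm

lemma aux_L2_norm {X E : Type*} [MeasurableSpace X] {μ : Measure X} [NormedAddCommGroup E]
    (f : Lp E 2 μ) : (∫ a, ‖f a‖ ^ (2:ℝ) ∂μ) ^ (1 / (2:ℝ)) = ‖f‖ := by
  rw [Lp.norm_def, (Lp.memLp f).eLpNorm_eq_integral_rpow_norm (by simp) (by simp),
    ENNReal.toReal_ofReal (by positivity)]
  simp

lemma aux_L2_le {X E F : Type*} [MeasurableSpace X] {μ : Measure X} [NormedAddCommGroup E]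
    [NormedAddCommGroup F] (f : Lp E 2 μ) (g : Lp F 2 μ) :
    ∫ x, ‖f x‖ * ‖g x‖ ∂μ ≤ ‖f‖ * ‖g‖ := by
  have h := integral_mul_norm_le_Lp_mul_Lq (μ := μ) (f := fun x => ‖f x‖) (g := fun x => ‖g x‖)
    Real.HolderConjugate.two_two
    (by simpa using (Lp.memLp f).norm) (by simpa using (Lp.memLp g).norm)
  simp only [norm_norm] at h
  rwa [aux_L2_norm f, aux_L2_norm g] at h

lemma powF_cont (α : ℝ) (hα : 0 ≤ α) : Continuous (powF α) := by
  unfold powF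
  refine (Complex.continuous_ofReal.comp ?_).mul continuous_id
  exact continuous_norm.rpow_const (fun _ => Or.inr hα)

lemma powF_int {X : Type*} [MeasurableSpace X] {μ : Measure X} {α : ℝ} (hα : 0 ≤ α)
    (y w : X → ℂ) (hym : AEStronglyMeasurable y μ) (hwm : AEStronglyMeasurable w μ)
    (hy : Integrable (fun x => ‖y x‖ ^ (α + 2)) μ) (hw : Integrable (fun x => ‖w x‖ ^ (α + 2)) μ) :
    Integrable (fun x => powF α (y x) * (starRingEnd ℂ) (w x)) μ := by
  refine (hy.add hw).mono ?_ ?_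
  · exact ((powF_cont α hα).comp_aestronglyMeasurable hym).mul
      (Complex.continuous_conj.comp_aestronglyMeasurable hwm)
  · filter_upwards with x
    rw [norm_mul, RCLike.norm_conj, norm_powF hα, Real.norm_eq_abs]
    refine le_trans ?_ (le_abs_self _)
    simp only [Pi.add_apply]
    have h1 : ‖y x‖ ^ (α+1) * ‖w x‖ ≤ (max ‖y x‖ ‖w x‖) ^ (α + 1) * max ‖y x‖ ‖w x‖ := by
      gcongr
      · exact le_max_left _ _
      · exact le_max_right _ _
    rw [← Real.rpow_add_one' (by positivity) (by linarith)] at h1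
    refine h1.trans ?_
    have : α + 1 + 1 = α + 2 := by ring
    rw [this]
    exact rpow_bd (by linarith) (norm_nonneg _) (norm_nonneg _) (by positivity) le_rfl

lemma powF_tendsto1 {X ι : Type*} [MeasurableSpace X] {μ : Measure X} {α : ℝ} (hα : 0 ≤ α)
    {l : Filter ι} (x : ι → Lp ℂ 2 μ) (y w : Lp ℂ 2 μ) (hxy : Tendsto x l (nhds y)) (B : ℝ)
    (hx : ∀ i, Integrable (fun z => ‖x i z‖ ^ (α + 2)) μ)
    (hxB : ∀ i, ∫ z, ‖x i z‖ ^ (α + 2) ∂μ ≤ B)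
    (hy : Integrable (fun z => ‖y z‖ ^ (α + 2)) μ)
    (hw : Integrable (fun z => ‖w z‖ ^ (α + 2)) μ) :
    Tendsto (fun i => ∫ z, powF α (x i z) * (starRingEnd ℂ) (w z) ∂μ) l
      (nhds (∫ z, powF α (y z) * (starRingEnd ℂ) (w z) ∂μ)) := by
  have mm : ∀ f : Lp ℂ 2 μ, AEStronglyMeasurable f μ := fun f => (Lp.aestronglyMeasurable f)
  rw [Metric.tendsto_nhds]
  intro η hη
  set B' := |B| + ∫ z, ‖y z‖ ^ (α + 2) ∂μ with hB'
  have hB'0 : 0 ≤ B' := by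
    have : 0 ≤ ∫ z, ‖y z‖ ^ (α + 2) ∂μ := integral_nonneg fun _ => by positivity
    positivity
  obtain ⟨δ, hδ, hδB⟩ : ∃ δ : ℝ, 0 < δ ∧ 2 * δ * B' ≤ η / 4 := by
    refine ⟨η / (8 * (B' + 1)), by positivity, ?_⟩
    rw [show 2 * (η / (8 * (B' + 1))) * B' = (η / 4) * (B' / (B' + 1)) by field_simp; ring]
    have : B' / (B' + 1) ≤ 1 := by rw [div_le_one (by positivity)]; linarith
    nlinarith
  set c := 2 * (δ⁻¹) ^ (α + 1) with hc
  have hc0 : 0 < c := by positivity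
  obtain ⟨M, hM, hMt⟩ := aux_tail w (mm w) (α + 2) hw (η / (4 * c)) (by positivity)
  set A := (α + 1) * (M / δ) ^ α with hA
  have hA0 : 0 ≤ A := by positivity
  have hn : Tendsto (fun i => A * (‖x i - y‖ * ‖w‖)) l (nhds 0) := by
    have h1 : Tendsto (fun i => ‖x i - y‖) l (nhds 0) := by
      have := (hxy.sub_const y).norm; simpa using this
    have := (h1.mul_const ‖w‖).const_mul A
    simpa using this
  filter_upwards [hn.eventually (gt_mem_nhds (by positivity : (0:ℝ) < η / 4))] with i hi
  rw [dist_eq_norm, ← integral_sub (powF_int hα _ _ (mm _) (mm _) (hx i) hw)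
    (powF_int hα _ _ (mm _) (mm _) hy hw)]
  have hI3 := (aux_tail_int w (mm w) (α + 2) M hw).const_mul c
  have hI2 := (aux_L2_int (x i - y) w).const_mul A
  have hI1 : Integrable (fun z => 2 * δ * (‖x i z‖ ^ (α + 2) + ‖y z‖ ^ (α + 2))) μ :=
    ((hx i).add hy).const_mul (2 * δ)
  have hI12 : Integrable (fun z => 2 * δ * (‖x i z‖ ^ (α + 2) + ‖y z‖ ^ (α + 2))
    + A * (‖(x i - y : Lp ℂ 2 μ) z‖ * ‖w z‖)) μ := hI1.add hI2
  have hle : ‖∫ z, (powF α (x i z) * (starRingEnd ℂ) (w z) - powF α (y z) * (starRingEnd ℂ) (w z)) ∂μ‖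
      ≤ ∫ z, (2 * δ * (‖x i z‖ ^ (α + 2) + ‖y z‖ ^ (α + 2)) + A * (‖(x i - y : Lp ℂ 2 μ) z‖ * ‖w z‖)
        + c * {w : ℂ | M < ‖w‖}.indicator (fun w => ‖w‖ ^ (α + 2)) (w z)) ∂μ := by
    refine norm_integral_le_of_norm_le (hI12.add hI3) ?_
    filter_upwards [Lp.coeFn_sub (x i) y] with z hz
    rw [hz, ← sub_mul, norm_mul, RCLike.norm_conj]
    exact powF_P1 hα _ _ _ δ M hδ hM
  refine hle.trans_lt ?_
  have e1 : ∫ z, (2 * δ * (‖x i z‖ ^ (α + 2) + ‖y z‖ ^ (α + 2)) + A * (‖(x i - y : Lp ℂ 2 μ) z‖ * ‖w z‖)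
        + c * {w : ℂ | M < ‖w‖}.indicator (fun w => ‖w‖ ^ (α + 2)) (w z)) ∂μ =
      2 * δ * ((∫ z, ‖x i z‖ ^ (α + 2) ∂μ) + ∫ z, ‖y z‖ ^ (α + 2) ∂μ)
      + A * ∫ z, (‖(x i - y : Lp ℂ 2 μ) z‖ * ‖w z‖) ∂μ
      + c * ∫ z, {w : ℂ | M < ‖w‖}.indicator (fun w => ‖w‖ ^ (α + 2)) (w z) ∂μ := by
    rw [integral_add hI12 hI3]
    rw [integral_add hI1 hI2, integral_const_mul, integral_const_mul, integral_const_mul,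
      integral_add (hx i) hy]
  rw [e1]
  have h1 : 2 * δ * ((∫ z, ‖x i z‖ ^ (α + 2) ∂μ) + ∫ z, ‖y z‖ ^ (α + 2) ∂μ) ≤ 2 * δ * B' := by
    have := (hxB i).trans (le_abs_self B)
    rw [hB']
    gcongr
  have h2 : A * ∫ z, (‖(x i - y : Lp ℂ 2 μ) z‖ * ‖w z‖) ∂μ ≤ A * (‖x i - y‖ * ‖w‖) := by
    gcongr; exact aux_L2_le _ _
  have h3 : c * ∫ z, {w : ℂ | M < ‖w‖}.indicator (fun w => ‖w‖ ^ (α + 2)) (w z) ∂μ < η / 4 := by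
    calc _ < c * (η / (4 * c)) := by gcongr
      _ = η / 4 := by field_simp
  linarith

lemma powF_tendsto2 {X ι : Type*} [MeasurableSpace X] {μ : Measure X} {α : ℝ} (hα : 0 ≤ α)
    {l : Filter ι} (x : ι → Lp ℂ 2 μ) (y w : Lp ℂ 2 μ) (hxy : Tendsto x l (nhds y)) (B : ℝ)
    (hx : ∀ i, Integrable (fun z => ‖x i z‖ ^ (α + 2)) μ)
    (hxB : ∀ i, ∫ z, ‖x i z‖ ^ (α + 2) ∂μ ≤ B)
    (hy : Integrable (fun z => ‖y z‖ ^ (α + 2)) μ)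
    (hw : Integrable (fun z => ‖w z‖ ^ (α + 2)) μ) :
    Tendsto (fun i => ∫ z, powF α (w z) * (starRingEnd ℂ) (x i z) ∂μ) l
      (nhds (∫ z, powF α (w z) * (starRingEnd ℂ) (y z) ∂μ)) := by
  have mm : ∀ f : Lp ℂ 2 μ, AEStronglyMeasurable f μ := fun f => (Lp.aestronglyMeasurable f)
  rw [Metric.tendsto_nhds]
  intro η hη
  set B' := 2 ^ (α + 2) * (|B| + ∫ z, ‖y z‖ ^ (α + 2) ∂μ) with hB'
  have hB'0 : 0 ≤ B' := by
    have : 0 ≤ ∫ z, ‖y z‖ ^ (α + 2) ∂μ := integral_nonneg fun _ => by positivity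
    positivity
  obtain ⟨δ, hδ, hδ1, hδB⟩ : ∃ δ : ℝ, 0 < δ ∧ δ ≤ 1 ∧ δ * B' ≤ η / 4 := by
    refine ⟨min 1 (η / (4 * (B' + 1))), by positivity, min_le_left _ _, ?_⟩
    have h0 : min 1 (η / (4 * (B' + 1))) * B' ≤ η / (4 * (B' + 1)) * B' := by
      gcongr; exact min_le_right _ _
    refine h0.trans ?_
    rw [show (η / (4 * (B' + 1))) * B' = (η / 4) * (B' / (B' + 1)) by field_simp]
    have : B' / (B' + 1) ≤ 1 := by rw [div_le_one (by positivity)]; linarith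
    nlinarith
  set c := δ⁻¹ with hc
  have hc0 : 0 < c := by positivity
  obtain ⟨M, hM, hMt⟩ := aux_tail w (mm w) (α + 2) hw (η / (4 * c)) (by positivity)
  set A := M ^ α with hA
  have hA0 : 0 ≤ A := by positivity
  have hn : Tendsto (fun i => A * (‖x i - y‖ * ‖w‖)) l (nhds 0) := by
    have h1 : Tendsto (fun i => ‖x i - y‖) l (nhds 0) := by
      have := (hxy.sub_const y).norm; simpa using this
    have := (h1.mul_const ‖w‖).const_mul A
    simpa using this
  filter_upwards [hn.eventually (gt_mem_nhds (by positivity : (0:ℝ) < η / 4))] with i hi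
  rw [dist_eq_norm, ← integral_sub (powF_int hα _ _ (mm _) (mm _) hw (hx i))
    (powF_int hα _ _ (mm _) (mm _) hw hy)]
  have hI3 := (aux_tail_int w (mm w) (α + 2) M hw).const_mul c
  have hI2 := (aux_L2_int (x i - y) w).const_mul A
  have hI1 : Integrable (fun z => δ * (2 ^ (α + 2) * (‖x i z‖ ^ (α + 2) + ‖y z‖ ^ (α + 2)))) μ :=
    (((hx i).add hy).const_mul (2 ^ (α + 2))).const_mul δ
  have hI12 : Integrable (fun z => δ * (2 ^ (α + 2) * (‖x i z‖ ^ (α + 2) + ‖y z‖ ^ (α + 2)))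
    + A * (‖(x i - y : Lp ℂ 2 μ) z‖ * ‖w z‖)) μ := hI1.add hI2
  have hle : ‖∫ z, (powF α (w z) * (starRingEnd ℂ) (x i z) - powF α (w z) * (starRingEnd ℂ) (y z)) ∂μ‖
      ≤ ∫ z, (δ * (2 ^ (α + 2) * (‖x i z‖ ^ (α + 2) + ‖y z‖ ^ (α + 2)))
        + A * (‖(x i - y : Lp ℂ 2 μ) z‖ * ‖w z‖)
        + c * {w : ℂ | M < ‖w‖}.indicator (fun w => ‖w‖ ^ (α + 2)) (w z)) ∂μ := by
    refine norm_integral_le_of_norm_le (hI12.add hI3) ?_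
    filter_upwards [Lp.coeFn_sub (x i) y] with z hz
    rw [hz, ← mul_sub, ← map_sub, norm_mul, RCLike.norm_conj]
    refine (powF_P2 hα (w z) (x i z - y z) δ M hδ hδ1 hM).trans ?_
    have : ‖x i z - y z‖ ^ (α + 2) ≤ 2 ^ (α + 2) * (‖x i z‖ ^ (α + 2) + ‖y z‖ ^ (α + 2)) := by
      have h1 : ‖x i z - y z‖ ≤ 2 * max ‖x i z‖ ‖y z‖ := by
        refine (norm_sub_le _ _).trans ?_
        have := le_max_left ‖x i z‖ ‖y z‖
        have := le_max_right ‖x i z‖ ‖y z‖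
        linarith
      have h2 := Real.rpow_le_rpow (norm_nonneg _) h1 (by linarith : 0 ≤ α + 2)
      rw [Real.mul_rpow (by norm_num) (by positivity)] at h2
      refine h2.trans ?_
      gcongr
      exact rpow_bd (by linarith) (norm_nonneg _) (norm_nonneg _) (by positivity) le_rfl
    have h3 := mul_le_mul_of_nonneg_left this hδ.le
    simp only [Pi.sub_apply]
    gcongr
  refine hle.trans_lt ?_
  have e1 : ∫ z, (δ * (2 ^ (α + 2) * (‖x i z‖ ^ (α + 2) + ‖y z‖ ^ (α + 2)))
        + A * (‖(x i - y : Lp ℂ 2 μ) z‖ * ‖w z‖)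
        + c * {w : ℂ | M < ‖w‖}.indicator (fun w => ‖w‖ ^ (α + 2)) (w z)) ∂μ =
      δ * (2 ^ (α + 2) * ((∫ z, ‖x i z‖ ^ (α + 2) ∂μ) + ∫ z, ‖y z‖ ^ (α + 2) ∂μ))
      + A * ∫ z, (‖(x i - y : Lp ℂ 2 μ) z‖ * ‖w z‖) ∂μ
      + c * ∫ z, {w : ℂ | M < ‖w‖}.indicator (fun w => ‖w‖ ^ (α + 2)) (w z) ∂μ := by
    rw [integral_add hI12 hI3]
    rw [integral_add hI1 hI2, integral_const_mul, integral_const_mul, integral_const_mul,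
      integral_const_mul, integral_add (hx i) hy]
  rw [e1]
  have h1 : δ * (2 ^ (α + 2) * ((∫ z, ‖x i z‖ ^ (α + 2) ∂μ) + ∫ z, ‖y z‖ ^ (α + 2) ∂μ)) ≤ δ * B' := by
    have := (hxB i).trans (le_abs_self B)
    rw [hB']
    gcongr
  have h2 : A * ∫ z, (‖(x i - y : Lp ℂ 2 μ) z‖ * ‖w z‖) ∂μ ≤ A * (‖x i - y‖ * ‖w‖) := by
    gcongr; exact aux_L2_le _ _
  have h3 : c * ∫ z, {w : ℂ | M < ‖w‖}.indicator (fun w => ‖w‖ ^ (α + 2)) (w z) ∂μ < η / 4 := by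
    calc _ < c * (η / (4 * c)) := by gcongr
      _ = η / 4 := by field_simp
  linarith
lemma toL2_le (S : DirichletSetting N) (u : S.H) : ‖S.toL2 u‖ ≤ ‖u‖ := by
  have := S.norm_eq u
  exact abs_le_of_sq_le_sq' (by nlinarith [sq_nonneg ‖S.grad u‖]) (norm_nonneg _) |>.2

lemma grad_le (S : DirichletSetting N) (u : S.H) : ‖S.grad u‖ ≤ ‖u‖ := by
  have := S.norm_eq u
  exact abs_le_of_sq_le_sq' (by nlinarith [sq_nonneg ‖S.toL2 u‖]) (norm_nonneg _) |>.2

lemma aux_memLp {E : Type*} [NormedAddCommGroup E] (Ω : Set (EucSp N)) (w : EucSp N → E)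
    (hw : Continuous w) (hc : HasCompactSupport w) (p : ℝ≥0∞) : MemLp w p (volume.restrict Ω) :=
  (hw.memLp_of_hasCompactSupport hc).restrict Ω

lemma aux_inner_left (S : DirichletSetting N) (f : Lp ℂ 2 (volume.restrict S.Ω)) (g : EucSp N → ℂ)
    (hg : MemLp (fun x => (starRingEnd ℂ) (g x)) 2 (volume.restrict S.Ω)) :
    inner ℂ (hg.toLp _) f = ∫ x in S.Ω, f x * g x := by
  rw [L2.inner_def]
  refine integral_congr_ae ?_
  filter_upwards [hg.coeFn_toLp] with x hx
  rw [hx]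
  simp [mul_comm]

lemma aux_inner_left2 (S : DirichletSetting N)
    (f : Lp (EuclideanSpace ℂ (Fin N)) 2 (volume.restrict S.Ω)) (g : EucSp N → ℂ) (j : Fin N)
    (hg : MemLp (fun x => EuclideanSpace.single j ((starRingEnd ℂ) (g x))) 2
      (volume.restrict S.Ω)) :
    inner ℂ (hg.toLp _) f = ∫ x in S.Ω, f x j * g x := by
  rw [L2.inner_def]
  refine integral_congr_ae ?_
  filter_upwards [hg.coeFn_toLp] with x hx
  rw [hx, EuclideanSpace.inner_single_left]
  simp [mul_comm]

lemma fderiv_hcs {E : Type*} [NormedAddCommGroup E] [NormedSpace ℝ E]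
    (w : EucSp N → E) (hc : HasCompactSupport w) (v : EucSp N) :
    HasCompactSupport (fun x => fderiv ℝ w x v) := by
  exact (hc.fderiv (𝕜 := ℝ)).comp_left (g := fun T : EucSp N →L[ℝ] E => T v) (by simp)

lemma fderiv_cd {E : Type*} [NormedAddCommGroup E] [NormedSpace ℝ E]
    (w : EucSp N → E) (hw : ContDiff ℝ (⊤ : ℕ∞) w) (v : EucSp N) :
    ContDiff ℝ (⊤ : ℕ∞) (fun x => fderiv ℝ w x v) :=
  (hw.fderiv_right (by simp)).clm_apply contDiff_const

lemma fderiv_ts {E : Type*} [NormedAddCommGroup E] [NormedSpace ℝ E]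
    (w : EucSp N → E) (v : EucSp N) :
    tsupport (fun x => fderiv ℝ w x v) ⊆ tsupport w := by
  refine (closure_mono ?_).trans (tsupport_fderiv_subset ℝ (f := w))
  intro x hx h
  apply hx
  simp [h]

lemma weak_grad_test (w φ : EucSp N → ℂ) (Ω : Set (EucSp N))
    (hw : ContDiff ℝ (⊤ : ℕ∞) w) (hc : HasCompactSupport w) (hs : tsupport w ⊆ Ω)
    (hφ : ContDiff ℝ (⊤ : ℕ∞) φ) (hφc : HasCompactSupport φ) (v : EucSp N) :
    ∫ x in Ω, φ x * fderiv ℝ w x v = - ∫ x in Ω, fderiv ℝ φ x v * w x := by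
  rw [setIntegral_eq_integral_of_forall_compl_eq_zero,
    setIntegral_eq_integral_of_forall_compl_eq_zero]
  · apply integral_mul_fderiv_eq_neg_fderiv_mul_of_integrable
    · exact ((fderiv_cd φ hφ v).continuous.mul hw.continuous).integrable_of_hasCompactSupport
        hc.mul_left
    · exact (hφ.continuous.mul (fderiv_cd w hw v).continuous).integrable_of_hasCompactSupport
        hφc.mul_right
    · exact (hφ.continuous.mul hw.continuous).integrable_of_hasCompactSupport
        hφc.mul_right
    · exact fun x _ => hφ.differentiable (by simp) x
    · exact fun x _ => hw.differentiable (by simp) x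
  · intro x hx
    rw [image_eq_zero_of_notMem_tsupport (fun h => hx (hs h)), mul_zero]
  · intro x hx
    rw [image_eq_zero_of_notMem_tsupport (f := fun x => fderiv ℝ w x v)
      (fun h => hx (hs (fderiv_ts w v h))), mul_zero]

lemma weak_grad (S : DirichletSetting N) (u : S.H) (w : EucSp N → ℂ)
    (hw : ContDiff ℝ (⊤ : ℕ∞) w) (hc : HasCompactSupport w) (hs : tsupport w ⊆ S.Ω) (j : Fin N) :
    ∫ x in S.Ω, S.toL2 u x * fderiv ℝ w x (EuclideanSpace.single j 1)
      = - ∫ x in S.Ω, (S.grad u x) j * w x := by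
  set e : EucSp N := EuclideanSpace.single j 1 with he
  have h1 : MemLp (fun x => (starRingEnd ℂ) (fderiv ℝ w x e)) 2 (volume.restrict S.Ω) :=
    aux_memLp _ _ (Complex.continuous_conj.comp (fderiv_cd w hw e).continuous)
      ((fderiv_hcs w hc e).comp_left (g := starRingEnd ℂ) (by simp)) _
  have h2 : MemLp (fun x => EuclideanSpace.single j ((starRingEnd ℂ) (w x))) 2
      (volume.restrict S.Ω) := by
    refine aux_memLp _ (fun x => EuclideanSpace.single j ((starRingEnd ℂ) (w x))) ?_ ?_ _
    · have hcj : Continuous fun x => (starRingEnd ℂ) (w x) :=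
        Complex.continuous_conj.comp hw.continuous
      have : Continuous fun x => ((starRingEnd ℂ) (w x)) • EuclideanSpace.single j (1:ℂ) :=
        hcj.smul continuous_const
      have e2 : (fun x => EuclideanSpace.single j ((starRingEnd ℂ) (w x))) =
          fun x => ((starRingEnd ℂ) (w x)) • EuclideanSpace.single j (1:ℂ) := by
        funext x
        ext i
        by_cases h : i = j
        · subst h; simp
        · simp [h]
      rw [e2]
      exact this
    · exact hc.comp_left (g := fun z => EuclideanSpace.single j ((starRingEnd ℂ) z)) (by simp)
  rw [eq_neg_iff_add_eq_zero, ← aux_inner_left S _ _ h1, ← aux_inner_left2 S _ _ _ h2]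
  rw [← norm_le_zero_iff]
  refine le_of_forall_pos_le_add fun η hη => ?_
  set A := ‖h1.toLp _‖ with hA
  set B := ‖h2.toLp _‖ with hB
  obtain ⟨v, φ, hv, hφ, hφc, hφs, hφ1, hφ2⟩ := S.dense_test u (η / (A + B + 1)) (by positivity)
  have hz : inner ℂ (h1.toLp _) (S.toL2 v) + inner ℂ (h2.toLp _) (S.grad v) = 0 := by
    rw [aux_inner_left S _ _ h1, aux_inner_left2 S _ _ _ h2, ← eq_neg_iff_add_eq_zero]
    have t1 : ∫ x in S.Ω, S.toL2 v x * fderiv ℝ w x e = ∫ x in S.Ω, φ x * fderiv ℝ w x e := by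
      refine integral_congr_ae ?_
      filter_upwards [hφ1] with x hx
      rw [hx]
    have t2 : ∫ x in S.Ω, S.grad v x j * w x = ∫ x in S.Ω, fderiv ℝ φ x e * w x := by
      refine integral_congr_ae ?_
      filter_upwards [hφ2] with x hx
      rw [hx]; rfl
    rw [t1, t2]
    exact weak_grad_test w φ _ hw hc hs hφ hφc e
  have hd : inner ℂ (h1.toLp _) (S.toL2 u) + inner ℂ (h2.toLp _) (S.grad u)
      = inner ℂ (h1.toLp _) (S.toL2 (u - v)) + inner ℂ (h2.toLp _) (S.grad (u - v)) := by
    rw [map_sub, map_sub, inner_sub_right, inner_sub_right]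
    linear_combination hz
  rw [hd, zero_add]
  calc _ ≤ A * ‖u - v‖ + B * ‖u - v‖ := by
        refine (norm_add_le _ _).trans ?_
        gcongr
        · exact (norm_inner_le_norm _ _).trans (by gcongr; exact toL2_le S _)
        · exact (norm_inner_le_norm _ _).trans (by gcongr; exact grad_le S _)
    _ ≤ (A + B + 1) * ‖u - v‖ := by nlinarith [norm_nonneg (u - v)]
    _ ≤ (A + B + 1) * (η / (A + B + 1)) := by gcongr
    _ = η := mul_div_cancel₀ _ (by positivity)
def gradC (a : EucSp N → ℝ) (x : EucSp N) : EuclideanSpace ℂ (Fin N) :=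
  WithLp.toLp 2 (fun j => ((fderiv ℝ a x (EuclideanSpace.single j 1) : ℝ) : ℂ))

lemma norm_gradC_le (a : EucSp N → ℝ) (x : EucSp N) : ‖gradC a x‖ ≤ ‖fderiv ℝ a x‖ := by
  set v : EucSp N := WithLp.toLp 2 (fun j => fderiv ℝ a x (EuclideanSpace.single j 1)) with hv
  have h1 : ‖gradC a x‖ = ‖v‖ := by
    rw [EuclideanSpace.norm_eq, EuclideanSpace.norm_eq]
    simp [gradC, hv]
  have h2 : fderiv ℝ a x v = ‖v‖ ^ 2 := by
    have e : v = ∑ j, v j • EuclideanSpace.single j (1:ℝ) := by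
      ext i
      simp [Finset.sum_apply, Pi.single_apply]
    conv_lhs => rw [e]
    rw [map_sum, EuclideanSpace.real_norm_sq_eq]
    refine Finset.sum_congr rfl fun j _ => ?_
    rw [map_smul, smul_eq_mul, sq]
  have h3 : ‖v‖ ^ 2 ≤ ‖fderiv ℝ a x‖ * ‖v‖ := by
    rw [← h2]
    exact (le_abs_self _).trans ((fderiv ℝ a x).le_opNorm v)
  rw [h1]
  rcases eq_or_lt_of_le (norm_nonneg v) with h | h
  · rw [← h]; positivity
  · rw [sq] at h3
    exact le_of_mul_le_mul_right h3 h

lemma gradC_cont (a : EucSp N → ℝ) (ha : ContDiff ℝ (⊤ : ℕ∞) a) : Continuous (gradC a) := by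
  unfold gradC
  refine (PiLp.continuous_toLp 2 _).comp (continuous_pi fun j => ?_)
  exact Complex.continuous_ofReal.comp (fderiv_cd a ha _).continuous

lemma prod_rule (S : DirichletSetting N) (a : EucSp N → ℝ) (ha : ContDiff ℝ (⊤ : ℕ∞) a)
    (u v : S.H)
    (hv : S.toL2 v =ᵐ[volume.restrict S.Ω] fun x => (a x : ℂ) * S.toL2 u x) :
    S.grad v =ᵐ[volume.restrict S.Ω]
      fun x => (a x : ℂ) • S.grad u x + S.toL2 u x • gradC a x := by
  suffices h : ∀ j : Fin N, ∀ᵐ x ∂(volume.restrict S.Ω),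
      S.grad v x j - ((a x : ℂ) * S.grad u x j + S.toL2 u x * (gradC a x) j) = 0 by
    filter_upwards [ae_all_iff.2 h] with x hx
    ext j
    simpa [sub_eq_zero] using hx j
  intro j
  rw [ae_restrict_iff' S.hopen.measurableSet]
  have li : ∀ f : EucSp N → ℂ, MemLp f 2 (volume.restrict S.Ω) → LocallyIntegrableOn f S.Ω volume :=
    fun f hf => locallyIntegrableOn_of_locallyIntegrable_restrict
      (hf.locallyIntegrable (by norm_num))
  have mj : ∀ w : S.H, MemLp (fun x => S.grad w x j) 2 (volume.restrict S.Ω) := fun w =>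
    (EuclideanSpace.proj (𝕜 := ℂ) j : EuclideanSpace ℂ (Fin N) →L[ℂ] ℂ).comp_memLp' (Lp.memLp (S.grad w))
  have ca : Continuous (fun x => (a x : ℂ)) := Complex.continuous_ofReal.comp ha.continuous
  have cg : Continuous (fun x => (gradC a x) j) := 
    Complex.continuous_ofReal.comp (fderiv_cd a ha _).continuous
  have lF : LocallyIntegrableOn (fun x => S.grad v x j -
      ((a x : ℂ) * S.grad u x j + S.toL2 u x * (gradC a x) j)) S.Ω volume := by
    refine (li _ (mj v)).sub (LocallyIntegrableOn.add ?_ ?_)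
    · exact (li _ (mj u)).continuousOn_mul ca.continuousOn S.hopen.isLocallyClosed
    · exact (li _ (Lp.memLp (S.toL2 u))).mul_continuousOn cg.continuousOn S.hopen.isLocallyClosed
  refine IsOpen.ae_eq_zero_of_integral_contDiff_smul_eq_zero S.hopen lF ?_
  intro g hg hgc hgs
  rw [← setIntegral_eq_integral_of_forall_compl_eq_zero (s := S.Ω)]
  swap
  · intro x hx
    rw [image_eq_zero_of_notMem_tsupport (fun h => hx (hgs h)), zero_smul]
  set e : EucSp N := EuclideanSpace.single j 1 with he
  have fdc : ∀ h : EucSp N → ℝ, ContDiff ℝ (⊤ : ℕ∞) h → ∀ x,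
      fderiv ℝ (fun x => (h x : ℂ)) x e = ((fderiv ℝ h x e : ℝ) : ℂ) := by
    intro h hh x
    have := (Complex.ofRealCLM.hasFDerivAt (x := h x)).comp x
      ((hh.differentiable (by simp)) x).hasFDerivAt
    have h2 := this.fderiv
    simp only [Function.comp_def, Complex.ofRealCLM_apply] at h2
    rw [h2]; simp
  have hag : ContDiff ℝ (⊤ : ℕ∞) (fun x => a x * g x) := ha.mul hg
  have hagc : HasCompactSupport (fun x => a x * g x) := hgc.mul_left
  have hags : tsupport (fun x => a x * g x) ⊆ S.Ω := (tsupport_mul_subset_right).trans hgs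
  have cast : ∀ h : EucSp N → ℝ, ContDiff ℝ (⊤ : ℕ∞) h → HasCompactSupport h → tsupport h ⊆ S.Ω → 
      ContDiff ℝ (⊤ : ℕ∞) (fun x => (h x : ℂ)) ∧ HasCompactSupport (fun x => (h x : ℂ)) ∧
      tsupport (fun x => (h x : ℂ)) ⊆ S.Ω := by
    intro h h1 h2 h3
    refine ⟨Complex.ofRealCLM.contDiff.comp h1, h2.comp_left (g := fun z : ℝ => (z : ℂ)) (by simp), ?_⟩
    refine (closure_mono ?_).trans h3
    intro x hx h
    exact hx (by simp [h])
  obtain ⟨g1, g2, g3⟩ := cast g hg hgc hgs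
  obtain ⟨k1, k2, k3⟩ := cast _ hag hagc hags
  have E1 := weak_grad S v _ g1 g2 g3 j
  have E2 := weak_grad S u _ k1 k2 k3 j
  rw [← he] at E1 E2
  simp only [fdc g hg, fdc _ hag] at E1 E2
  have cl : ∀ h : EucSp N → ℝ, Continuous h → HasCompactSupport h → 
      MemLp (fun x => (h x : ℂ)) 2 (volume.restrict S.Ω) := fun h h1 h2 =>
    aux_memLp _ _ (Complex.continuous_ofReal.comp h1)
      (h2.comp_left (g := fun z : ℝ => (z : ℂ)) (by simp)) _
  have I1 : Integrable (fun x => S.grad v x j * (g x : ℂ)) (volume.restrict S.Ω) :=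
    (mj v).integrable_mul (cl g hg.continuous hgc)
  have I2 : Integrable (fun x => S.grad u x j * ((a x * g x : ℝ) : ℂ)) (volume.restrict S.Ω) :=
    (mj u).integrable_mul (cl _ hag.continuous hagc)
  have I3 : Integrable (fun x => S.toL2 u x * ((g x * fderiv ℝ a x e : ℝ) : ℂ)) (volume.restrict S.Ω) :=
    (Lp.memLp (S.toL2 u)).integrable_mul (cl _ (hg.continuous.mul (fderiv_cd a ha e).continuous)
      hgc.mul_right)
  have I4 : Integrable (fun x => S.toL2 u x * ((a x * fderiv ℝ g x e : ℝ) : ℂ)) (volume.restrict S.Ω) :=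
    (Lp.memLp (S.toL2 u)).integrable_mul (cl _ (ha.continuous.mul (fderiv_cd g hg e).continuous)
      (fderiv_hcs g hgc e).mul_left)
  have E3 : ∫ x in S.Ω, S.toL2 v x * ((fderiv ℝ g x e : ℝ) : ℂ) =
      ∫ x in S.Ω, S.toL2 u x * ((a x * fderiv ℝ g x e : ℝ) : ℂ) := by
    refine integral_congr_ae ?_
    filter_upwards [hv] with x hx
    rw [hx]; push_cast; ring
  have E4 : ∫ x in S.Ω, S.toL2 u x * ((fderiv ℝ (fun x => a x * g x) x e : ℝ) : ℂ) =
      ∫ x in S.Ω, (S.toL2 u x * ((a x * fderiv ℝ g x e : ℝ) : ℂ) +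
        S.toL2 u x * ((g x * fderiv ℝ a x e : ℝ) : ℂ)) := by
    congr 1
    funext x
    have : fderiv ℝ (fun x => a x * g x) x e = a x * fderiv ℝ g x e + g x * fderiv ℝ a x e := by
      rw [fderiv_fun_mul (ha.differentiable (by simp) x) (hg.differentiable (by simp) x)]
      simp
    rw [this]; push_cast; ring
  rw [integral_add I4 I3] at E4
  have E5 : ∫ x in S.Ω, g x • (S.grad v x j - ((a x : ℂ) * S.grad u x j + S.toL2 u x * (gradC a x) j))
      = ∫ x in S.Ω, ((S.grad v x j * (g x : ℂ) - S.grad u x j * ((a x * g x : ℝ) : ℂ)) -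
        S.toL2 u x * ((g x * fderiv ℝ a x e : ℝ) : ℂ)) := by
    congr 1
    funext x
    have : (gradC a x) j = ((fderiv ℝ a x e : ℝ) : ℂ) := rfl
    rw [this, Complex.real_smul]
    push_cast; ring
  have I12 : Integrable (fun x => S.grad v x j * (g x : ℂ) - S.grad u x j * ((a x * g x : ℝ) : ℂ))
    (volume.restrict S.Ω) := I1.sub I2
  rw [E5, integral_sub I12 I3, integral_sub I1 I2]
  rw [E3] at E1
  rw [E4] at E2
  linear_combination E1 - E2
lemma aux_norm_lp {X E : Type*} [MeasurableSpace X] {μ : Measure X} [NormedAddCommGroup E]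
    (f : Lp E 2 μ) : ‖(Lp.memLp f).norm.toLp _‖ = ‖f‖ := by
  rw [Lp.norm_toLp, eLpNorm_norm, Lp.norm_def]

lemma mult_L2 (S : DirichletSetting N) (a : EucSp N → ℝ) (A : ℝ) (hA : ∀ x, |a x| ≤ A)
    (u v : S.H)
    (hv : S.toL2 v =ᵐ[volume.restrict S.Ω] fun x => (a x : ℂ) * S.toL2 u x) :
    ‖S.toL2 v‖ ≤ A * ‖S.toL2 u‖ := by
  refine Lp.norm_le_mul_norm_of_ae_le_mul ?_
  filter_upwards [hv] with x hx
  rw [hx, norm_mul, Complex.norm_real]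
  exact mul_le_mul_of_nonneg_right (hA x) (norm_nonneg _)

lemma mult_grad (S : DirichletSetting N) (a : EucSp N → ℝ) (ha : ContDiff ℝ (⊤ : ℕ∞) a) (A L : ℝ)
    (hA : ∀ x, |a x| ≤ A) (hL : ∀ x, ‖gradC a x‖ ≤ L)
    (u v : S.H)
    (hv : S.toL2 v =ᵐ[volume.restrict S.Ω] fun x => (a x : ℂ) * S.toL2 u x) :
    ‖S.grad v‖ ≤ A * ‖S.grad u‖ + L * ‖S.toL2 u‖ := by
  have hA0 : 0 ≤ A := (abs_nonneg _).trans (hA 0)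
  have hL0 : 0 ≤ L := (norm_nonneg _).trans (hL 0)
  set f : Lp ℝ 2 (volume.restrict S.Ω) := (Lp.memLp (S.grad u)).norm.toLp _ with hf
  set g : Lp ℝ 2 (volume.restrict S.Ω) := (Lp.memLp (S.toL2 u)).norm.toLp _ with hg
  have h1 : ‖S.grad v‖ ≤ ‖A • f + L • g‖ := by
    refine Lp.norm_le_norm_of_ae_le ?_
    filter_upwards [prod_rule S a ha u v hv, Lp.coeFn_add (A • f) (L • g), Lp.coeFn_smul A f,
      Lp.coeFn_smul L g, (Lp.memLp (S.grad u)).norm.coeFn_toLp,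
      (Lp.memLp (S.toL2 u)).norm.coeFn_toLp] with x h1 h2 h3 h4 h5 h6
    rw [h1, h2, Pi.add_apply, h3, h4, Pi.smul_apply, Pi.smul_apply, hf, hg, h5, h6]
    rw [smul_eq_mul, smul_eq_mul, Real.norm_eq_abs]
    refine le_trans ?_ (le_abs_self _)
    refine (norm_add_le _ _).trans ?_
    rw [norm_smul, norm_smul, Complex.norm_real, Real.norm_eq_abs, mul_comm L]
    gcongr
    · exact hA x
    · exact hL x
  refine h1.trans ((norm_add_le _ _).trans ?_)
  rw [norm_smul, norm_smul, hf, hg, aux_norm_lp, aux_norm_lp, Real.norm_eq_abs, Real.norm_eq_abs,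
    abs_of_nonneg hA0, abs_of_nonneg hL0]

lemma mult_H (S : DirichletSetting N) (a : EucSp N → ℝ) (ha : ContDiff ℝ (⊤ : ℕ∞) a) (A L : ℝ)
    (hA : ∀ x, |a x| ≤ A) (hL : ∀ x, ‖gradC a x‖ ≤ L)
    (u v : S.H)
    (hv : S.toL2 v =ᵐ[volume.restrict S.Ω] fun x => (a x : ℂ) * S.toL2 u x) :
    ‖v‖ ≤ (2 * A + L) * ‖u‖ := by
  have hA0 : 0 ≤ A := (abs_nonneg _).trans (hA 0)
  have hL0 : 0 ≤ L := (norm_nonneg _).trans (hL 0)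
  have h1 := mult_L2 S a A hA u v hv
  have h2 := mult_grad S a ha A L hA hL u v hv
  have h3 : ‖v‖ ≤ ‖S.toL2 v‖ + ‖S.grad v‖ := by
    have := S.norm_eq v
    refine abs_le_of_sq_le_sq' ?_ (by positivity) |>.2
    nlinarith [norm_nonneg (S.toL2 v), norm_nonneg (S.grad v)]
  have h4 := mul_le_mul_of_nonneg_left (toL2_le S u) hA0
  have h5 := mul_le_mul_of_nonneg_left (grad_le S u) hA0
  have h6 := mul_le_mul_of_nonneg_left (toL2_le S u) hL0
  linarith

lemma comm_bound (S : DirichletSetting N) (a : EucSp N → ℝ) (ha : ContDiff ℝ (⊤ : ℕ∞) a) (A L : ℝ)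
    (hA : ∀ x, |a x| ≤ A) (hL : ∀ x, ‖gradC a x‖ ≤ L) (x y vx vy : S.H)
    (hvx : S.toL2 vx =ᵐ[volume.restrict S.Ω] fun z => (a z : ℂ) * S.toL2 x z)
    (hvy : S.toL2 vy =ᵐ[volume.restrict S.Ω] fun z => (a z : ℂ) * S.toL2 y z) :
    |deltaPair S x (Complex.I • vy) + deltaPair S y (Complex.I • vx)|
      ≤ L * (‖S.grad x‖ * ‖S.toL2 y‖ + ‖S.grad y‖ * ‖S.toL2 x‖) := by
  have hL0 : 0 ≤ L := (norm_nonneg _).trans (hL 0)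
  have e0 : deltaPair S x (Complex.I • vy) + deltaPair S y (Complex.I • vx)
      = (inner ℂ (S.grad x) (S.grad vy) + inner ℂ (S.grad y) (S.grad vx) : ℂ).im := by
    unfold deltaPair
    rw [map_smul, map_smul, inner_smul_right, inner_smul_right]
    simp
  have hI : Integrable (fun z => inner ℂ (S.grad x z) (S.grad vy z)
      + inner ℂ (S.grad y z) (S.grad vx z)) (volume.restrict S.Ω) :=
    (L2.integrable_inner (𝕜 := ℂ) (S.grad x) (S.grad vy)).add (L2.integrable_inner (𝕜 := ℂ) (S.grad y) (S.grad vx))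
  have e1 : (inner ℂ (S.grad x) (S.grad vy) + inner ℂ (S.grad y) (S.grad vx) : ℂ).im
      = ∫ z in S.Ω, (inner ℂ (S.grad x z) (S.grad vy z)
      + inner ℂ (S.grad y z) (S.grad vx z)).im := by
    rw [L2.inner_def, L2.inner_def, ← integral_add (L2.integrable_inner (𝕜 := ℂ) (S.grad x) (S.grad vy))
      (L2.integrable_inner (𝕜 := ℂ) (S.grad y) (S.grad vx))]
    exact (integral_im hI).symm
  rw [e0, e1, ← Real.norm_eq_abs]
  have I1 := aux_L2_int (S.grad x) (S.toL2 y)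
  have I2 := aux_L2_int (S.grad y) (S.toL2 x)
  have b : ‖∫ z in S.Ω, (inner ℂ (S.grad x z) (S.grad vy z)
      + inner ℂ (S.grad y z) (S.grad vx z)).im‖ ≤
      ∫ z in S.Ω, (L * (‖S.grad x z‖ * ‖S.toL2 y z‖ + ‖S.grad y z‖ * ‖S.toL2 x z‖)) := by
    refine norm_integral_le_of_norm_le ((I1.add I2).const_mul L) ?_
    filter_upwards [prod_rule S a ha x vx hvx, prod_rule S a ha y vy hvy] with z h1 h2
    rw [h1, h2, inner_add_right, inner_add_right, inner_smul_right, inner_smul_right,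
      inner_smul_right, inner_smul_right]
    have e2 : ((a z : ℂ) * inner ℂ (S.grad x z) (S.grad y z) + S.toL2 y z * inner ℂ (S.grad x z) (gradC a z)
        + ((a z : ℂ) * inner ℂ (S.grad y z) (S.grad x z) + S.toL2 x z * inner ℂ (S.grad y z) (gradC a z))).im
        = (S.toL2 y z * inner ℂ (S.grad x z) (gradC a z) + S.toL2 x z * inner ℂ (S.grad y z) (gradC a z)).im := by
      rw [← inner_conj_symm (S.grad x z) (S.grad y z)]
      simp [-inner_conj_symm]
      ring
    rw [e2, Real.norm_eq_abs]
    refine (Complex.abs_im_le_norm _).trans ((norm_add_le _ _).trans ?_)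
    rw [norm_mul, norm_mul]
    have t1 : ‖inner ℂ (S.grad x z) (gradC a z)‖ ≤ ‖S.grad x z‖ * L :=
      (norm_inner_le_norm _ _).trans (by gcongr; exact hL z)
    have t2 : ‖inner ℂ (S.grad y z) (gradC a z)‖ ≤ ‖S.grad y z‖ * L :=
      (norm_inner_le_norm _ _).trans (by gcongr; exact hL z)
    have t3 := mul_le_mul_of_nonneg_left t1 (norm_nonneg (S.toL2 y z))
    have t4 := mul_le_mul_of_nonneg_left t2 (norm_nonneg (S.toL2 x z))
    linarith
  refine b.trans ?_
  rw [integral_const_mul, integral_add I1 I2]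
  have := aux_L2_le (S.grad x) (S.toL2 y)
  have := aux_L2_le (S.grad y) (S.toL2 x)
  gcongr

lemma mult_mem (S : DirichletSetting N) (a : EucSp N → ℝ) (A : ℝ) (hA : ∀ x, |a x| ≤ A)
    (u v : S.H) (p : ℝ≥0∞)
    (hv : S.toL2 v =ᵐ[volume.restrict S.Ω] fun x => (a x : ℂ) * S.toL2 u x)
    (hu : MemLp (S.toL2 u) p S.μ) : MemLp (S.toL2 v) p S.μ ∧
      (eLpNorm (S.toL2 v) p S.μ).toReal ≤ A * (eLpNorm (S.toL2 u) p S.μ).toReal := by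
  have hA0 : 0 ≤ A := (abs_nonneg _).trans (hA 0)
  have hle : ∀ᵐ x ∂S.μ, ‖S.toL2 v x‖ ≤ A * ‖S.toL2 u x‖ := by
    change ∀ᵐ x ∂(volume.restrict S.Ω), _
    filter_upwards [hv] with x hx
    rw [hx, norm_mul, Complex.norm_real]
    exact mul_le_mul_of_nonneg_right (hA x) (norm_nonneg _)
  refine ⟨hu.of_le_mul (Lp.aestronglyMeasurable _) hle, ?_⟩
  have := eLpNorm_le_mul_eLpNorm_of_ae_le_mul hle p
  have h2 := ENNReal.toReal_mono (ENNReal.mul_ne_top ENNReal.ofReal_ne_top hu.2.ne) this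
  rwa [ENNReal.toReal_mul, ENNReal.toReal_ofReal hA0] at h2
lemma delta_cont_test (S : DirichletSetting N) (u : ℝ → S.H)
    (hc : Continuous fun t => S.toL2 (u t)) (v : S.H) (φ : EucSp N → ℂ)
    (hφ : ContDiff ℝ (⊤ : ℕ∞) φ) (hφc : HasCompactSupport φ) (hφs : tsupport φ ⊆ S.Ω)
    (hφ2 : S.grad v =ᵐ[volume.restrict S.Ω] (fun x => (WithLp.equiv 2 (Fin N → ℂ)).symm
          (fun j => fderiv ℝ φ x (EuclideanSpace.single j (1 : ℝ))))) :
    Continuous fun t => deltaPair S (u t) v := by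
  set w : Fin N → EucSp N → ℂ := fun j x =>
    (starRingEnd ℂ) (fderiv ℝ φ x (EuclideanSpace.single j (1 : ℝ))) with hw
  have w1 : ∀ j, ContDiff ℝ (⊤ : ℕ∞) (w j) := fun j =>
    Complex.conjCLE.contDiff.comp (fderiv_cd φ hφ _)
  have w2 : ∀ j, HasCompactSupport (w j) := fun j =>
    (fderiv_hcs φ hφc _).comp_left (g := starRingEnd ℂ) (by simp)
  have w3 : ∀ j, tsupport (w j) ⊆ S.Ω := by
    intro j
    refine (closure_mono ?_).trans ((fderiv_ts φ (EuclideanSpace.single j (1 : ℝ))).trans hφs)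
    intro x hx h
    exact hx (by simp [hw, h])
  have m : ∀ j, MemLp (fun x => (starRingEnd ℂ) (fderiv ℝ (w j) x (EuclideanSpace.single j 1))) 2
      (volume.restrict S.Ω) := fun j => 
    aux_memLp _ _ (Complex.continuous_conj.comp (fderiv_cd _ (w1 j) _).continuous)
      ((fderiv_hcs _ (w2 j) _).comp_left (g := starRingEnd ℂ) (by simp)) _
  have mj : ∀ j, ∀ t, Integrable (fun x => S.grad (u t) x j * w j x) (volume.restrict S.Ω) := by
    intro j t
    have h1 : MemLp (fun x => S.grad (u t) x j) 2 (volume.restrict S.Ω) := 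
      (EuclideanSpace.proj (𝕜 := ℂ) j : EuclideanSpace ℂ (Fin N) →L[ℂ] ℂ).comp_memLp'
        (Lp.memLp (S.grad (u t)))
    exact h1.integrable_mul (aux_memLp _ _ (w1 j).continuous (w2 j) 2)
  have key : ∀ t, deltaPair S (u t) v =
      (∑ j, inner ℂ ((m j).toLp _) (S.toL2 (u t)) : ℂ).re := by
    intro t
    unfold deltaPair
    rw [← inner_conj_symm, Complex.conj_re, ← Complex.neg_re]
    congr 1
    have e1 : inner ℂ (S.grad v) (S.grad (u t)) = ∑ j, ∫ x in S.Ω, S.grad (u t) x j * w j x := by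
      rw [L2.inner_def, ← integral_finsetSum _ (fun j _ => mj j t)]
      refine integral_congr_ae ?_
      filter_upwards [hφ2] with x hx
      rw [hx, PiLp.inner_apply]
      refine Finset.sum_congr rfl fun j _ => ?_
      simp [hw]
    rw [e1, ← Finset.sum_neg_distrib]
    refine Finset.sum_congr rfl fun j _ => ?_
    rw [aux_inner_left S _ _ (m j), weak_grad S (u t) (w j) (w1 j) (w2 j) (w3 j) j]
  simp only [key]
  refine Complex.continuous_re.comp (continuous_finsetSum _ fun j _ => ?_)
  exact Continuous.inner continuous_const hc

lemma delta_cont (S : DirichletSetting N) (u : ℝ → S.H) (B : ℝ) (hB : ∀ t, ‖u t‖ ≤ B)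
    (hc : Continuous fun t => S.toL2 (u t)) (φ : S.H) :
    Continuous fun t => deltaPair S (u t) φ := by
  refine continuous_of_uniform_approx_of_continuous ?_
  intro U hU
  obtain ⟨η, hη, hU⟩ := Metric.mem_uniformity_dist.1 hU
  have hB0 : 0 ≤ B := (norm_nonneg _).trans (hB 0)
  obtain ⟨v, f, hv, h1, h2, h3, h4, h5⟩ := S.dense_test φ (η / (B + 1)) (by positivity)
  refine ⟨_, delta_cont_test S u hc v f h1 h2 h3 h5, fun t => hU ?_⟩
  have : deltaPair S (u t) φ - deltaPair S (u t) v
      = -(inner ℂ (S.grad (u t)) (S.grad (φ - v)) : ℂ).re := by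
    unfold deltaPair
    rw [map_sub, inner_sub_right, Complex.sub_re]
    ring
  rw [Real.dist_eq, this, abs_neg]
  calc _ ≤ ‖S.grad (u t)‖ * ‖S.grad (φ - v)‖ :=
        (Complex.abs_re_le_norm _).trans (norm_inner_le_norm _ _)
    _ ≤ B * ‖φ - v‖ := by
        have := (grad_le S (u t)).trans (hB t)
        gcongr
        exact grad_le S _
    _ ≤ (B + 1) * ‖φ - v‖ := by nlinarith [norm_nonneg (φ - v)]
    _ < (B + 1) * (η / (B + 1)) := by gcongr
    _ = η := mul_div_cancel₀ _ (by positivity)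

lemma cont_L2 (S : DirichletSetting N) (u : ℝ → S.H) (C B m : ℝ)
    (hm : ∀ t, ‖S.toL2 (u t)‖ = m)
    (h : ∀ s t, |l2Pair S (u t) (u s) - l2Pair S (u s) (u s)| ≤ C * |t - s| * B) :
    Continuous fun t => S.toL2 (u t) := by
  rw [continuous_iff_continuousAt]
  intro s
  rw [ContinuousAt, tendsto_iff_norm_sub_tendsto_zero]
  have hsq : Tendsto (fun t => ‖S.toL2 (u t) - S.toL2 (u s)‖ ^ 2) (nhds s) (nhds 0) := by
    have hlim : Tendsto (fun t => 2 * (C * |t - s| * B)) (nhds s) (nhds 0) := by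
      have : Continuous (fun t : ℝ => 2 * (C * |t - s| * B)) := by fun_prop
      have := this.tendsto s
      simpa using this
    refine squeeze_zero (fun _ => by positivity) (fun t => ?_) hlim
    have e := @norm_sub_sq ℂ _ _ _ _ (S.toL2 (u t)) (S.toL2 (u s))
    have e2 : (inner ℂ (S.toL2 (u s)) (S.toL2 (u s)) : ℂ).re = ‖S.toL2 (u s)‖ ^ 2 :=
      inner_self_eq_norm_sq (𝕜 := ℂ) (S.toL2 (u s))
    have e3 : RCLike.re (inner ℂ (S.toL2 (u t)) (S.toL2 (u s)) : ℂ) =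
        (inner ℂ (S.toL2 (u s)) (S.toL2 (u t)) : ℂ).re := inner_re_symm _ _
    have h1 := h s t
    unfold l2Pair at h1
    have h2 := neg_abs_le ((inner ℂ (S.toL2 (u s)) (S.toL2 (u t)) : ℂ).re - (inner ℂ (S.toL2 (u s)) (S.toL2 (u s)) : ℂ).re)
    rw [e, e3, hm, hm]
    rw [hm] at e2
    linarith
  have := (Real.continuous_sqrt.tendsto 0).comp hsq
  simpa [Function.comp_def] using this
lemma pow_int (S : DirichletSetting N) {α : ℝ} (hα : 0 ≤ α) (v : S.H)
    (hv : MemLp (S.toL2 v) (ENNReal.ofReal (α + 2)) S.μ) :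
    Integrable (fun z => ‖S.toL2 v z‖ ^ (α + 2)) (volume.restrict S.Ω) ∧
    ∫ z in S.Ω, ‖S.toL2 v z‖ ^ (α + 2) = 
      ((eLpNorm (S.toL2 v) (ENNReal.ofReal (α + 2)) S.μ).toReal) ^ (α + 2) := by
  have hp0 : ENNReal.ofReal (α + 2) ≠ 0 := by simp; linarith
  have hpr : (ENNReal.ofReal (α + 2)).toReal = α + 2 := ENNReal.toReal_ofReal (by linarith)
  constructor
  · have := hv.integrable_norm_rpow hp0 ENNReal.ofReal_ne_top
    rw [hpr] at this
    exact this
  · rw [hv.eLpNorm_eq_integral_rpow_norm hp0 ENNReal.ofReal_ne_top, hpr,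
      ENNReal.toReal_ofReal (by positivity), ← Real.rpow_mul (integral_nonneg fun _ => by positivity),
      inv_mul_cancel₀ (by linarith), Real.rpow_one]
    rfl

set_option maxHeartbeats 2000000 in
open scoped Topology in
lemma core (S : DirichletSetting N)
    (lam α : ℝ) (hα0 : 0 ≤ α)
    (u₀ : S.H) (u : ℝ → S.H) 
    (hu_Lα : ∀ t : ℝ, MemLp (S.toL2 (u t)) (ENNReal.ofReal (α + 2)) S.μ)
    (hu_bdd : ∃ C : ℝ, ∀ t : ℝ,
      ‖u t‖ + (eLpNorm (S.toL2 (u t)) (ENNReal.ofReal (α + 2)) S.μ).toReal ≤ C)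
    (hu_lipE : ∃ C : ℝ, ∀ (s t : ℝ) (φ : S.H),
      MemLp (S.toL2 φ) (ENNReal.ofReal (α + 2)) S.μ →
      |l2Pair S (u t) φ - l2Pair S (u s) φ|
        ≤ C * |t - s| * (‖φ‖ + (eLpNorm (S.toL2 φ) (ENNReal.ofReal (α + 2)) S.μ).toReal))
    (hweak : ∀ (φ : S.H), MemLp (S.toL2 φ) (ENNReal.ofReal (α + 2)) S.μ →
      ∀ (ψ : ℝ → ℝ), ContDiff ℝ (⊤ : ℕ∞) ψ → HasCompactSupport ψ →
      tsupport ψ ⊆ {t : ℝ | t ≠ 0} →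
      ∫ t : ℝ, (-(l2Pair S (Complex.I • u t) φ) * deriv ψ t
        + (deltaPair S (u t) φ
            - lam * (∫ x, ((‖(S.toL2 (u t)) x‖ ^ α : ℝ) : ℂ)
                * ((S.toL2 (u t)) x * (starRingEnd ℂ) ((S.toL2 φ) x)) ∂S.μ).re) * ψ t)
        = 0)
    (hcharge : ∀ t : ℝ, ‖S.toL2 (u t)‖ = ‖S.toL2 u₀‖)
    (Q : ℝ) (hQ : ∀ t, ‖S.grad (u t)‖ ≤ Q)
    (a : EucSp N → ℝ) (ha : ContDiff ℝ (⊤ : ℕ∞) a) (haW : IsW1inf S.Ω a) (A L : ℝ)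
    (hA : ∀ x, |a x| ≤ A) (hL : ∀ x, ‖gradC a x‖ ≤ L) (T : ℝ) :
    (∫ x in S.Ω, a x * ‖S.toL2 (u T) x‖ ^ 2) - (∫ x in S.Ω, a x * ‖S.toL2 (u 0) x‖ ^ 2)
      ≤ L * (2 * ‖S.toL2 u₀‖ * Q) * |T| := by
  have hA0 : 0 ≤ A := (abs_nonneg _).trans (hA 0)
  have hL0 : 0 ≤ L := (norm_nonneg _).trans (hL 0)
  obtain ⟨B, hB⟩ := hu_bdd
  obtain ⟨C', hC'⟩ := hu_lipE
  set p := ENNReal.ofReal (α + 2) with hp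
  have hB0 : 0 ≤ B := le_trans (by positivity) (hB 0)
  have hB1 : ∀ t, ‖u t‖ ≤ B := fun t => le_trans (by simp) (hB t)
  have hB2 : ∀ t, (eLpNorm (S.toL2 (u t)) p S.μ).toReal ≤ B := fun t => le_trans (by simp) (hB t)
  set C := |C'| with hCdef
  have hC0 : 0 ≤ C := abs_nonneg _
  have hC : ∀ (s t : ℝ) (φ : S.H), MemLp (S.toL2 φ) p S.μ →
      |l2Pair S (u t) φ - l2Pair S (u s) φ|
        ≤ C * |t - s| * (‖φ‖ + (eLpNorm (S.toL2 φ) p S.μ).toReal) := by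
    intro s t φ hφ
    refine (hC' s t φ hφ).trans ?_
    gcongr
    exact le_abs_self _
  have hcont : Continuous fun t => S.toL2 (u t) := by
    refine cont_L2 S u C B _ hcharge fun s t => ?_
    refine (hC s t (u s) (hu_Lα s)).trans ?_
    gcongr
    exact hB s
  choose V hV using fun t => S.smul_W1inf_mem a haW (u t)
  have hVH : ∀ t, ‖V t‖ ≤ (2 * A + L) * B := fun t =>
    (mult_H S a ha A L hA hL _ _ (hV t)).trans (by gcongr; exact hB1 t)
  have hVm : ∀ t, MemLp (S.toL2 (V t)) p S.μ := fun t =>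
    (mult_mem S a A hA _ _ p (hV t) (hu_Lα t)).1
  have hVp : ∀ t, (eLpNorm (S.toL2 (V t)) p S.μ).toReal ≤ A * B := fun t =>
    (mult_mem S a A hA _ _ p (hV t) (hu_Lα t)).2.trans (by gcongr; exact hB2 t)
  -- Phi
  set Φ : ℝ → S.H := fun t => Complex.I • V t with hΦ
  have hΦae : ∀ t, S.toL2 (Φ t) =ᵐ[volume.restrict S.Ω] fun z => Complex.I * S.toL2 (V t) z := by
    intro t
    have : S.toL2 (Φ t) = Complex.I • S.toL2 (V t) := by simp [hΦ]
    rw [this]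
    filter_upwards [Lp.coeFn_smul Complex.I (S.toL2 (V t))] with z hz
    rw [hz]; rfl
  have hΦn : ∀ t, ‖Φ t‖ = ‖V t‖ := fun t => by simp [hΦ, norm_smul]
  have hΦnorm : ∀ t, ∀ᵐ z ∂S.μ, ‖S.toL2 (Φ t) z‖ = ‖S.toL2 (V t) z‖ := by
    intro t
    change ∀ᵐ z ∂(volume.restrict S.Ω), _
    filter_upwards [hΦae t] with z hz
    rw [hz]; simp
  have hΦm : ∀ t, MemLp (S.toL2 (Φ t)) p S.μ := fun t =>
    (hVm t).congr_norm (Lp.aestronglyMeasurable _) ((hΦnorm t).mono fun _ h => h.symm)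
  have hΦp : ∀ t, eLpNorm (S.toL2 (Φ t)) p S.μ = eLpNorm (S.toL2 (V t)) p S.μ := fun t =>
    eLpNorm_congr_norm_ae (hΦnorm t)
  have hΦc : Continuous fun t => S.toL2 (Φ t) := by
    rw [continuous_iff_continuousAt]
    intro s
    rw [ContinuousAt, tendsto_iff_norm_sub_tendsto_zero]
    have h1 : Tendsto (fun t => A * ‖S.toL2 (u t) - S.toL2 (u s)‖) (𝓝 s) (𝓝 0) := by
      have := (tendsto_iff_norm_sub_tendsto_zero.1 (hcont.tendsto s)).const_mul A
      simpa using this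
    refine squeeze_zero (fun _ => norm_nonneg _) (fun t => ?_) h1
    have e : S.toL2 (Φ t) - S.toL2 (Φ s) = Complex.I • S.toL2 (V t - V s) := by
      simp [hΦ, smul_sub]
    rw [e, norm_smul, Complex.norm_I, one_mul, ← map_sub]
    refine mult_L2 S a A hA _ _ ?_
    rw [map_sub, map_sub]
    filter_upwards [hV t, hV s, Lp.coeFn_sub (S.toL2 (V t)) (S.toL2 (V s)),
      Lp.coeFn_sub (S.toL2 (u t)) (S.toL2 (u s))] with z h1 h2 h3 h4
    rw [h3, h4, Pi.sub_apply, Pi.sub_apply, h1, h2]; ring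
  -- nonlinear term
  set P : S.H → S.H → ℂ := fun v φ => ∫ z in S.Ω, powF α (S.toL2 v z) * (starRingEnd ℂ) (S.toL2 φ z)
    with hP
  have hPeq : ∀ v φ : S.H, (∫ x, ((‖(S.toL2 v) x‖ ^ α : ℝ) : ℂ)
      * ((S.toL2 v) x * (starRingEnd ℂ) ((S.toL2 φ) x)) ∂S.μ) = P v φ := by
    intro v φ
    change (∫ x in S.Ω, _) = _
    refine integral_congr_ae (Eventually.of_forall fun z => ?_)
    simp only [powF]; ring
  have pu := fun t => pow_int S hα0 (u t) (hu_Lα t)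
  have pΦ := fun t => pow_int S hα0 (Φ t) (hΦm t)
  have pub : ∀ t, ∫ z in S.Ω, ‖S.toL2 (u t) z‖ ^ (α + 2) ≤ B ^ (α + 2) := by
    intro t
    rw [(pu t).2]
    have := hB2 t
    gcongr
  have pΦb : ∀ t, ∫ z in S.Ω, ‖S.toL2 (Φ t) z‖ ^ (α + 2) ≤ (A * B) ^ (α + 2) := by
    intro t
    rw [(pΦ t).2, hΦp]
    have := hVp t
    gcongr
  have hP1 : ∀ t s, Tendsto (fun r => P (u r) (Φ t)) (𝓝 s) (𝓝 (P (u s) (Φ t))) := fun t s =>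
    powF_tendsto1 hα0 (fun r => S.toL2 (u r)) (S.toL2 (u s)) (S.toL2 (Φ t)) (hcont.tendsto s) _
      (fun r => (pu r).1) pub (pu s).1 (pΦ t).1
  have hP2 : ∀ s, Tendsto (fun r => P (u s) (Φ r)) (𝓝 s) (𝓝 (P (u s) (Φ s))) := fun s =>
    powF_tendsto2 hα0 (fun r => S.toL2 (Φ r)) (S.toL2 (Φ s)) (S.toL2 (u s)) (hΦc.tendsto s) _
      (fun r => (pΦ r).1) pΦb (pΦ s).1 (pu s).1
  have hP0 : ∀ s, (P (u s) (Φ s)).re = 0 := by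
    intro s
    have hint := powF_int hα0 (S.toL2 (u s)) (S.toL2 (Φ s)) (Lp.aestronglyMeasurable _)
      (Lp.aestronglyMeasurable _) (pu s).1 (pΦ s).1
    have : (P (u s) (Φ s)).re = ∫ z in S.Ω, (powF α (S.toL2 (u s) z) *
        (starRingEnd ℂ) (S.toL2 (Φ s) z)).re := (integral_re hint).symm
    rw [this]
    refine integral_eq_zero_of_ae ?_
    filter_upwards [hΦae s, hV s] with z h1 h2
    rw [h1, h2]
    simp only [powF, Pi.zero_apply]
    simp
    ring
  -- G
  have hG1 : ∀ s t, l2Pair S (Complex.I • u s) (Φ t) = l2Pair S (u s) (V t) := by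
    intro s t
    unfold l2Pair
    rw [hΦ, map_smul, map_smul, inner_smul_left, inner_smul_right]
    simp
  have hGint : ∀ s t, l2Pair S (u s) (V t) =
      ∫ z in S.Ω, a z * ((starRingEnd ℂ) (S.toL2 (u t) z) * S.toL2 (u s) z).re := by
    intro s t
    unfold l2Pair
    rw [L2.inner_def]
    have := (integral_re (L2.integrable_inner (𝕜 := ℂ) (S.toL2 (V t)) (S.toL2 (u s)))).symm
    refine Eq.trans this ?_
    refine integral_congr_ae ?_
    filter_upwards [hV t] with z hz
    rw [hz]
    simp
    ring
  have hsymm : ∀ s t, l2Pair S (u s) (V t) = l2Pair S (u t) (V s) := by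
    intro s t
    rw [hGint, hGint]
    congr 1
    funext z
    simp only [Complex.mul_re, Complex.conj_re, Complex.conj_im]
    ring
  set C2 := C * ((2 * A + L) * B + A * B) with hC2
  have hC20 : 0 ≤ C2 := by positivity
  have hLip : ∀ s s' t, |l2Pair S (u s) (V t) - l2Pair S (u s') (V t)| ≤ C2 * |s - s'| := by
    intro s s' t
    refine (hC s' s (V t) (hVm t)).trans ?_
    rw [hC2, mul_right_comm]
    gcongr
    · exact hVH t
    · exact hVp t
  set D : ℝ → ℝ → ℝ := fun s t => -(deltaPair S (u s) (Φ t) - lam * (P (u s) (Φ t)).re) with hD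
  have hderiv : ∀ s t, HasDerivAt (fun x => l2Pair S (u x) (V t)) (D s t) s := by
    intro s t
    refine aux_weak_to_deriv (fun x => l2Pair S (u x) (V t))
      (fun s => deltaPair S (u s) (Φ t) - lam * (P (u s) (Φ t)).re) C2 ?_ ?_ ?_ s
    · intro s' t'
      exact hLip t' s' t
    · refine (delta_cont S u B hB1 hcont (Φ t)).sub (continuous_const.mul
        (Complex.continuous_re.comp ?_))
      rw [continuous_iff_continuousAt]
      exact fun s => hP1 t s
    · intro ψ h1 h2 h3
      have := hweak (Φ t) (hΦm t) ψ h1 h2 h3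
      simp only [hPeq, hG1] at this
      exact this
  have hmain := aux_time (fun s t => l2Pair S (u s) (V t)) D C2 (L * (2 * ‖S.toL2 u₀‖ * Q)) hC20 hsymm hLip
    hderiv ?_ T
  · have hconv : ∀ t, l2Pair S (u t) (V t) = ∫ x in S.Ω, a x * ‖S.toL2 (u t) x‖ ^ 2 := by
      intro t
      rw [hGint]
      congr 1
      funext z
      rw [← Complex.normSq_eq_conj_mul_self, Complex.ofReal_re, Complex.normSq_eq_norm_sq]
    simp only [hconv] at hmain
    exact hmain
  · intro s η hη
    have hlim : Tendsto (fun t => |lam * ((P (u s) (Φ t)).re + (P (u t) (Φ s)).re)|) (𝓝 s) (𝓝 0) := by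
      have h1 := (Complex.continuous_re.tendsto _).comp (hP2 s)
      have h2 := (Complex.continuous_re.tendsto _).comp (hP1 s s)
      have h3 := ((h1.add h2).const_mul lam).abs
      rw [hP0] at h3
      simpa using h3
    filter_upwards [hlim.eventually (gt_mem_nhds hη)] with t ht
    have e : D s t + D t s = -(deltaPair S (u s) (Φ t) + deltaPair S (u t) (Φ s)) +
        lam * ((P (u s) (Φ t)).re + (P (u t) (Φ s)).re) := by
      simp only [hD]; ring
    rw [e]
    refine (abs_add_le _ _).trans ?_
    rw [abs_neg]
    have hcb := comm_bound S a ha A L hA hL (u s) (u t) (V s) (V t) (hV s) (hV t)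
    rw [hcharge, hcharge] at hcb
    have hQ1 : L * (‖S.grad (u s)‖ * ‖S.toL2 u₀‖ + ‖S.grad (u t)‖ * ‖S.toL2 u₀‖) ≤
        L * (Q * ‖S.toL2 u₀‖ + Q * ‖S.toL2 u₀‖) := by
      gcongr
      · exact hQ s
      · exact hQ t
    have : L * (Q * ‖S.toL2 u₀‖ + Q * ‖S.toL2 u₀‖) = L * (2 * ‖S.toL2 u₀‖ * Q) := by ring
    have h9 := hcb.trans hQ1
    rw [this] at h9
    linarith
lemma cutoff (κ : ℝ) (hκ0 : 0 < κ) (hκ1 : κ < 1) : ∃ F : EucSp N → ℝ, ContDiff ℝ (⊤ : ℕ∞) F ∧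
    (∀ x, 0 ≤ F x) ∧ (∃ M, ∀ x, F x ≤ M) ∧ LipschitzWith 1 F ∧ F 0 = 0 ∧
    ∀ x, 1 ≤ ‖x‖ → κ ≤ F x := by
  set δ := (1 - κ) / 2 with hδ
  have hδ0 : 0 < δ := by rw [hδ]; linarith
  set b : EucSp N → ℝ := fun x => Real.sqrt (δ ^ 2 + ‖x‖ ^ 2) - δ with hb
  have hb0 : ∀ x, 0 ≤ b x := by
    intro x
    simp only [hb, sub_nonneg]
    exact Real.le_sqrt_of_sq_le (by nlinarith [sq_nonneg ‖x‖])
  have hbs : ContDiff ℝ (⊤ : ℕ∞) b := by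
    refine ContDiff.sub (ContDiff.sqrt ?_ ?_) contDiff_const
    · exact contDiff_const.add (contDiff_norm_sq ℝ)
    · intro x; positivity
  have hbl : ∀ x y, b x ≤ b y + ‖x - y‖ := by
    intro x y
    have h1 : ‖x‖ ≤ ‖y‖ + ‖x - y‖ := by
      have := norm_add_le y (x - y); simpa using this
    have hq := Real.sq_sqrt (by positivity : 0 ≤ δ ^ 2 + ‖y‖ ^ 2)
    have hqy : ‖y‖ ≤ Real.sqrt (δ ^ 2 + ‖y‖ ^ 2) := Real.le_sqrt_of_sq_le (by nlinarith)
    have : Real.sqrt (δ ^ 2 + ‖x‖ ^ 2) ≤ Real.sqrt (δ ^ 2 + ‖y‖ ^ 2) + ‖x - y‖ := by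
      rw [Real.sqrt_le_left (by positivity)]
      have h2 : ‖x‖ ^ 2 ≤ (‖y‖ + ‖x - y‖) ^ 2 := by gcongr
      nlinarith [mul_le_mul_of_nonneg_right hqy (norm_nonneg (x - y))]
    simp only [hb]; linarith
  have hpos : ∀ x, 0 < 1 + δ * b x := fun x => by have := hb0 x; positivity
  refine ⟨fun x => b x / (1 + δ * b x), ?_, ?_, ⟨1 / δ, ?_⟩, ?_, ?_, ?_⟩
  · exact hbs.div (contDiff_const.add (contDiff_const.mul hbs)) fun x => (hpos x).ne'
  · intro x; exact div_nonneg (hb0 x) (hpos x).le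
  · intro x
    rw [div_le_div_iff₀ (hpos x) hδ0]; linarith
  · have key : ∀ x y, b x / (1 + δ * b x) ≤ b y / (1 + δ * b y) + ‖x - y‖ := by
      intro x y
      have e : b x / (1 + δ * b x) - b y / (1 + δ * b y) =
          (b x - b y) / ((1 + δ * b x) * (1 + δ * b y)) := by
        rw [div_sub_div _ _ (hpos x).ne' (hpos y).ne']
        congr 1
        ring
      have h1 : (b x - b y) / ((1 + δ * b x) * (1 + δ * b y)) ≤ ‖x - y‖ := by
        rw [div_le_iff₀ (mul_pos (hpos x) (hpos y))]
        have h2 := hbl x y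
        have h3 : 1 ≤ (1 + δ * b x) * (1 + δ * b y) := by
          have := mul_nonneg hδ0.le (hb0 x)
          have := mul_nonneg hδ0.le (hb0 y)
          nlinarith
        nlinarith [norm_nonneg (x - y)]
      linarith
    refine LipschitzWith.of_dist_le_mul fun x y => ?_
    rw [Real.dist_eq, dist_eq_norm, abs_le]
    have h1 := key x y
    have h2 := key y x
    rw [norm_sub_rev] at h2
    constructor <;> simp <;> linarith
  · have : b 0 = 0 := by simp [hb, Real.sqrt_sq hδ0.le]
    simp [this]
  · intro x hx
    rw [le_div_iff₀ (hpos x)]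
    have h1 : 1 - δ ≤ b x := by
      have : 1 ≤ Real.sqrt (δ ^ 2 + ‖x‖ ^ 2) := Real.le_sqrt_of_sq_le (by nlinarith)
      simp only [hb]; linarith
    have h2 : 0 < 1 - κ * δ := by rw [hδ]; nlinarith
    have h3 : κ ≤ (1 - δ) * (1 - κ * δ) := by rw [hδ]; nlinarith [sq_nonneg (1 - κ)]
    nlinarith [mul_le_mul_of_nonneg_right h1 h2.le]

lemma holder_part (S : DirichletSetting N) (f : Lp ℂ 2 (volume.restrict S.Ω)) (c : EucSp N)
    (M₀ τ e : ℝ) (hM : 0 < M₀) (hτ : 0 < τ) (he : 0 < e)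
    (h : e ^ 2 ≤ ∫ x in S.Ω ∩ ball c (M₀ * τ), ‖f x‖ ^ 2) (r : ℝ≥0∞) (hr : 2 ≤ r) :
    ENNReal.ofReal e * (volume (ball (0 : EucSp N) M₀)) ^ (-((1:ℝ)/2 - (1/r).toReal)) ≤
      ENNReal.ofReal (τ ^ ((N : ℝ) * ((1:ℝ)/2 - (1/r).toReal))) *
            eLpNorm f r (volume.restrict (S.Ω ∩ ball c (M₀ * τ))) := by
  set ν := volume.restrict (S.Ω ∩ ball c (M₀ * τ)) with hν
  set W := volume (ball (0 : EucSp N) M₀) with hW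
  have hW0 : W ≠ 0 := (measure_ball_pos _ _ hM).ne'
  have hWt : W ≠ ∞ := measure_ball_lt_top.ne
  have hνle : ν ≤ volume.restrict S.Ω := Measure.restrict_mono inter_subset_left le_rfl
  have hfm : MemLp f 2 ν := (Lp.memLp f).mono_measure hνle
  have hs : (1:ℝ)/(2:ℝ≥0∞).toReal - 1 / r.toReal = (1:ℝ)/2 - (1/r).toReal := by simp
  set s := (1:ℝ)/2 - (1/r).toReal with hsdef
  have hs0 : 0 ≤ s := by
    rw [hsdef, sub_nonneg]
    have : (1/r).toReal ≤ (1/(2:ℝ≥0∞)).toReal :=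
      ENNReal.toReal_mono (by simp) (ENNReal.div_le_div_left hr 1)
    simpa using this
  have h1 : ENNReal.ofReal e ≤ eLpNorm f 2 ν := by
    rw [hfm.eLpNorm_eq_integral_rpow_norm (by simp) (by simp)]
    apply ENNReal.ofReal_le_ofReal
    have e1 : ∫ a, ‖f a‖ ^ (2:ℝ≥0∞).toReal ∂ν = ∫ x in S.Ω ∩ ball c (M₀ * τ), ‖f x‖ ^ 2 := by
      simp [hν]
    rw [e1]
    have := Real.rpow_le_rpow (by positivity) h (by norm_num : (0:ℝ) ≤ (2:ℝ≥0∞).toReal⁻¹)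
    refine le_trans (le_of_eq ?_) this
    rw [← Real.rpow_natCast, ← Real.rpow_mul he.le]
    simp
  have h2 := eLpNorm_le_eLpNorm_mul_rpow_measure_univ (μ := ν) hr hfm.1
  rw [hs] at h2
  have h3 : ν univ ≤ ENNReal.ofReal (τ ^ N) * W := by
    rw [hν, Measure.restrict_apply_univ]
    refine (measure_mono inter_subset_right).trans (le_of_eq ?_)
    have := Measure.addHaar_ball_mul_of_pos (volume : Measure (EucSp N)) c hτ M₀
    rw [mul_comm M₀, this, finrank_euclideanSpace_fin]
  have h4 : ν univ ^ s ≤ ENNReal.ofReal (τ ^ ((N:ℝ) * s)) * W ^ s := by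
    refine (ENNReal.rpow_le_rpow h3 hs0).trans (le_of_eq ?_)
    rw [ENNReal.mul_rpow_of_nonneg _ _ hs0, ENNReal.ofReal_rpow_of_nonneg (by positivity) hs0,
      Real.rpow_mul hτ.le, Real.rpow_natCast]
  calc ENNReal.ofReal e * W ^ (-s)
      ≤ (eLpNorm f r ν * (ENNReal.ofReal (τ ^ ((N:ℝ) * s)) * W ^ s)) * W ^ (-s) := by
        gcongr
        exact h1.trans (h2.trans (by gcongr))
    _ = ENNReal.ofReal (τ ^ ((N:ℝ) * s)) * eLpNorm f r ν * (W ^ s * W ^ (-s)) := by ring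
    _ = _ := by
        rw [← ENNReal.rpow_add _ _ hW0 hWt]; simp

open scoped Topology in
lemma liminf_part {l : Filter ℝ} (g : ℝ → ℝ≥0∞) (ε : ℝ) (hε : 0 < ε) (W : ℝ≥0∞)
    (h : ∀ e, 0 < e → e < ε → ∀ᶠ t in l, ENNReal.ofReal e * W ≤ g t) :
    ENNReal.ofReal ε * W ≤ liminf g l := by
  have hc : Tendsto (fun e : ℝ => ENNReal.ofReal e * W) (𝓝[<] ε) (𝓝 (ENNReal.ofReal ε * W)) := by
    refine ENNReal.Tendsto.mul_const ?_ (Or.inl (by simpa using hε))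
    exact (ENNReal.continuous_ofReal.tendsto ε).mono_left nhdsWithin_le_nhds
  refine le_of_tendsto hc ?_
  have : Ioo 0 ε ∈ 𝓝[<] ε := Ioo_mem_nhdsLT hε
  filter_upwards [this] with e he
  exact le_liminf_of_le (by isBoundedDefault) (h e he.1 he.2)
lemma L2_sq {X E : Type*} [MeasurableSpace X] {μ : Measure X} [NormedAddCommGroup E]
    (f : Lp E 2 μ) : Integrable (fun x => ‖f x‖ ^ 2) μ ∧ ∫ x, ‖f x‖ ^ 2 ∂μ = ‖f‖ ^ 2 := by
  constructor
  · exact (Lp.memLp f).integrable_norm_pow (by norm_num)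
  · have h := aux_L2_norm f
    rw [← h, ← Real.sqrt_eq_rpow, Real.sq_sqrt (integral_nonneg fun x => by positivity)]
    simp

open scoped Topology in
lemma mass_part (S : DirichletSetting N) (u₀ : S.H) (u : ℝ → S.H)
    (hcharge : ∀ t : ℝ, ‖S.toL2 (u t)‖ = ‖S.toL2 u₀‖) (Q : ℝ)
    (hcore : ∀ (a : EucSp N → ℝ), ContDiff ℝ (⊤ : ℕ∞) a → IsW1inf S.Ω a → ∀ A L : ℝ,
      (∀ x, |a x| ≤ A) → (∀ x, ‖gradC a x‖ ≤ L) → ∀ T : ℝ,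
      (∫ x in S.Ω, a x * ‖S.toL2 (u T) x‖ ^ 2) - (∫ x in S.Ω, a x * ‖S.toL2 (u 0) x‖ ^ 2)
      ≤ L * (2 * ‖S.toL2 u₀‖ * Q) * |T|)
    (ε e : ℝ) (he0 : 0 < e) (heε : e < ε) (hε : ε < ‖S.toL2 u₀‖) (hQ : 0 < Q) (M₀ : ℝ)
    (hM₀ : M₀ = 2 * ‖S.toL2 u₀‖ * Q / (‖S.toL2 u₀‖ ^ 2 - ε ^ 2)) (c : EucSp N)
    (l : Filter ℝ) (hl : Tendsto (fun t : ℝ => |t|) l atTop) :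
    ∀ᶠ t in l, e ^ 2 ≤ ∫ x in S.Ω ∩ ball c (M₀ * |t|), ‖S.toL2 (u t) x‖ ^ 2 := by
  set m := ‖S.toL2 u₀‖ with hm
  have hm0 : 0 < m := he0.trans (heε.trans hε)
  have h1 : 0 < m ^ 2 - ε ^ 2 := by nlinarith
  have h2 : m ^ 2 - ε ^ 2 < m ^ 2 - e ^ 2 := by nlinarith
  have h3 : 0 < m ^ 2 - e ^ 2 := h1.trans h2
  have hMpos : 0 < M₀ := by rw [hM₀]; positivity
  set κ := ((m ^ 2 - ε ^ 2) / (m ^ 2 - e ^ 2) + 1) / 2 with hκ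
  have hκe : κ * (m ^ 2 - e ^ 2) = ((m ^ 2 - ε ^ 2) + (m ^ 2 - e ^ 2)) / 2 := by
    rw [hκ]; field_simp
  have hκ0 : 0 < κ := by positivity
  have hκ1 : κ < 1 := by
    have : (m ^ 2 - ε ^ 2) / (m ^ 2 - e ^ 2) < 1 := by rwa [div_lt_one h3]
    rw [hκ]; linarith
  set η := ((m ^ 2 - e ^ 2) - (m ^ 2 - ε ^ 2)) / 2 with hη
  have hη0 : 0 < η := by rw [hη]; linarith
  obtain ⟨F, hFs, hF0, ⟨M, hFM⟩, hFl, hFz, hFκ⟩ := cutoff (N := N) κ hκ0 hκ1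
  have hFabs : ∀ x, |F x| ≤ M := fun x => by rw [abs_of_nonneg (hF0 x)]; exact hFM x
  obtain ⟨hi0, -⟩ := L2_sq (S.toL2 (u 0))
  have hlim : Tendsto (fun R : ℝ => ∫ x in S.Ω, F (R⁻¹ • (x - c)) * ‖S.toL2 (u 0) x‖ ^ 2) atTop
      (𝓝 0) := by
    have hz : ∫ x in S.Ω, (0:ℝ) = (0:ℝ) := by simp
    suffices hmain : Tendsto (fun R : ℝ => ∫ x in S.Ω, F (R⁻¹ • (x - c)) * ‖S.toL2 (u 0) x‖ ^ 2) atTop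
      (𝓝 (∫ x in S.Ω, (0:ℝ))) by
      rwa [hz] at hmain
    refine tendsto_integral_filter_of_dominated_convergence
      (fun x => M * ‖S.toL2 (u 0) x‖ ^ 2) ?_ ?_ (hi0.const_mul M) ?_
    · refine Eventually.of_forall fun R => ?_
      refine AEStronglyMeasurable.mul ?_ hi0.aestronglyMeasurable
      exact (hFs.continuous.comp (by fun_prop)).aestronglyMeasurable
    · refine Eventually.of_forall fun R => Eventually.of_forall fun x => ?_
      rw [norm_mul, norm_pow, norm_norm, Real.norm_eq_abs]
      exact mul_le_mul_of_nonneg_right (hFabs _) (by positivity)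
    · refine Eventually.of_forall fun x => ?_
      have hx : Tendsto (fun R : ℝ => R⁻¹ • (x - c)) atTop (𝓝 0) := by
        have := (tendsto_inv_atTop_zero (𝕜 := ℝ)).smul_const (x - c)
        simpa using this
      have := ((hFs.continuous.tendsto 0).comp hx).mul_const (‖S.toL2 (u 0) x‖ ^ 2)
      simpa [hFz] using this
  have hlt : Tendsto (fun t : ℝ => M₀ * |t|) l atTop := hl.const_mul_atTop hMpos
  have hev := (hlim.comp hlt).eventually (gt_mem_nhds hη0)
  filter_upwards [hev, hl.eventually_gt_atTop 0] with t ht htp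
  simp only [Function.comp] at ht
  set R := M₀ * |t| with hR
  have hRp : 0 < R := by positivity
  set a : EucSp N → ℝ := fun x => F (R⁻¹ • (x - c)) with ha
  have has : ContDiff ℝ (⊤ : ℕ∞) a := hFs.comp (by fun_prop)
  have hal : LipschitzWith (R⁻¹).toNNReal a := by
    refine LipschitzWith.of_dist_le_mul fun x y => ?_
    have h := hFl.dist_le_mul (R⁻¹ • (x - c)) (R⁻¹ • (y - c))
    rw [dist_smul₀, dist_sub_right] at h
    rw [Real.coe_toNNReal _ (by positivity)]
    simpa [abs_of_pos hRp] using h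
  have haA : ∀ x, |a x| ≤ M := fun x => hFabs _
  have hag : ∀ x, ‖gradC a x‖ ≤ R⁻¹ := fun x => by
    have := norm_fderiv_le_of_lipschitz ℝ hal (x₀ := x)
    rw [Real.coe_toNNReal _ (by positivity)] at this
    exact (norm_gradC_le a x).trans this
  have key := hcore a has ⟨⟨_, hal.lipschitzOnWith⟩, M, fun x _ => haA x⟩ M R⁻¹ haA hag t
  have hRK : R⁻¹ * (2 * m * Q) * |t| = m ^ 2 - ε ^ 2 := by
    rw [hR, hM₀]
    have := htp.ne'
    field_simp
  rw [hRK] at key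
  obtain ⟨hit, het⟩ := L2_sq (S.toL2 (u t))
  rw [hcharge t] at het
  have hind : Integrable ((ball c R).indicator fun x => ‖S.toL2 (u t) x‖ ^ 2)
      (volume.restrict S.Ω) := hit.indicator measurableSet_ball
  have hai : Integrable (fun x => a x * ‖S.toL2 (u t) x‖ ^ 2) (volume.restrict S.Ω) := by
    refine hit.bdd_mul has.continuous.aestronglyMeasurable (c := M) ?_
    exact Eventually.of_forall haA
  have hmain : ∫ x in S.Ω, κ * (‖S.toL2 (u t) x‖ ^ 2
      - (ball c R).indicator (fun x => ‖S.toL2 (u t) x‖ ^ 2) x)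
      ≤ ∫ x in S.Ω, a x * ‖S.toL2 (u t) x‖ ^ 2 := by
    refine integral_mono ((hit.sub hind).const_mul κ) hai fun x => ?_
    by_cases hx : x ∈ ball c R
    · simp only [indicator_of_mem hx, sub_self, mul_zero]
      exact mul_nonneg (hF0 _) (by positivity)
    · simp only [indicator_of_notMem hx, sub_zero]
      refine mul_le_mul_of_nonneg_right (hFκ _ ?_) (by positivity)
      rw [mem_ball, not_lt, dist_eq_norm] at hx
      rw [norm_smul, norm_inv, Real.norm_eq_abs, abs_of_pos hRp, inv_mul_eq_div, le_div_iff₀ hRp]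
      linarith
  rw [integral_const_mul, integral_sub hit hind, setIntegral_indicator measurableSet_ball, het]
    at hmain
  have : κ * (m ^ 2 - ∫ x in S.Ω ∩ ball c R, ‖S.toL2 (u t) x‖ ^ 2) ≤ κ * (m ^ 2 - e ^ 2) := by
    rw [hκe]; rw [hη] at ht; linarith
  have := le_of_mul_le_mul_left this hκ0
  linarith

lemma energy_pos (S : DirichletSetting N) (lam α : ℝ) (hlam : 0 < lam) (hα0 : 0 ≤ α)
    (u₀ : S.H) (hu₀ : u₀ ≠ 0) (h : MemLp (S.toL2 u₀) (ENNReal.ofReal (α + 2)) S.μ) :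
    0 < repulsiveEnergy S lam α u₀ := by
  have h0 : eLpNorm (S.toL2 u₀) (ENNReal.ofReal (α + 2)) S.μ ≠ 0 := by
    intro h0
    rw [eLpNorm_eq_zero_iff h.1 (by simp; linarith)] at h0
    have h1 : S.toL2 u₀ = 0 := (Lp.eq_zero_iff_ae_eq_zero).2 h0
    exact hu₀ (S.toL2_injective (by rw [h1, map_zero]))
  have := ENNReal.toReal_pos h0 h.2.ne
  unfold repulsiveEnergy
  have : 0 < α + 2 := by linarith
  positivity

lemma grad_energy (S : DirichletSetting N) (lam α : ℝ) (hlam : 0 < lam) (hα0 : 0 ≤ α)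
    (v : S.H) (K : ℝ) (h : repulsiveEnergy S lam α v ≤ K) : ‖S.grad v‖ ≤ Real.sqrt (2 * K) := by
  refine Real.le_sqrt_of_sq_le ?_
  unfold repulsiveEnergy at h
  have : 0 ≤ (lam / (α + 2)) *
      ((eLpNorm (S.toL2 v) (ENNReal.ofReal (α + 2)) S.μ).toReal) ^ (α + 2) := by positivity
  linarith

/-- **Repulsive single power nonlinearity of arbitrary size (Bégout, Example 3.6).**
Let `Ω ⊆ ℝ^N` be a nonempty open set, `λ > 0`, `0 ≤ α < ∞`, `f(u) = -λ|u|^α u`,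
`E = H¹₀(Ω) ∩ L^{α+2}(Ω)` and `E* = H⁻¹(Ω) + L^{(α+2)/(α+1)}(Ω)`. Let
`u₀ ∈ H¹₀(Ω) \ {0}` and `u ∈ L^∞(ℝ;E) ∩ W^{1,∞}(ℝ;E*)` be a weak solution of
`i∂ₜu + Δu - λ|u|^α u = 0`, `u(0) = u₀`, satisfying conservation of charge and
`E(u(t)) ≤ E(u₀)` for all `t`, where
`E(v) = (1/2)‖∇v‖²_{L²} + (λ/(α+2))‖v‖^{α+2}_{L^{α+2}}`. Then for every
`0 < ε < ‖u₀‖_{L²(Ω)}`, with `M₀ = 2‖u₀‖_{L²}√(2E(u₀))/(‖u₀‖²_{L²} - ε²)`, for every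
`c ∈ Ω` and `r ∈ [2,∞]`:
`liminf_{t→±∞} |t|^{N(1/2-1/r)} ‖u(t)‖_{L^r(Ω∩{|x-c|<M₀|t|})} ≥ ε |B(0,M₀)|^{-(1/2-1/r)}`. -/
theorem repulsive_power_lower_bound (N : ℕ) (S : DirichletSetting N)
    (lam α : ℝ) (hlam : 0 < lam) (hα0 : 0 ≤ α)
    (u₀ : S.H) (hu₀ : u₀ ≠ 0) (u : ℝ → S.H) (hu0 : u 0 = u₀)
    (hu_Lα : ∀ t : ℝ, MemLp (S.toL2 (u t)) (ENNReal.ofReal (α + 2)) S.μ)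
    (hu_bdd : ∃ C : ℝ, ∀ t : ℝ,
      ‖u t‖ + (eLpNorm (S.toL2 (u t)) (ENNReal.ofReal (α + 2)) S.μ).toReal ≤ C)
    (hu_lipE : ∃ C : ℝ, ∀ (s t : ℝ) (φ : S.H),
      MemLp (S.toL2 φ) (ENNReal.ofReal (α + 2)) S.μ →
      |l2Pair S (u t) φ - l2Pair S (u s) φ|
        ≤ C * |t - s| * (‖φ‖ + (eLpNorm (S.toL2 φ) (ENNReal.ofReal (α + 2)) S.μ).toReal))
    (hweak : ∀ (φ : S.H), MemLp (S.toL2 φ) (ENNReal.ofReal (α + 2)) S.μ →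
      ∀ (ψ : ℝ → ℝ), ContDiff ℝ (⊤ : ℕ∞) ψ → HasCompactSupport ψ →
      tsupport ψ ⊆ {t : ℝ | t ≠ 0} →
      ∫ t : ℝ, (-(l2Pair S (Complex.I • u t) φ) * deriv ψ t
        + (deltaPair S (u t) φ
            - lam * (∫ x, ((‖(S.toL2 (u t)) x‖ ^ α : ℝ) : ℂ)
                * ((S.toL2 (u t)) x * (starRingEnd ℂ) ((S.toL2 φ) x)) ∂S.μ).re) * ψ t)
        = 0)
    (hcharge : ∀ t : ℝ, ‖S.toL2 (u t)‖ = ‖S.toL2 u₀‖)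
    (henergy : ∀ t : ℝ, repulsiveEnergy S lam α (u t) ≤ repulsiveEnergy S lam α u₀)
    (ε : ℝ) (hε0 : 0 < ε) (hε : ε < ‖S.toL2 u₀‖) (M₀ : ℝ)
    (hM₀ : M₀ = 2 * ‖S.toL2 u₀‖ * Real.sqrt (2 * repulsiveEnergy S lam α u₀)
      / (‖S.toL2 u₀‖ ^ 2 - ε ^ 2)) :
    lowerBoundTwoSided S u ε M₀ := by

  have hE := energy_pos S lam α hlam hα0 u₀ hu₀ (hu0 ▸ hu_Lα 0)
  have hQ0 : 0 < Real.sqrt (2 * repulsiveEnergy S lam α u₀) := Real.sqrt_pos.2 (by linarith)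
  have hQ : ∀ t, ‖S.grad (u t)‖ ≤ Real.sqrt (2 * repulsiveEnergy S lam α u₀) := fun t =>
    grad_energy S lam α hlam hα0 (u t) _ (henergy t)
  have hM : 0 < M₀ := by
    have h1 : 0 < ‖S.toL2 u₀‖ := hε0.trans hε
    have h2 : 0 < ‖S.toL2 u₀‖ ^ 2 - ε ^ 2 := by nlinarith
    rw [hM₀]; positivity
  have gen : ∀ (l : Filter ℝ), Tendsto (fun t : ℝ => |t|) l atTop → ∀ r : ℝ≥0∞, 2 ≤ r →
      ∀ c : EucSp N,
      ENNReal.ofReal ε * (volume (Metric.ball (0 : EucSp N) M₀)) ^ (-((1:ℝ)/2 - (1/r).toReal))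
      ≤ Filter.liminf (fun t : ℝ =>
          ENNReal.ofReal (|t| ^ ((N : ℝ) * ((1:ℝ)/2 - (1/r).toReal))) *
            eLpNorm (S.toL2 (u t)) r (volume.restrict (S.Ω ∩ Metric.ball c (M₀ * |t|)))) l := by
    intro l hl r hr c
    refine liminf_part _ ε hε0 _ fun e he0 heε => ?_
    have := mass_part S u₀ u hcharge _
      (core S lam α hα0 u₀ u hu_Lα hu_bdd hu_lipE hweak hcharge _ hQ)
      ε e he0 heε hε hQ0 M₀ hM₀ c l hl
    filter_upwards [this, hl.eventually_gt_atTop 0] with t ht htp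
    exact holder_part S (S.toL2 (u t)) c M₀ |t| e hM htp he0 ht r hr
  intro r hr c _
  exact ⟨gen atTop tendsto_abs_atTop_atTop r hr c, gen atBot tendsto_abs_atBot_atTop r hr c⟩

end
end

section
/- Let N ≥ 2, let C ⊂ ℝ^N be a nonempty star-shaped open bounded set with smooth boundary, Ω = ℝ^N ∖ \overline{C}, and f(u) = λ(1+|u|²)^{α/2}u with λ > 0 and 0 ≤ α < 4/N (and additionally α < 2/(N−2) if N ≥ 5). Let u₀ ∈ H¹₀(Ω), u₀ ≠ 0, and let u ∈ C_b(ℝ;H¹₀(Ω)) ∩ C¹_b(ℝ;H⁻¹(Ω)) be the unique solution of i∂ₜu + Δu + λ(1+|u|²)^{α/2}u = 0 with Dirichlet boundary condition and u(0) = u₀, satisfying conservation of charge and of the energy E(u₀) = (1/2)‖∇u₀‖²_{L²(Ω)} − (λ/(α+2))∫_Ω ((1+|u₀(x)|²)^{(α+2)/2} − 1) dx. Then for every 0 < ε < ‖u₀‖_{L²(Ω)}, with M₀ = 2‖u₀‖_{L²(Ω)}‖∇u‖_{L^∞(ℝ;L²(Ω))}/(‖u₀‖²_{L²(Ω)} −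 ε²), one has for every c ∈ Ω and r ∈ [2,∞]: liminf_{t→±∞} |t|^{N(1/2−1/r)} ‖u(t)‖_{L^r(Ω ∩ {|x−c| < M₀|t|})} ≥ ε · |B(0,M₀)|^{−(1/2−1/r)}. -/
noncomputable section

open MeasureTheory Filter Metric Set Complex ENNReal NNReal

variable {N : ℕ}

/-- The energy for the nonlinearity `f(u) = λ(1+|u|²)^{α/2}u`:
`E(v) = (1/2)‖∇v‖²_{L²(Ω)} - (λ/(α+2))∫_Ω ((1+|v|²)^{(α+2)/2} - 1) dx`. -/
def exteriorEnergy (S : DirichletSetting N) (lam α : ℝ) (v : S.H) : ℝ :=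
  (1 / 2) * ‖S.grad v‖ ^ 2 -
    (lam / (α + 2)) * ∫ x, ((1 + ‖(S.toL2 v) x‖ ^ 2) ^ ((α + 2) / 2) - 1) ∂S.μ

lemma ds_norm_toL2_le (S : DirichletSetting N) (v : S.H) : ‖S.toL2 v‖ ≤ ‖v‖ := by
  have := S.norm_eq v
  nlinarith [norm_nonneg v, norm_nonneg (S.toL2 v), sq_nonneg ‖S.grad v‖]

lemma ds_norm_grad_le (S : DirichletSetting N) (v : S.H) : ‖S.grad v‖ ≤ ‖v‖ := by
  have := S.norm_eq v
  nlinarith [norm_nonneg v, norm_nonneg (S.grad v), sq_nonneg ‖S.toL2 v‖]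

lemma ds_cont_toL2 (S : DirichletSetting N) : Continuous S.toL2 :=
  (S.toL2.mkContinuous 1 (by simpa using ds_norm_toL2_le S)).continuous

lemma ds_cont_grad (S : DirichletSetting N) : Continuous S.grad :=
  (S.grad.mkContinuous 1 (by simpa using ds_norm_grad_le S)).continuous

def IsTest (S : DirichletSetting N) (v : S.H) (φ : EucSp N → ℂ) : Prop :=
  ContDiff ℝ (⊤ : ℕ∞) φ ∧ HasCompactSupport φ ∧ tsupport φ ⊆ S.Ω ∧
      (S.toL2 v =ᵐ[volume.restrict S.Ω] φ) ∧
      (∀ᵐ x ∂(volume.restrict S.Ω), ∀ j, (S.grad v x) j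
         = fderiv ℝ φ x (EuclideanSpace.single j (1 : ℝ)))

lemma ds_induction (S : DirichletSetting N) (p : S.H → Prop) (hc : IsClosed {v | p v})
    (ht : ∀ v φ, IsTest S v φ → p v) (u : S.H) : p u := by
  have : u ∈ closure {v | p v} := by
    rw [Metric.mem_closure_iff]
    intro δ hδ
    obtain ⟨v, φ, h1, h2, h3, h4, h5, h6⟩ := S.dense_test u δ hδ
    refine ⟨v, ht v φ ⟨h2, h3, h4, h5, ?_⟩, by rwa [dist_eq_norm]⟩
    filter_upwards [h6] with x hx j
    rw [hx]; rfl
  rwa [hc.closure_eq] at this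

/-- component of gradient times L2 function, as an inner product -/
lemma ds_comp_memLp (S : DirichletSetting N) (v : S.H) (j : Fin N) :
    MemLp (fun x => (S.grad v x) j) 2 (volume.restrict S.Ω) := by
  refine (Lp.memLp (S.grad v)).of_le_mul (c := 1) ?_ ?_
  · have hc : Continuous (fun z : EuclideanSpace ℂ (Fin N) => z j) := by fun_prop
    exact hc.comp_aestronglyMeasurable (Lp.aestronglyMeasurable _)
  · filter_upwards with x
    simpa using PiLp.norm_apply_le (S.grad v x) j

lemma ds_cont_int (S : DirichletSetting N) {ψ : EucSp N → ℂ}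
    (hψ : MemLp ψ 2 (volume.restrict S.Ω)) :
    Continuous fun v : S.H => ∫ x in S.Ω, ψ x * S.toL2 v x := by
  have hs : MemLp (fun x => (starRingEnd ℂ) (ψ x)) 2 (volume.restrict S.Ω) := hψ.star
  have : (fun v : S.H => ∫ x in S.Ω, ψ x * S.toL2 v x)
      = fun v : S.H => inner ℂ (hs.toLp _) (S.toL2 v) := by
    ext v
    rw [L2.inner_def]
    refine integral_congr_ae ?_
    filter_upwards [hs.coeFn_toLp] with x hx
    rw [hx]; simp [mul_comm]
  rw [this]
  exact continuous_const.inner (ds_cont_toL2 S)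

lemma memLp_single (S : DirichletSetting N) {ψ : EucSp N → ℂ} (j : Fin N)
    (hψ : MemLp ψ 2 (volume.restrict S.Ω)) :
    MemLp (fun x => EuclideanSpace.single j (ψ x)) 2 (volume.restrict S.Ω) := by
  refine hψ.of_le_mul (c := 1) ?_ ?_
  · have hc : Continuous (fun z : ℂ => EuclideanSpace.single j z) := by
      refine (PiLp.continuous_toLp 2 _).comp ?_
      exact continuous_single (A := fun _ : Fin N => ℂ) j
    exact hc.comp_aestronglyMeasurable hψ.1
  · filter_upwards with x
    simp

lemma ds_cont_int_grad (S : DirichletSetting N) {ψ : EucSp N → ℂ} (j : Fin N)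
    (hψ : MemLp ψ 2 (volume.restrict S.Ω)) :
    Continuous fun v : S.H => ∫ x in S.Ω, ψ x * (S.grad v x) j := by
  have hs : MemLp (fun x => (starRingEnd ℂ) (ψ x)) 2 (volume.restrict S.Ω) := hψ.star
  have hs' := memLp_single S j hs
  have : (fun v : S.H => ∫ x in S.Ω, ψ x * (S.grad v x) j)
      = fun v : S.H => inner ℂ (hs'.toLp _) (S.grad v) := by
    ext v
    rw [L2.inner_def]
    refine integral_congr_ae ?_
    filter_upwards [hs'.coeFn_toLp] with x hx
    rw [hx, EuclideanSpace.inner_single_left]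
    simp
  rw [this]
  exact continuous_const.inner (ds_cont_grad S)

/-- Weak gradient formula. -/
lemma ds_ibp (S : DirichletSetting N) {ψ : EucSp N → ℂ} (hψ : ContDiff ℝ 1 ψ)
    (hψc : HasCompactSupport ψ) (j : Fin N) (v : S.H) :
    ∫ x in S.Ω, ψ x * (S.grad v x) j
      = - ∫ x in S.Ω, fderiv ℝ ψ x (EuclideanSpace.single j (1 : ℝ)) * S.toL2 v x := by
  have hd : Continuous fun x => fderiv ℝ ψ x (EuclideanSpace.single j (1 : ℝ)) :=
    (hψ.continuous_fderiv (by norm_num)).clm_apply continuous_const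
  have hdc : HasCompactSupport fun x => fderiv ℝ ψ x (EuclideanSpace.single j (1 : ℝ)) :=
    hψc.fderiv_apply ℝ _
  have m1 : MemLp ψ 2 (volume.restrict S.Ω) :=
    (hψ.continuous.memLp_of_hasCompactSupport hψc).restrict _
  have m2 : MemLp (fun x => fderiv ℝ ψ x (EuclideanSpace.single j (1 : ℝ))) 2
      (volume.restrict S.Ω) := (hd.memLp_of_hasCompactSupport hdc).restrict _
  refine ds_induction S (fun v => ∫ x in S.Ω, ψ x * (S.grad v x) j
      = - ∫ x in S.Ω, fderiv ℝ ψ x (EuclideanSpace.single j (1 : ℝ)) * S.toL2 v x)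
      (isClosed_eq (ds_cont_int_grad S j m1) (ds_cont_int S m2).neg) ?_ v
  rintro v φ ⟨h1, h2, h3, h4, h5⟩
  have e1 : ∫ x in S.Ω, ψ x * (S.grad v x) j
      = ∫ x, ψ x * fderiv ℝ φ x (EuclideanSpace.single j (1 : ℝ)) := by
    refine Eq.trans ?_ (setIntegral_eq_integral_of_forall_compl_eq_zero (s := S.Ω) ?_)
    · refine integral_congr_ae ?_
      filter_upwards [h5] with x hx
      rw [hx]
    · intro x hx
      have : fderiv ℝ φ x = 0 := by
        by_contra hne
        exact hx (h3 (support_fderiv_subset (𝕜 := ℝ) (f := φ) hne))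
      simp [this]
  have e2 : ∫ x in S.Ω, fderiv ℝ ψ x (EuclideanSpace.single j (1 : ℝ)) * S.toL2 v x
      = ∫ x, fderiv ℝ ψ x (EuclideanSpace.single j (1 : ℝ)) * φ x := by
    refine Eq.trans ?_ (setIntegral_eq_integral_of_forall_compl_eq_zero (s := S.Ω) ?_)
    · refine integral_congr_ae ?_
      filter_upwards [h4] with x hx
      rw [hx]
    · intro x hx
      have : φ x = 0 := by
        by_contra hne
        exact hx (h3 (subset_tsupport _ hne))
      simp [this]
  rw [e1, e2]
  have hφ1 : ContDiff ℝ 1 φ := h1.of_le (by norm_cast)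
  have hφd : Continuous fun x => fderiv ℝ φ x (EuclideanSpace.single j (1 : ℝ)) :=
    (hφ1.continuous_fderiv (by norm_num)).clm_apply continuous_const
  refine integral_mul_fderiv_eq_neg_fderiv_mul_of_integrable ?_ ?_ ?_ ?_ ?_
  · exact (hd.mul hφ1.continuous).integrable_of_hasCompactSupport hdc.mul_right
  · exact (hψ.continuous.mul hφd).integrable_of_hasCompactSupport hψc.mul_right
  · exact (hψ.continuous.mul hφ1.continuous).integrable_of_hasCompactSupport hψc.mul_right
  · exact fun x _ => (hψ.differentiable (by norm_num)) x
  · exact fun x _ => (hφ1.differentiable (by norm_num)) x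

lemma ds_grad_zero (hN : 2 ≤ N) (S : DirichletSetting N) (u : S.H) (hu : S.grad u = 0) : u = 0 := by
  let j : Fin N := ⟨0, by omega⟩
  let e : EucSp N := EuclideanSpace.single j (1 : ℝ)
  let b : EucSp N → ℝ := fun x => Real.arctan (x j)
  let b' : EucSp N → ℝ := fun x => 1 / (1 + (x j) ^ 2)
  have hbc : ContDiff ℝ 1 b := by
    refine Real.contDiff_arctan.comp ?_
    fun_prop
  have hb'c : Continuous b' := by
    refine continuous_const.div (by fun_prop) (fun x => by positivity)
  have hbd : ∀ x, HasFDerivAt b ((b' x) • (EuclideanSpace.proj j : EucSp N →L[ℝ] ℝ)) x := by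
    intro x
    exact (Real.hasDerivAt_arctan (x j)).comp_hasFDerivAt x
      (EuclideanSpace.proj j : EucSp N →L[ℝ] ℝ).hasFDerivAt
  have hg0 : ∀ᵐ x ∂(volume.restrict S.Ω), S.grad u x = 0 := by
    rw [hu]; exact Lp.coeFn_zero _ _ _
  have hm := Lp.memLp (S.toL2 u)
  have m1 : MemLp (fun x => (b' x : ℂ) * (starRingEnd ℂ) (S.toL2 u x)) 2 (volume.restrict S.Ω) := by
    refine hm.of_le_mul (c := 1) ?_ ?_
    · exact ((Complex.continuous_ofReal.comp hb'c).aestronglyMeasurable).mul hm.star.1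
    · filter_upwards with x
      have : ‖(b' x : ℂ)‖ ≤ 1 := by
        rw [Complex.norm_real, Real.norm_eq_abs, abs_of_nonneg (by positivity)]
        exact div_le_one_of_le₀ (by nlinarith [sq_nonneg (x j)]) (by positivity)
      rw [norm_mul, RCLike.norm_conj]
      gcongr
  have m2 : MemLp (fun x => (b x : ℂ) * (starRingEnd ℂ) (S.toL2 u x)) 2 (volume.restrict S.Ω) := by
    refine hm.of_le_mul (c := Real.pi / 2) ?_ ?_
    · exact ((Complex.continuous_ofReal.comp hbc.continuous).aestronglyMeasurable).mul hm.star.1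
    · filter_upwards with x
      have : ‖(b x : ℂ)‖ ≤ Real.pi / 2 := by
        rw [Complex.norm_real, Real.norm_eq_abs, abs_le]
        exact ⟨(Real.neg_pi_div_two_lt_arctan _).le, (Real.arctan_lt_pi_div_two _).le⟩
      rw [norm_mul, RCLike.norm_conj]
      gcongr
  have key : (∫ x in S.Ω, ((b' x : ℂ) * (starRingEnd ℂ) (S.toL2 u x)) * S.toL2 u x)
      + ∫ x in S.Ω, ((b x : ℂ) * (starRingEnd ℂ) (S.toL2 u x)) * (S.grad u x) j = 0 := by
    refine ds_induction S (fun w => (∫ x in S.Ω, ((b' x : ℂ) * (starRingEnd ℂ) (S.toL2 u x)) * S.toL2 w x)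
      + ∫ x in S.Ω, ((b x : ℂ) * (starRingEnd ℂ) (S.toL2 u x)) * (S.grad w x) j = 0)
      (isClosed_eq ((ds_cont_int S m1).add (ds_cont_int_grad S j m2)) continuous_const) ?_ u
    intro w φ hw
    obtain ⟨h1, h2, h3, h4, h5⟩ := hw
    have hφ1 : ContDiff ℝ 1 φ := h1.of_le (by norm_cast)
    let ψ : EucSp N → ℂ := fun x => (b x : ℂ) * (starRingEnd ℂ) (φ x)
    have hψ : ContDiff ℝ 1 ψ :=
      (Complex.ofRealCLM.contDiff.comp hbc).mul (Complex.conjCLE.contDiff.comp hφ1)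
    have hψc : HasCompactSupport ψ := by
      refine HasCompactSupport.mul_left ?_
      exact h2.comp_left (g := starRingEnd ℂ) (map_zero _)
    have hψd : ∀ x, fderiv ℝ ψ x e = (b' x : ℂ) * (starRingEnd ℂ) (φ x)
        + (b x : ℂ) * (starRingEnd ℂ) (fderiv ℝ φ x e) := by
      intro x
      have d1 : HasFDerivAt (fun x => (b x : ℂ))
          (Complex.ofRealCLM.comp ((b' x) • (EuclideanSpace.proj j : EucSp N →L[ℝ] ℝ))) x :=
        Complex.ofRealCLM.hasFDerivAt.comp x (hbd x)
      have d2 : HasFDerivAt (fun x => (starRingEnd ℂ) (φ x))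
          ((Complex.conjCLE : ℂ →L[ℝ] ℂ).comp (fderiv ℝ φ x)) x :=
        (Complex.conjCLE : ℂ →L[ℝ] ℂ).hasFDerivAt.comp x
          ((hφ1.differentiable (by norm_num)) x).hasFDerivAt
      have := (d1.mul d2).fderiv
      have h' : fderiv ℝ ψ x = _ := this
      rw [h']
      simp [e]
      ring
    have hi := ds_ibp S hψ hψc j u
    have z : ∫ x in S.Ω, ψ x * (S.grad u x) j = 0 := by
      rw [← integral_zero (EucSp N) ℂ (μ := volume.restrict S.Ω)]
      refine integral_congr_ae ?_
      filter_upwards [hg0] with x hx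
      simp [hx]
    rw [z] at hi
    have hi2 : ∫ x in S.Ω, fderiv ℝ ψ x e * S.toL2 u x = 0 := by
      have := neg_eq_zero.1 hi.symm
      exact this
    have hi3 := congrArg (starRingEnd ℂ) hi2
    rw [← integral_conj, map_zero] at hi3
    have n1 : Integrable (fun x => ((b' x : ℂ) * (starRingEnd ℂ) (S.toL2 u x)) * S.toL2 w x)
      (volume.restrict S.Ω) := m1.integrable_mul (Lp.memLp (S.toL2 w))
    have n2 : Integrable (fun x => ((b x : ℂ) * (starRingEnd ℂ) (S.toL2 u x)) * (S.grad w x) j)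
      (volume.restrict S.Ω) := m2.integrable_mul (ds_comp_memLp S w j)
    rw [← integral_add n1 n2, ← hi3]
    refine integral_congr_ae ?_
    filter_upwards [h4, h5] with x hx4 hx5
    rw [hx4, hx5, hψd]
    simp [e]
    ring
  have z : ∫ x in S.Ω, ((b x : ℂ) * (starRingEnd ℂ) (S.toL2 u x)) * (S.grad u x) j = 0 := by
      rw [← integral_zero (EucSp N) ℂ (μ := volume.restrict S.Ω)]
      refine integral_congr_ae ?_
      filter_upwards [hg0] with x hx
      simp [hx]
  rw [z, add_zero] at key
  have n1 : Integrable (fun x => ((b' x : ℂ) * (starRingEnd ℂ) (S.toL2 u x)) * S.toL2 u x)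
      (volume.restrict S.Ω) := m1.integrable_mul (Lp.memLp (S.toL2 u))
  have e1 : ∀ x, ((b' x : ℂ) * (starRingEnd ℂ) (S.toL2 u x)) * S.toL2 u x
      = ((b' x * ‖S.toL2 u x‖ ^ 2 : ℝ) : ℂ) := by
    intro x
    rw [mul_assoc, ← Complex.normSq_eq_conj_mul_self, Complex.normSq_eq_norm_sq]
    push_cast; rfl
  simp_rw [e1] at key n1
  rw [integral_complex_ofReal] at key
  have n2 : Integrable (fun x => b' x * ‖S.toL2 u x‖ ^ 2) (volume.restrict S.Ω) := by
    exact n1.re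
  have key2 := (integral_eq_zero_iff_of_nonneg (fun x => by positivity) n2).1 (by exact_mod_cast key)
  have : S.toL2 u = 0 := by
    rw [Lp.eq_zero_iff_ae_eq_zero]
    filter_upwards [key2] with x hx
    have hb : b' x ≠ 0 := by positivity
    simpa [hb] using hx
  exact S.toL2_injective (by rw [this, map_zero])

lemma grad_vec_norm_le {a : EucSp N → ℝ} {L : ℝ≥0} (hL : LipschitzWith L a) (x : EucSp N) (z : ℂ) :
    ‖(WithLp.toLp 2 (fun j => z * ((fderiv ℝ a x (EuclideanSpace.single j (1 : ℝ)) : ℝ) : ℂ)) :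
      EuclideanSpace ℂ (Fin N))‖ ≤ L * ‖z‖ := by
  have hn : ‖fderiv ℝ a x‖ ≤ L := norm_fderiv_le_of_lipschitz ℝ hL
  set d : Fin N → ℝ := fun j => fderiv ℝ a x (EuclideanSpace.single j (1 : ℝ)) with hd
  set D : EucSp N := WithLp.toLp 2 d with hD
  have h1 : fderiv ℝ a x D = ‖D‖ ^ 2 := by
    have : D = ∑ j, d j • EuclideanSpace.single j (1 : ℝ) := by
      ext i
      simp [hD, Finset.sum_apply, Pi.single_apply]
    rw [EuclideanSpace.norm_sq_eq]
    conv_lhs => rw [this]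
    rw [map_sum]
    refine Finset.sum_congr rfl fun j _ => ?_
    simp [hD, hd, sq]
  have h2 : ‖D‖ ≤ L := by
    by_contra hlt
    push Not at hlt
    have h3 : fderiv ℝ a x D ≤ L * ‖D‖ :=
      (le_abs_self _).trans (((fderiv ℝ a x).le_opNorm D).trans (by gcongr))
    have : (0 : ℝ) ≤ L := L.2
    nlinarith
  have h4 : ‖(WithLp.toLp 2 (fun j => z * ((d j : ℝ) : ℂ)) :
      EuclideanSpace ℂ (Fin N))‖ = ‖z‖ * ‖D‖ := by
    rw [EuclideanSpace.norm_eq, EuclideanSpace.norm_eq, Real.sqrt_eq_iff_mul_self_eq (by positivity) (by positivity)]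
    simp only [norm_mul, mul_pow, ← Finset.mul_sum, Complex.norm_real]
    rw [mul_mul_mul_comm, Real.mul_self_sqrt (by positivity)]
    ring
  rw [h4, mul_comm]
  gcongr

lemma F1_memLp (S : DirichletSetting N) {a : EucSp N → ℝ} (hac : ContDiff ℝ 1 a) {B : ℝ}
    (hB : ∀ x, |a x| ≤ B) (u : S.H) :
    MemLp (fun x => (a x : ℂ) • S.grad u x) 2 (volume.restrict S.Ω) := by
  refine (Lp.memLp (S.grad u)).of_le_mul (c := B) ?_ ?_
  · exact ((Complex.continuous_ofReal.comp hac.continuous).aestronglyMeasurable).smul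
      (Lp.aestronglyMeasurable _)
  · filter_upwards with x
    rw [norm_smul, Complex.norm_real]
    gcongr
    exact hB x

lemma F2_memLp (S : DirichletSetting N) {a : EucSp N → ℝ} (hac : ContDiff ℝ 1 a) {L : ℝ≥0}
    (hL : LipschitzWith L a) (u : S.H) :
    MemLp (fun x => (WithLp.toLp 2 (fun j => S.toL2 u x *
      ((fderiv ℝ a x (EuclideanSpace.single j (1 : ℝ)) : ℝ) : ℂ)) :
      EuclideanSpace ℂ (Fin N))) 2 (volume.restrict S.Ω) := by
  refine (Lp.memLp (S.toL2 u)).of_le_mul (c := L) ?_ ?_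
  · have hd : Continuous fun x => (WithLp.toLp 2 (fun j => 
      ((fderiv ℝ a x (EuclideanSpace.single j (1 : ℝ)) : ℝ) : ℂ)) : EuclideanSpace ℂ (Fin N)) := by
      refine (PiLp.continuous_toLp 2 _).comp (continuous_pi fun j => ?_)
      exact Complex.continuous_ofReal.comp
        ((hac.continuous_fderiv (by norm_num)).clm_apply continuous_const)
    exact (Lp.aestronglyMeasurable (S.toL2 u)).smul hd.aestronglyMeasurable
  · filter_upwards with x
    exact grad_vec_norm_le hL x _

lemma inner_int (S : DirichletSetting N) (f g : Lp (EuclideanSpace ℂ (Fin N)) 2 (volume.restrict S.Ω)) :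
    inner ℂ f g = ∑ j, ∫ x in S.Ω, (starRingEnd ℂ) (f x j) * g x j := by
  have hcm : ∀ (f : Lp (EuclideanSpace ℂ (Fin N)) 2 (volume.restrict S.Ω)) (j : Fin N),
      MemLp (fun x => (f x) j) 2 (volume.restrict S.Ω) := by
    intro f j
    refine (Lp.memLp f).of_le_mul (c := 1) ?_ ?_
    · have hc : Continuous (fun z : EuclideanSpace ℂ (Fin N) => z j) := by fun_prop
      exact hc.comp_aestronglyMeasurable (Lp.aestronglyMeasurable _)
    · filter_upwards with x
      simpa using PiLp.norm_apply_le (f x) j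
  rw [← integral_finsetSum]
  · rw [L2.inner_def]
    refine integral_congr_ae ?_
    filter_upwards with x
    simp [PiLp.inner_apply, mul_comm]
  · intro j _
    exact MemLp.integrable_mul (p := 2) (q := 2) (hcm f j).star (hcm g j)

lemma ds_product (S : DirichletSetting N) {a : EucSp N → ℝ} (hac : ContDiff ℝ 1 a) {L : ℝ≥0}
    (hL : LipschitzWith L a) {B : ℝ} (hB : ∀ x, |a x| ≤ B) (u v : S.H)
    (hv : S.toL2 v =ᵐ[volume.restrict S.Ω] fun x => (a x : ℂ) * S.toL2 u x) (w : S.H) :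
    inner ℂ (S.grad w) (S.grad v)
      = inner ℂ (S.grad w) ((F1_memLp S hac hB u).toLp _ + (F2_memLp S hac hL u).toLp _) := by
  refine ds_induction S (fun w => inner ℂ (S.grad w) (S.grad v)
      = inner ℂ (S.grad w) ((F1_memLp S hac hB u).toLp _ + (F2_memLp S hac hL u).toLp _))
      (isClosed_eq ((ds_cont_grad S).inner continuous_const)
        ((ds_cont_grad S).inner continuous_const)) ?_ w
  clear w
  rintro w φ ⟨h1, h2, h3, h4, h5⟩
  rw [inner_int, inner_int]
  refine Finset.sum_congr rfl fun j _ => ?_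
  let e : EucSp N := EuclideanSpace.single j (1 : ℝ)
  let ψ : EucSp N → ℂ := fun x => (starRingEnd ℂ) (fderiv ℝ φ x e)
  have hψ : ContDiff ℝ 1 ψ := by
    have : ContDiff ℝ 1 fun x => fderiv ℝ φ x e :=
      (h1.fderiv_right (m := 1) (by norm_cast)).clm_apply contDiff_const
    exact Complex.conjCLE.contDiff.comp this
  have hψc : HasCompactSupport ψ :=
    (h2.fderiv_apply ℝ e).comp_left (g := starRingEnd ℂ) (map_zero _)
  let χ : EucSp N → ℂ := fun x => (a x : ℂ) * ψ x
  have hχ : ContDiff ℝ 1 χ := (Complex.ofRealCLM.contDiff.comp hac).mul hψ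
  have hχc : HasCompactSupport χ := hψc.mul_left
  have hχd : ∀ x, fderiv ℝ χ x e = ((fderiv ℝ a x e : ℝ) : ℂ) * ψ x + (a x : ℂ) * fderiv ℝ ψ x e := by
    intro x
    have d1 : HasFDerivAt (fun x => (a x : ℂ)) (Complex.ofRealCLM.comp (fderiv ℝ a x)) x :=
        Complex.ofRealCLM.hasFDerivAt.comp x ((hac.differentiable (by norm_num)) x).hasFDerivAt
    have h' : fderiv ℝ χ x = _ := (d1.mul ((hψ.differentiable (by norm_num)) x).hasFDerivAt).fderiv
    rw [h']
    simp
    ring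
  have i1 := ds_ibp S hψ hψc j v
  have i2 := ds_ibp S hχ hχc j u
  have cψ : MemLp ψ 2 (volume.restrict S.Ω) :=
    (hψ.continuous.memLp_of_hasCompactSupport hψc).restrict _
  have cχ : MemLp χ 2 (volume.restrict S.Ω) :=
    (hχ.continuous.memLp_of_hasCompactSupport hχc).restrict _
  have cχ' : MemLp (fun x => fderiv ℝ χ x e) 2 (volume.restrict S.Ω) :=
    (((hχ.continuous_fderiv (by norm_num)).clm_apply continuous_const).memLp_of_hasCompactSupport
      (hχc.fderiv_apply ℝ e)).restrict _
  have cd : MemLp (fun x => ((fderiv ℝ a x e : ℝ) : ℂ) * ψ x) 2 (volume.restrict S.Ω) :=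
    (((Complex.continuous_ofReal.comp
        ((hac.continuous_fderiv (by norm_num)).clm_apply continuous_const)).mul
        hψ.continuous).memLp_of_hasCompactSupport hψc.mul_left).restrict _
  have mu := Lp.memLp (S.toL2 u)
  have J1 : Integrable (fun x => χ x * (S.grad u x) j) (volume.restrict S.Ω) :=
    cχ.integrable_mul (ds_comp_memLp S u j)
  have J2 : Integrable (fun x => (((fderiv ℝ a x e : ℝ) : ℂ) * ψ x) * S.toL2 u x)
    (volume.restrict S.Ω) := cd.integrable_mul mu
  have J3 : Integrable (fun x => fderiv ℝ χ x e * S.toL2 u x)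
    (volume.restrict S.Ω) := cχ'.integrable_mul mu
  calc ∫ x in S.Ω, (starRingEnd ℂ) (S.grad w x j) * S.grad v x j
      = ∫ x in S.Ω, ψ x * S.grad v x j := by
        refine integral_congr_ae ?_
        filter_upwards [h5] with x hx
        rw [hx]
    _ = - ∫ x in S.Ω, fderiv ℝ ψ x e * S.toL2 v x := i1
    _ = - ∫ x in S.Ω, (fderiv ℝ χ x e * S.toL2 u x
          - (((fderiv ℝ a x e : ℝ) : ℂ) * ψ x) * S.toL2 u x) := by
        congr 1
        refine integral_congr_ae ?_
        filter_upwards [hv] with x hx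
        rw [hx, hχd]
        ring
    _ = (∫ x in S.Ω, χ x * (S.grad u x) j)
          + ∫ x in S.Ω, (((fderiv ℝ a x e : ℝ) : ℂ) * ψ x) * S.toL2 u x := by
        rw [integral_sub J3 J2, i2]
        ring
    _ = ∫ x in S.Ω, (χ x * (S.grad u x) j
          + (((fderiv ℝ a x e : ℝ) : ℂ) * ψ x) * S.toL2 u x) := (integral_add J1 J2).symm
    _ = _ := by
        refine integral_congr_ae ?_
        filter_upwards [h5, Lp.coeFn_add ((F1_memLp S hac hB u).toLp _) ((F2_memLp S hac hL u).toLp _),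
          (F1_memLp S hac hB u).coeFn_toLp, (F2_memLp S hac hL u).coeFn_toLp] with x g1 g2 g3 g4
        rw [g1, g2, Pi.add_apply, g3, g4]
        simp [χ, ψ, e]
        ring

lemma F2_norm (S : DirichletSetting N) {a : EucSp N → ℝ} (hac : ContDiff ℝ 1 a) {L : ℝ≥0}
    (hL : LipschitzWith L a) (u : S.H) : ‖(F2_memLp S hac hL u).toLp _‖ ≤ L * ‖S.toL2 u‖ := by
  refine Lp.norm_le_mul_norm_of_ae_le_mul ?_
  filter_upwards [(F2_memLp S hac hL u).coeFn_toLp] with x hx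
  rw [hx]
  exact grad_vec_norm_le hL x _

lemma F1_norm (S : DirichletSetting N) {a : EucSp N → ℝ} (hac : ContDiff ℝ 1 a) {B : ℝ}
    (hB : ∀ x, |a x| ≤ B) (u : S.H) : ‖(F1_memLp S hac hB u).toLp _‖ ≤ B * ‖S.grad u‖ := by
  refine Lp.norm_le_mul_norm_of_ae_le_mul ?_
  filter_upwards [(F1_memLp S hac hB u).coeFn_toLp] with x hx
  rw [hx, norm_smul, Complex.norm_real]
  gcongr
  exact hB x

lemma ds_mul_bound (S : DirichletSetting N) {a : EucSp N → ℝ} (hac : ContDiff ℝ 1 a) {L : ℝ≥0}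
    (hL : LipschitzWith L a) {B : ℝ} (hB : ∀ x, |a x| ≤ B) (u v : S.H)
    (hv : S.toL2 v =ᵐ[volume.restrict S.Ω] fun x => (a x : ℂ) * S.toL2 u x) :
    ‖v‖ ≤ (2 * B + L) * ‖u‖ := by
  have hB0 : 0 ≤ B := (abs_nonneg _).trans (hB 0)
  have h0 : ‖S.toL2 v‖ ≤ B * ‖S.toL2 u‖ := by
    refine Lp.norm_le_mul_norm_of_ae_le_mul ?_
    filter_upwards [hv] with x hx
    rw [hx, norm_mul, Complex.norm_real]
    gcongr
    exact hB x
  have h1 : ‖S.grad v‖ ≤ B * ‖S.grad u‖ + L * ‖S.toL2 u‖ := by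
    have hp := ds_product S hac hL hB u v hv v
    have h2 : ‖S.grad v‖ * ‖S.grad v‖ ≤ ‖S.grad v‖ * (B * ‖S.grad u‖ + L * ‖S.toL2 u‖) := by
      have h3 : ‖(inner ℂ (S.grad v) (S.grad v) : ℂ)‖ = ‖S.grad v‖ * ‖S.grad v‖ := by
        rw [inner_self_eq_norm_sq_to_K]
        simp [sq]
      rw [← h3, hp]
      refine (norm_inner_le_norm _ _).trans ?_
      gcongr
      exact (norm_add_le _ _).trans (add_le_add (F1_norm S hac hB u) (F2_norm S hac hL u))
    rcases (norm_nonneg (S.grad v)).eq_or_lt with h | h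
    · rw [← h]; positivity
    · exact le_of_mul_le_mul_left h2 h
  have h2 := S.norm_eq v
  have h3 : ‖v‖ ≤ ‖S.toL2 v‖ + ‖S.grad v‖ := by
    refine abs_le_of_sq_le_sq' ?_ (by positivity) |>.2
    nlinarith [mul_nonneg (norm_nonneg (S.toL2 v)) (norm_nonneg (S.grad v))]
  have := ds_norm_toL2_le S u
  have := ds_norm_grad_le S u
  have : (0 : ℝ) ≤ L := L.2
  calc ‖v‖ ≤ B * ‖S.toL2 u‖ + (B * ‖S.grad u‖ + L * ‖S.toL2 u‖) := by linarith
    _ ≤ B * ‖u‖ + (B * ‖u‖ + L * ‖u‖) := by gcongr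
    _ = _ := by ring

lemma ds_im_bound (S : DirichletSetting N) {a : EucSp N → ℝ} (hac : ContDiff ℝ 1 a) {L : ℝ≥0}
    (hL : LipschitzWith L a) {B : ℝ} (hB : ∀ x, |a x| ≤ B) (u v : S.H)
    (hv : S.toL2 v =ᵐ[volume.restrict S.Ω] fun x => (a x : ℂ) * S.toL2 u x) :
    |(inner ℂ (S.grad u) (S.grad v) : ℂ).im| ≤ L * ‖S.toL2 u‖ * ‖S.grad u‖ := by
  rw [ds_product S hac hL hB u v hv u, inner_add_right, Complex.add_im]
  have h1 : (inner ℂ (S.grad u) ((F1_memLp S hac hB u).toLp _) : ℂ).im = 0 := by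
    have : (inner ℂ (S.grad u) ((F1_memLp S hac hB u).toLp _) : ℂ)
        = ((∫ x in S.Ω, a x * ‖S.grad u x‖ ^ 2 : ℝ) : ℂ) := by
      rw [L2.inner_def, ← integral_complex_ofReal]
      refine integral_congr_ae ?_
      filter_upwards [(F1_memLp S hac hB u).coeFn_toLp] with x hx
      rw [hx, inner_smul_right, inner_self_eq_norm_sq_to_K]
      push_cast; rfl
    rw [this, Complex.ofReal_im]
  rw [h1, zero_add]
  refine (Complex.abs_im_le_norm _).trans ((norm_inner_le_norm _ _).trans ?_)
  rw [mul_comm]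
  gcongr
  exact F2_norm S hac hL u

lemma l2Pair_eq_int (S : DirichletSetting N) {a : EucSp N → ℝ} (u v : S.H)
    (hv : S.toL2 v =ᵐ[volume.restrict S.Ω] fun x => (a x : ℂ) * S.toL2 u x) :
    l2Pair S u v = ∫ x in S.Ω, a x * ‖S.toL2 u x‖ ^ 2 := by
  have : (inner ℂ (S.toL2 v) (S.toL2 u) : ℂ) = ((∫ x in S.Ω, a x * ‖S.toL2 u x‖ ^ 2 : ℝ) : ℂ) := by
    rw [L2.inner_def, ← integral_complex_ofReal]
    refine integral_congr_ae ?_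
    filter_upwards [hv] with x hx
    rw [hx]
    simp only [RCLike.inner_apply, map_mul, Complex.conj_ofReal]
    rw [mul_left_comm, Complex.mul_conj, Complex.normSq_eq_norm_sq]
    push_cast; rfl
  rw [l2Pair, this, Complex.ofReal_re]

lemma l2Pair_sub_left (S : DirichletSetting N) (u v w : S.H) :
    l2Pair S (u - v) w = l2Pair S u w - l2Pair S v w := by
  simp [l2Pair, inner_sub_right]

lemma l2Pair_add_right (S : DirichletSetting N) (u v w : S.H) :
    l2Pair S u (v + w) = l2Pair S u v + l2Pair S u w := by
  simp [l2Pair, inner_add_left]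

lemma l2Pair_symm_mul (S : DirichletSetting N) {a : EucSp N → ℝ} (u v Au Av : S.H)
    (hu : S.toL2 Au =ᵐ[volume.restrict S.Ω] fun x => (a x : ℂ) * S.toL2 u x)
    (hv : S.toL2 Av =ᵐ[volume.restrict S.Ω] fun x => (a x : ℂ) * S.toL2 v x) :
    l2Pair S u Av = l2Pair S v Au := by
  have : (inner ℂ (S.toL2 Av) (S.toL2 u) : ℂ) = inner ℂ (S.toL2 v) (S.toL2 Au) := by
    rw [L2.inner_def, L2.inner_def]
    refine integral_congr_ae ?_
    filter_upwards [hv, hu] with x hx hy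
    rw [hx, hy]
    simp only [RCLike.inner_apply, map_mul, Complex.conj_ofReal]
    ring
  rw [l2Pair, l2Pair, this]
  exact inner_re_symm (𝕜 := ℂ) _ _

/-- Derivative in time of the localized mass. -/
lemma ds_deriv (S : DirichletSetting N) {a : EucSp N → ℝ} (hac : ContDiff ℝ 1 a) {L : ℝ≥0}
    (hL : LipschitzWith L a) {B : ℝ} (hB : ∀ x, |a x| ≤ B)
    (u : ℝ → S.H) (hu_cont : Continuous u)
    (u' : ℝ → (S.H →L[ℝ] ℝ))
    (hu'_bdd : ∃ C : ℝ, ∀ t : ℝ, ‖u' t‖ ≤ C)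
    (hu'_deriv : ∀ (φ : S.H) (t : ℝ), HasDerivAt (fun s => l2Pair S (u s) φ) (u' t φ) t)
    (A : S.H → S.H)
    (hA : ∀ v, S.toL2 (A v) =ᵐ[volume.restrict S.Ω] fun x => (a x : ℂ) * S.toL2 v x) (t : ℝ) :
    HasDerivAt (fun s => l2Pair S (u s) (A (u s))) (2 * u' t (A (u t))) t := by
  obtain ⟨C, hC⟩ := hu'_bdd
  have hC0 : 0 ≤ C := (norm_nonneg _).trans (hC 0)
  have lip : ∀ (φ : S.H) (s : ℝ), |l2Pair S (u s - u t) φ| ≤ C * ‖φ‖ * |s - t| := by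
    intro φ s
    rw [l2Pair_sub_left]
    have := Convex.norm_image_sub_le_of_norm_hasDerivWithin_le (s := Set.univ)
      (f := fun s => l2Pair S (u s) φ) (f' := fun t => u' t φ) (C := C * ‖φ‖) (x := t) (y := s)
      (fun x _ => (hu'_deriv φ x).hasDerivWithinAt)
      (fun x _ => ((u' x).le_opNorm φ).trans (by gcongr; exact hC x)) convex_univ trivial trivial
    simpa using this
  have hsub : ∀ v w, A v - A w = A (v - w) := by
    intro v w
    apply S.toL2_injective
    rw [map_sub]
    apply Lp.ext
    filter_upwards [hA v, hA w, hA (v - w), Lp.coeFn_sub (S.toL2 (A v)) (S.toL2 (A w)),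
      Lp.coeFn_sub (S.toL2 v) (S.toL2 w)] with x h1 h2 h3 h4 h5
    rw [h4, h3, Pi.sub_apply, h1, h2, map_sub, h5, Pi.sub_apply]
    ring
  have e : ∀ s, l2Pair S (u s) (A (u s)) =
      (2 * l2Pair S (u s) (A (u t)) - l2Pair S (u t) (A (u t)))
        + l2Pair S (u s - u t) (A (u s - u t)) := by
    intro s
    rw [← hsub]
    have h1 := l2Pair_symm_mul S (u s) (u t) _ _ (hA (u s)) (hA (u t))
    have h2 := l2Pair_add_right S (u s - u t) (A (u s) - A (u t)) (A (u t))
    rw [sub_add_cancel] at h2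
    have h3 := l2Pair_sub_left S (u s) (u t) (A (u s))
    have h4 := l2Pair_sub_left S (u s) (u t) (A (u t))
    linarith
  have d1 : HasDerivAt (fun s => 2 * l2Pair S (u s) (A (u t)) - l2Pair S (u t) (A (u t)))
      (2 * u' t (A (u t))) t := ((hu'_deriv (A (u t)) t).const_mul 2).sub_const _
  have d2 : HasDerivAt (fun s => l2Pair S (u s - u t) (A (u s - u t))) 0 t := by
    rw [hasDerivAt_iff_isLittleO]
    have h0 : l2Pair S (u t - u t) (A (u t - u t)) = 0 := by simp [l2Pair]
    simp only [h0, sub_zero, smul_zero]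
    rw [Asymptotics.isLittleO_iff]
    intro c hc
    have hlim : Tendsto (fun s => C * ((2 * B + L) * ‖u s - u t‖)) (nhds t) (nhds 0) := by
      have : Continuous (fun s => C * ((2 * B + L) * ‖u s - u t‖)) := by fun_prop
      have h := this.tendsto t
      simpa using h
    filter_upwards [hlim.eventually (gt_mem_nhds hc)] with s hs
    rw [Real.norm_eq_abs, Real.norm_eq_abs]
    refine (lip _ s).trans ?_
    gcongr
    refine le_trans ?_ hs.le
    gcongr
    exact ds_mul_bound S hac hL hB _ _ (hA _)
  have := d1.add d2
  rw [add_zero] at this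
  exact this.congr_of_eventuallyEq (Eventually.of_forall e)

lemma ds_growth (S : DirichletSetting N) {a : EucSp N → ℝ} (hac : ContDiff ℝ 1 a) {L : ℝ≥0}
    (hL : LipschitzWith L a) {B : ℝ} (hB : ∀ x, |a x| ≤ B)
    (lam α : ℝ)
    (u₀ : S.H) (u : ℝ → S.H) (hu0 : u 0 = u₀)
    (hu_cont : Continuous u) 
    (u' : ℝ → (S.H →L[ℝ] ℝ))
    (hu'_bdd : ∃ C : ℝ, ∀ t : ℝ, ‖u' t‖ ≤ C)
    (hu'_deriv : ∀ (φ : S.H) (t : ℝ), HasDerivAt (fun s => l2Pair S (u s) φ) (u' t φ) t)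
    (heq : ∀ (t : ℝ) (φ : S.H),
      u' t ((-Complex.I) • φ) + deltaPair S (u t) φ
        + lam * (∫ x, (((1 + ‖(S.toL2 (u t)) x‖ ^ 2) ^ (α / 2) : ℝ) : ℂ)
            * ((S.toL2 (u t)) x * (starRingEnd ℂ) ((S.toL2 φ) x)) ∂S.μ).re
      = 0)
    (hcharge : ∀ t : ℝ, ‖S.toL2 (u t)‖ = ‖S.toL2 u₀‖) (G : ℝ) (hG : ∀ t, ‖S.grad (u t)‖ ≤ G)
    (t : ℝ) :
    ∫ x in S.Ω, a x * ‖S.toL2 (u t) x‖ ^ 2 ≤ (∫ x in S.Ω, a x * ‖S.toL2 u₀ x‖ ^ 2)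
      + 2 * (L * ‖S.toL2 u₀‖ * G) * |t| := by
  have hW : IsW1inf S.Ω a := ⟨⟨L, hL.lipschitzOnWith⟩, B, fun x _ => hB x⟩
  choose A hA using S.smul_W1inf_mem a hW
  have hd := ds_deriv S hac hL hB u hu_cont u' hu'_bdd hu'_deriv A hA
  have hb : ∀ s, |u' s (A (u s))| ≤ L * ‖S.toL2 u₀‖ * G := by
    intro s
    have h := heq s (Complex.I • A (u s))
    have h1 : (-Complex.I) • Complex.I • A (u s) = A (u s) := by
      rw [smul_smul]; simp
    have h2 : (∫ x, (((1 + ‖(S.toL2 (u s)) x‖ ^ 2) ^ (α / 2) : ℝ) : ℂ)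
            * ((S.toL2 (u s)) x * (starRingEnd ℂ) ((S.toL2 (Complex.I • A (u s))) x)) ∂S.μ).re = 0 := by
      have : (∫ x, (((1 + ‖(S.toL2 (u s)) x‖ ^ 2) ^ (α / 2) : ℝ) : ℂ)
            * ((S.toL2 (u s)) x * (starRingEnd ℂ) ((S.toL2 (Complex.I • A (u s))) x)) ∂S.μ)
          = (-Complex.I) * ((∫ x, (1 + ‖(S.toL2 (u s)) x‖ ^ 2) ^ (α / 2)
            * (a x * ‖S.toL2 (u s) x‖ ^ 2) ∂S.μ : ℝ) : ℂ) := by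
        rw [← integral_complex_ofReal, ← integral_const_mul]
        refine integral_congr_ae ?_
        have hsm := Lp.coeFn_smul Complex.I (S.toL2 (A (u s)))
        rw [← map_smul] at hsm
        simp only [DirichletSetting.μ]
        filter_upwards [hsm, hA (u s)] with x hx hy
        rw [hx, Pi.smul_apply, hy]
        simp only [smul_eq_mul, map_mul, Complex.conj_I, Complex.conj_ofReal]
        have hz := Complex.mul_conj (S.toL2 (u s) x)
        rw [Complex.normSq_eq_norm_sq] at hz
        push_cast at hz ⊢
        rw [← hz]
        ring
      rw [this]; simp
    rw [h1, h2, mul_zero, add_zero] at h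
    have h3 : deltaPair S (u s) (Complex.I • A (u s)) = (inner ℂ (S.grad (u s)) (S.grad (A (u s))) : ℂ).im := by
      rw [deltaPair, map_smul, inner_smul_right]
      simp
    have h4 : u' s (A (u s)) = -(inner ℂ (S.grad (u s)) (S.grad (A (u s))) : ℂ).im := by linarith
    rw [h4, abs_neg]
    refine (ds_im_bound S hac hL hB (u s) _ (hA _)).trans ?_
    rw [hcharge]
    gcongr
    exact hG s
  have := Convex.norm_image_sub_le_of_norm_hasDerivWithin_le (s := Set.univ)
      (f := fun s => l2Pair S (u s) (A (u s))) (C := 2 * (L * ‖S.toL2 u₀‖ * G)) (x := 0) (y := t)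
      (fun x _ => (hd x).hasDerivWithinAt)
      (fun x _ => by
        rw [norm_mul, Real.norm_eq_abs, Real.norm_eq_abs, abs_two]
        gcongr
        exact hb x) convex_univ trivial trivial
  simp only [Real.norm_eq_abs, sub_zero, l2Pair_eq_int S _ _ (hA _), hu0] at this
  have := le_of_abs_le this
  linarith

def cutS (κ : ℝ) (x : EucSp N) : ℝ := Real.sqrt (κ ^ 2 + ‖x‖ ^ 2) - κ

def cutA (κ : ℝ) (x : EucSp N) : ℝ := cutS κ x / (1 + κ * cutS κ x)

lemma cutS_nonneg {κ : ℝ} (x : EucSp N) : 0 ≤ cutS κ x := by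
  unfold cutS
  have : κ ≤ Real.sqrt (κ ^ 2 + ‖x‖ ^ 2) := Real.le_sqrt_of_sq_le (by nlinarith [sq_nonneg ‖x‖])
  linarith

lemma cutS_lip {κ : ℝ} (hκ : 0 < κ) (x y : EucSp N) : |cutS κ x - cutS κ y| ≤ ‖x - y‖ := by
  have key : ∀ p q : ℝ, 0 ≤ p → 0 ≤ q → p ≤ q →
      Real.sqrt (κ ^ 2 + q ^ 2) ≤ Real.sqrt (κ ^ 2 + p ^ 2) + (q - p) := by
    intro p q hp hq hpq
    rw [Real.sqrt_le_left (by have := Real.sqrt_nonneg (κ ^ 2 + p ^ 2); linarith)]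
    have h1 := Real.sq_sqrt (show 0 ≤ κ ^ 2 + p ^ 2 by positivity)
    have h2 : p ≤ Real.sqrt (κ ^ 2 + p ^ 2) := Real.le_sqrt_of_sq_le (by nlinarith)
    nlinarith
  have mono : ∀ p q : ℝ, 0 ≤ p → p ≤ q →
      Real.sqrt (κ ^ 2 + p ^ 2) ≤ Real.sqrt (κ ^ 2 + q ^ 2) := by
    intro p q hp hpq
    apply Real.sqrt_le_sqrt; gcongr
  have h3 := abs_norm_sub_norm_le x y
  refine le_trans ?_ h3
  unfold cutS
  rcases le_total ‖x‖ ‖y‖ with h | h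
  · have := key _ _ (norm_nonneg x) (norm_nonneg y) h
    have := mono _ _ (norm_nonneg x) h
    rw [abs_of_nonpos (by linarith), abs_of_nonpos (by linarith)]
    linarith
  · have := key _ _ (norm_nonneg y) (norm_nonneg x) h
    have := mono _ _ (norm_nonneg y) h
    rw [abs_of_nonneg (by linarith), abs_of_nonneg (by linarith)]
    linarith

lemma cutA_contDiff {κ : ℝ} (hκ : 0 < κ) : ContDiff ℝ 1 (cutA κ : EucSp N → ℝ) := by
  have h1 : ContDiff ℝ 1 (cutS κ : EucSp N → ℝ) := by
    refine ContDiff.sub (ContDiff.sqrt (contDiff_const.add (contDiff_norm_sq ℝ)) ?_) contDiff_const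
    intro x; positivity
  refine h1.div (contDiff_const.add (contDiff_const.mul h1)) ?_
  intro x
  have := cutS_nonneg (κ := κ) x
  positivity

lemma cutA_lip {κ : ℝ} (hκ : 0 < κ) : LipschitzWith 1 (cutA κ : EucSp N → ℝ) := by
  refine LipschitzWith.of_dist_le_mul fun x y => ?_
  rw [Real.dist_eq, dist_eq_norm, NNReal.coe_one, one_mul]
  refine le_trans ?_ (cutS_lip hκ x y)
  have hx := cutS_nonneg (κ := κ) x
  have hy := cutS_nonneg (κ := κ) y
  have : cutA κ x - cutA κ y = (cutS κ x - cutS κ y) / ((1 + κ * cutS κ x) * (1 + κ * cutS κ y)) := by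
    unfold cutA
    field_simp
    ring
  rw [this, abs_div]
  refine div_le_self (abs_nonneg _) ?_
  rw [abs_of_nonneg (by positivity)]
  have : 0 ≤ κ * cutS κ x := by positivity
  have : 0 ≤ κ * cutS κ y := by positivity
  nlinarith

lemma cutA_nonneg {κ : ℝ} (hκ : 0 < κ) (x : EucSp N) : 0 ≤ cutA κ x := by
  have hx := cutS_nonneg (κ := κ) x
  unfold cutA; positivity

lemma cutA_le {κ : ℝ} (hκ : 0 < κ) (x : EucSp N) : |cutA κ x| ≤ 1 / κ := by
  rw [abs_of_nonneg (cutA_nonneg hκ x)]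
  have hx := cutS_nonneg (κ := κ) x
  unfold cutA
  rw [div_le_div_iff₀ (by positivity) hκ]
  nlinarith

lemma cutA_zero {κ : ℝ} (hκ : 0 < κ) : cutA κ (0 : EucSp N) = 0 := by
  simp [cutA, cutS, Real.sqrt_sq hκ.le]

lemma cutA_lower {κ : ℝ} (hκ : 0 < κ) (hκ1 : κ < 1) (x : EucSp N) (hx : 1 ≤ ‖x‖) :
    (1 - κ) / (1 + κ) ≤ cutA κ x := by
  have h0 : 1 - κ ≤ cutS κ x := by
    unfold cutS
    have : 1 ≤ Real.sqrt (κ ^ 2 + ‖x‖ ^ 2) := Real.le_sqrt_of_sq_le (by nlinarith)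
    linarith
  unfold cutA
  have hx := cutS_nonneg (κ := κ) x
  rw [div_le_div_iff₀ (by positivity) (by positivity)]
  nlinarith [mul_nonneg hκ.le hx, mul_nonneg (mul_nonneg hκ.le hx) hκ.le]

lemma ds_norm_sq (S : DirichletSetting N) (v : S.H) :
    ∫ x in S.Ω, ‖S.toL2 v x‖ ^ 2 = ‖S.toL2 v‖ ^ 2 := by
  have h := l2Pair_eq_int S (a := fun _ => 1) v v (by filter_upwards with x; simp)
  simp only [one_mul] at h
  rw [← h, l2Pair, inner_self_eq_norm_sq_to_K]
  norm_cast

lemma ds_int_sq (S : DirichletSetting N) (v : S.H) :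
    Integrable (fun x => ‖S.toL2 v x‖ ^ 2) (volume.restrict S.Ω) :=
  (Lp.memLp (S.toL2 v)).integrable_norm_pow (by norm_num)

/-- mass in the ball -/
lemma ds_mass (S : DirichletSetting N) (u₀ : S.H) (u : ℝ → S.H) {M₀ D : ℝ} (hM : 0 < M₀)
    (hcharge : ∀ t : ℝ, ‖S.toL2 (u t)‖ = ‖S.toL2 u₀‖)
    (hgrow : ∀ (a : EucSp N → ℝ) (L : ℝ≥0) (B : ℝ), ContDiff ℝ 1 a → LipschitzWith L a →
      (∀ x, |a x| ≤ B) → ∀ t, ∫ x in S.Ω, a x * ‖S.toL2 (u t) x‖ ^ 2 ≤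
        (∫ x in S.Ω, a x * ‖S.toL2 u₀ x‖ ^ 2) + L * (D * M₀) * |t|)
    {κ : ℝ} (hκ : 0 < κ) (hκ1 : κ < 1) (c : EucSp N) (t : ℝ) (ht : 0 < |t|) :
    ‖S.toL2 u₀‖ ^ 2 - ((∫ x in S.Ω, cutA κ ((M₀ * |t|)⁻¹ • (x - c)) * ‖S.toL2 u₀ x‖ ^ 2) + D)
        * ((1 + κ) / (1 - κ))
      ≤ ∫ x in S.Ω ∩ Metric.ball c (M₀ * |t|), ‖S.toL2 (u t) x‖ ^ 2 := by
  set R := M₀ * |t| with hR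
  have hR0 : 0 < R := by positivity
  set a : EucSp N → ℝ := fun x => cutA κ (R⁻¹ • (x - c)) with ha
  have hac : ContDiff ℝ 1 a :=
    (cutA_contDiff hκ).comp (by fun_prop)
  let L : ℝ≥0 := ⟨R⁻¹, by positivity⟩
  have hL : LipschitzWith L a := by
    refine LipschitzWith.of_dist_le_mul fun x y => ?_
    refine ((cutA_lip hκ).dist_le_mul _ _).trans ?_
    rw [dist_eq_norm, dist_eq_norm, ← smul_sub, norm_smul, Real.norm_eq_abs,
      abs_of_pos (by positivity), NNReal.coe_one, one_mul]
    rw [sub_sub_sub_cancel_right]; exact le_refl (R⁻¹ * ‖x - y‖)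
  have hB : ∀ x, |a x| ≤ 1 / κ := fun x => cutA_le hκ _
  have h := hgrow a L _ hac hL hB t
  have hLD : (L : ℝ) * (D * M₀) * |t| = D := by
    change R⁻¹ * (D * M₀) * |t| = D
    rw [hR]; field_simp
  rw [hLD] at h
  set k := (1 + κ) / (1 - κ) with hk
  have hk0 : 0 < k := div_pos (by linarith) (by linarith)
  have hau : Integrable (fun x => a x * ‖S.toL2 (u t) x‖ ^ 2) (volume.restrict S.Ω) := by
    refine (ds_int_sq S (u t)).bdd_mul (c := 1 / κ) hac.continuous.aestronglyMeasurable ?_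
    filter_upwards with x
    exact hB x
  have hbm : MeasurableSet (Metric.ball c R) := measurableSet_ball
  have hind : Integrable ((Metric.ball c R).indicator fun x => ‖S.toL2 (u t) x‖ ^ 2)
    (volume.restrict S.Ω) := (ds_int_sq S (u t)).indicator hbm
  have hle : ∫ x in S.Ω, ‖S.toL2 (u t) x‖ ^ 2 ≤
      ∫ x in S.Ω, ((Metric.ball c R).indicator (fun x => ‖S.toL2 (u t) x‖ ^ 2) x
        + k * (a x * ‖S.toL2 (u t) x‖ ^ 2)) := by
    refine integral_mono (ds_int_sq S (u t)) (hind.add (hau.const_mul k)) fun x => ?_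
    have ha0 : 0 ≤ a x := cutA_nonneg hκ _
    by_cases hx : x ∈ Metric.ball c R
    · simp only [Set.indicator_of_mem hx]
      have : 0 ≤ k * (a x * ‖S.toL2 (u t) x‖ ^ 2) := by positivity
      linarith
    · simp only [Set.indicator_of_notMem hx, zero_add]
      have h1 : 1 ≤ ‖R⁻¹ • (x - c)‖ := by
        rw [norm_smul, Real.norm_eq_abs, abs_of_pos (by positivity), ← div_eq_inv_mul,
          one_le_div hR0]
        rw [Metric.mem_ball, dist_eq_norm] at hx
        linarith
      have h2 : (1 - κ) / (1 + κ) ≤ a x := cutA_lower hκ hκ1 _ h1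
      have h3 : 1 ≤ k * a x := by
        have : k * ((1 - κ) / (1 + κ)) = 1 := by
          have : 1 - κ ≠ 0 := by linarith
          have : 1 + κ ≠ 0 := by linarith
          rw [hk]; field_simp
        rw [← this]; gcongr
      rw [← mul_assoc]
      exact le_mul_of_one_le_left (by positivity) h3
  rw [integral_add hind (hau.const_mul k), integral_const_mul, integral_indicator hbm,
    Measure.restrict_restrict hbm, Set.inter_comm, ds_norm_sq, hcharge] at hle
  have : k * ∫ x in S.Ω, a x * ‖S.toL2 (u t) x‖ ^ 2 ≤
    k * ((∫ x in S.Ω, a x * ‖S.toL2 u₀ x‖ ^ 2) + D) := by gcongr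
  linarith

lemma ds_g0 (S : DirichletSetting N) (u₀ : S.H) {M₀ : ℝ} (hM : 0 < M₀)
    {κ : ℝ} (hκ : 0 < κ) (c : EucSp N) (l : Filter ℝ) [l.IsCountablyGenerated]
    (hl : Tendsto (fun t : ℝ => |t|) l atTop) :
    Tendsto (fun t : ℝ => ∫ x in S.Ω, cutA κ ((M₀ * |t|)⁻¹ • (x - c)) * ‖S.toL2 u₀ x‖ ^ 2) l
      (nhds 0) := by
  have hcut : Continuous (cutA κ : EucSp N → ℝ) := (cutA_contDiff hκ).continuous
  have : Tendsto (fun t : ℝ => ∫ x in S.Ω, cutA κ ((M₀ * |t|)⁻¹ • (x - c)) * ‖S.toL2 u₀ x‖ ^ 2) l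
      (nhds (∫ x in S.Ω, (0 : ℝ))) := by
    refine tendsto_integral_filter_of_dominated_convergence
      (fun x => (1 / κ) * ‖S.toL2 u₀ x‖ ^ 2) ?_ ?_ ((ds_int_sq S u₀).const_mul _) ?_
    · filter_upwards with t
      refine AEStronglyMeasurable.mul ?_ (ds_int_sq S u₀).1
      exact (hcut.comp (by fun_prop)).aestronglyMeasurable
    · filter_upwards with t
      filter_upwards with x
      rw [norm_mul, Real.norm_eq_abs, Real.norm_of_nonneg (sq_nonneg _)]
      gcongr
      exact cutA_le hκ _
    · filter_upwards with x
      have h1 : Tendsto (fun t : ℝ => (M₀ * |t|)⁻¹) l (nhds 0) :=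
        tendsto_inv_atTop_zero.comp (hl.const_mul_atTop hM)
      have h2 : Tendsto (fun t : ℝ => (M₀ * |t|)⁻¹ • (x - c)) l (nhds 0) := by
        simpa using h1.smul_const (x - c)
      have h3 := (hcut.tendsto 0).comp h2
      rw [cutA_zero hκ] at h3
      simpa using h3.mul_const (‖S.toL2 u₀ x‖ ^ 2)
  simpa using this

lemma ds_final (hN : 2 ≤ N) (S : DirichletSetting N) (v : S.H) {M₀ : ℝ} (hM : 0 < M₀) (c : EucSp N) (t ε : ℝ)
    (ht : 0 < |t|) (hε : 0 ≤ ε)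
    (h : ε ^ 2 ≤ ∫ x in S.Ω ∩ Metric.ball c (M₀ * |t|), ‖S.toL2 v x‖ ^ 2)
    (r : ℝ≥0∞) (hr : 2 ≤ r) :
    ENNReal.ofReal ε * (volume (Metric.ball (0 : EucSp N) M₀)) ^ (-((1:ℝ)/2 - (1/r).toReal))
      ≤ ENNReal.ofReal (|t| ^ ((N : ℝ) * ((1:ℝ)/2 - (1/r).toReal))) *
            eLpNorm (S.toL2 v) r (volume.restrict (S.Ω ∩ Metric.ball c (M₀ * |t|))) := by
  haveI : Nontrivial (Fin N) := Fin.nontrivial_iff_two_le.2 hN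
  set ν := volume.restrict (S.Ω ∩ Metric.ball c (M₀ * |t|)) with hν
  set V := volume (Metric.ball (0 : EucSp N) M₀) with hV
  set θ := (1:ℝ)/2 - (1/r).toReal with hθ
  have hθ0 : 0 ≤ θ := by
    have : (1/r).toReal ≤ (1/2 : ℝ≥0∞).toReal :=
      ENNReal.toReal_mono (by simp) (ENNReal.div_le_div_left hr 1)
    have h2 : (1/2 : ℝ≥0∞).toReal = 1/2 := by simp
    rw [hθ]; linarith
  have hm : MemLp (S.toL2 v) 2 ν :=
    (Lp.memLp (S.toL2 v)).mono_measure (Measure.restrict_mono Set.inter_subset_left le_rfl)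
  have h1 : ENNReal.ofReal ε ≤ eLpNorm (S.toL2 v) 2 ν := by
    rw [hm.eLpNorm_eq_integral_rpow_norm (by norm_num) (by norm_num)]
    apply ENNReal.ofReal_le_ofReal
    simp only [ENNReal.toReal_ofNat, Real.rpow_ofNat]
    rw [← Real.sqrt_sq hε, ← one_div, ← Real.sqrt_eq_rpow]
    exact Real.sqrt_le_sqrt h
  have h2 := eLpNorm_le_eLpNorm_mul_rpow_measure_univ hr hm.1
  have h3 : 1 / (2 : ℝ≥0∞).toReal - 1 / r.toReal = θ := by
    rw [hθ]; simp
  rw [h3] at h2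
  have h4 : ν Set.univ ≤ ENNReal.ofReal (|t| ^ N) * V := by
    rw [hν, Measure.restrict_apply_univ]
    refine (measure_mono Set.inter_subset_right).trans ?_
    rw [mul_comm M₀, Measure.addHaar_ball_mul _ _ ht.le]
    simp [hV]
  have h5 : (ν Set.univ) ^ θ ≤ ENNReal.ofReal (|t| ^ ((N : ℝ) * θ)) * V ^ θ := by
    refine (ENNReal.rpow_le_rpow h4 hθ0).trans ?_
    rw [ENNReal.mul_rpow_of_nonneg _ _ hθ0, ENNReal.ofReal_rpow_of_pos (by positivity),
      Real.rpow_mul ht.le, Real.rpow_natCast]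
  have hV0 : V ≠ 0 := (Metric.measure_ball_pos _ _ hM).ne'
  have hVt : V ≠ ⊤ := measure_ball_lt_top.ne
  calc ENNReal.ofReal ε * V ^ (-θ)
      ≤ (eLpNorm (S.toL2 v) r ν * (ENNReal.ofReal (|t| ^ ((N : ℝ) * θ)) * V ^ θ)) * V ^ (-θ) := by
        gcongr
        exact h1.trans (h2.trans (by gcongr))
    _ = ENNReal.ofReal (|t| ^ ((N : ℝ) * θ)) * eLpNorm (S.toL2 v) r ν * (V ^ θ * V ^ (-θ)) := by ring
    _ = _ := by
        rw [← ENNReal.rpow_add _ _ hV0 hVt]; simp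

lemma ds_main (hN : 2 ≤ N) (S : DirichletSetting N) (u₀ : S.H) (u : ℝ → S.H) {M₀ ε : ℝ} (hM : 0 < M₀)
    (hε0 : 0 < ε)
    (hcharge : ∀ t : ℝ, ‖S.toL2 (u t)‖ = ‖S.toL2 u₀‖)
    (hgrow : ∀ (a : EucSp N → ℝ) (L : ℝ≥0) (B : ℝ), ContDiff ℝ 1 a → LipschitzWith L a →
      (∀ x, |a x| ≤ B) → ∀ t, ∫ x in S.Ω, a x * ‖S.toL2 (u t) x‖ ^ 2 ≤
        (∫ x in S.Ω, a x * ‖S.toL2 u₀ x‖ ^ 2) + L * ((‖S.toL2 u₀‖ ^ 2 - ε ^ 2) * M₀) * |t|)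
    (c : EucSp N) (r : ℝ≥0∞) (hr : 2 ≤ r) (l : Filter ℝ) [l.IsCountablyGenerated]
    (hl : Tendsto (fun t : ℝ => |t|) l atTop) :
    ENNReal.ofReal ε * (volume (Metric.ball (0 : EucSp N) M₀)) ^ (-((1:ℝ)/2 - (1/r).toReal))
      ≤ Filter.liminf (fun t : ℝ =>
          ENNReal.ofReal (|t| ^ ((N : ℝ) * ((1:ℝ)/2 - (1/r).toReal))) *
            eLpNorm (S.toL2 (u t)) r (volume.restrict (S.Ω ∩ Metric.ball c (M₀ * |t|)))) l := by
  set X := (volume (Metric.ball (0 : EucSp N) M₀)) ^ (-((1:ℝ)/2 - (1/r).toReal)) with hX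
  have hV0 : volume (Metric.ball (0 : EucSp N) M₀) ≠ 0 := (Metric.measure_ball_pos _ _ hM).ne'
  have hVt : volume (Metric.ball (0 : EucSp N) M₀) ≠ ⊤ := measure_ball_lt_top.ne
  have hXt : X ≠ ⊤ := ENNReal.rpow_ne_top_of_ne_zero hV0 hVt
  have hlim : Tendsto (fun e : ℝ => ENNReal.ofReal e * X) (nhdsWithin ε (Set.Iio ε))
      (nhds (ENNReal.ofReal ε * X)) := by
    refine ENNReal.Tendsto.mul_const ?_ (Or.inr hXt)
    exact (ENNReal.continuous_ofReal.tendsto ε).mono_left nhdsWithin_le_nhds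
  refine le_of_tendsto hlim ?_
  have hpos : ∀ᶠ e in nhdsWithin ε (Set.Iio ε), 0 < e := 
    nhdsWithin_le_nhds (lt_mem_nhds hε0)
  filter_upwards [hpos, self_mem_nhdsWithin] with e he0 hee
  have hee : e < ε := hee
  set D := ‖S.toL2 u₀‖ ^ 2 - ε ^ 2 with hD
  -- choose κ
  have hκ : ∃ κ : ℝ, 0 < κ ∧ κ < 1 ∧ e ^ 2 < ‖S.toL2 u₀‖ ^ 2 - (0 + D) * ((1 + κ) / (1 - κ)) := by
    have hc : ContinuousAt (fun κ : ℝ => ‖S.toL2 u₀‖ ^ 2 - (0 + D) * ((1 + κ) / (1 - κ))) 0 := by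
      have : ContinuousAt (fun κ : ℝ => (1 + κ) / (1 - κ)) 0 :=
        ContinuousAt.div (by fun_prop) (by fun_prop) (by norm_num)
      fun_prop
    have h0 : e ^ 2 < ‖S.toL2 u₀‖ ^ 2 - (0 + D) * ((1 + 0) / (1 - 0)) := by
      rw [hD]; nlinarith
    have h1 := hc.eventually (lt_mem_nhds h0)
    have h2 : ∀ᶠ κ : ℝ in nhds 0, κ < 1 := gt_mem_nhds (by norm_num)
    have h3 : ∀ᶠ κ : ℝ in nhdsWithin 0 (Set.Ioi 0), 0 < κ := self_mem_nhdsWithin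
    obtain ⟨κ, k1, k2, k3⟩ := (h3.and (nhdsWithin_le_nhds (h2.and h1))).exists
    exact ⟨κ, k1, k2, k3⟩
  obtain ⟨κ, k1, k2, k3⟩ := hκ
  have g0 := ds_g0 S u₀ hM k1 c l hl
  have g1 := ((g0.add_const D).mul_const ((1 + κ) / (1 - κ))).const_sub (‖S.toL2 u₀‖ ^ 2)
  refine Filter.le_liminf_of_le (by isBoundedDefault) ?_
  filter_upwards [g1.eventually (lt_mem_nhds k3), hl.eventually (eventually_gt_atTop 0)] with t ht ht0
  exact ds_final hN S (u t) hM c t e ht0 he0.le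
    (ht.le.trans (ds_mass S u₀ u hM hcharge hgrow k1 k2 c t ht0)) r hr

/-- **Exterior of a star-shaped obstacle (Bégout, Remark 3.7 (4)).**
Let `N ≥ 2`, `K ⊂ ℝ^N` a nonempty star-shaped open bounded set with smooth boundary,
`Ω = ℝ^N \ K̄`, and `f(u) = λ(1+|u|²)^{α/2}u` with `λ > 0` and `0 ≤ α < 4/N`
(moreover `α < 2/(N-2)` if `N ≥ 5`). Let `u₀ ∈ H¹₀(Ω) \ {0}` and let
`u ∈ C_b(ℝ;H¹₀(Ω)) ∩ C¹_b(ℝ;H⁻¹(Ω))` be the unique solution of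
`i∂ₜu + Δu + λ(1+|u|²)^{α/2}u = 0`, `u(0) = u₀`, satisfying conservation of charge
and of the energy
`E(u₀) = (1/2)‖∇u₀‖²_{L²} - (λ/(α+2))∫_Ω ((1+|u₀|²)^{(α+2)/2} - 1)`. Then for every
`0 < ε < ‖u₀‖_{L²(Ω)}`, with `M₀ = 2‖u₀‖_{L²}‖∇u‖_{L^∞(ℝ;L²)}/(‖u₀‖²_{L²} - ε²)`,
for every `c ∈ Ω` and `r ∈ [2,∞]`:
`liminf_{t→±∞} |t|^{N(1/2-1/r)} ‖u(t)‖_{L^r(Ω∩{|x-c|<M₀|t|})} ≥ ε |B(0,M₀)|^{-(1/2-1/r)}`. -/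
theorem exterior_domain_lower_bound (N : ℕ) (hN : 2 ≤ N)
    (K : Set (EucSp N)) (hKne : K.Nonempty) (hKo : IsOpen K)
    (hKb : Bornology.IsBounded K)
    (hKstar : ∃ x₀ ∈ K, StarConvex ℝ x₀ K)
    (hKsmooth : ∃ g : EucSp N → ℝ, ContDiff ℝ (⊤ : ℕ∞) g ∧ K = {x | g x < 0} ∧
      ∀ x ∈ frontier K, g x = 0 ∧ fderiv ℝ g x ≠ 0)
    (S : DirichletSetting N) (hΩ : S.Ω = (closure K)ᶜ)
    (lam α : ℝ) (hlam : 0 < lam) (hα0 : 0 ≤ α) (hα1 : α < 4 / (N : ℝ))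
    (hα2 : 5 ≤ N → α < 2 / ((N : ℝ) - 2))
    (u₀ : S.H) (hu₀ : u₀ ≠ 0) (u : ℝ → S.H) (hu0 : u 0 = u₀)
    (hu_cont : Continuous u) (hu_bdd : ∃ C : ℝ, ∀ t : ℝ, ‖u t‖ ≤ C)
    (u' : ℝ → (S.H →L[ℝ] ℝ))
    (hu'_cont : ∀ φ : S.H, Continuous fun t => u' t φ)
    (hu'_bdd : ∃ C : ℝ, ∀ t : ℝ, ‖u' t‖ ≤ C)
    (hu'_deriv : ∀ (φ : S.H) (t : ℝ), HasDerivAt (fun s => l2Pair S (u s) φ) (u' t φ) t)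
    (heq : ∀ (t : ℝ) (φ : S.H),
      u' t ((-Complex.I) • φ) + deltaPair S (u t) φ
        + lam * (∫ x, (((1 + ‖(S.toL2 (u t)) x‖ ^ 2) ^ (α / 2) : ℝ) : ℂ)
            * ((S.toL2 (u t)) x * (starRingEnd ℂ) ((S.toL2 φ) x)) ∂S.μ).re
      = 0)
    (hcharge : ∀ t : ℝ, ‖S.toL2 (u t)‖ = ‖S.toL2 u₀‖)
    (henergy : ∀ t : ℝ, exteriorEnergy S lam α (u t) = exteriorEnergy S lam α u₀)
    (ε : ℝ) (hε0 : 0 < ε) (hε : ε < ‖S.toL2 u₀‖) (M₀ : ℝ)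
    (hM₀ : M₀ = 2 * ‖S.toL2 u₀‖ * gradSup S u Set.univ / (‖S.toL2 u₀‖ ^ 2 - ε ^ 2)) :
    lowerBoundTwoSided S u ε M₀ := by
  have hGb : BddAbove ((fun t => ‖S.grad (u t)‖) '' Set.univ) := by
    obtain ⟨C, hC⟩ := hu_bdd
    refine ⟨C, ?_⟩
    rintro _ ⟨t, _, rfl⟩
    exact (ds_norm_grad_le S (u t)).trans (hC t)
  have hG : ∀ t, ‖S.grad (u t)‖ ≤ gradSup S u Set.univ := fun t =>
    le_csSup hGb ⟨t, trivial, rfl⟩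
  have hG0 : 0 < gradSup S u Set.univ := by
    refine lt_of_lt_of_le (norm_pos_iff.2 fun h => hu₀ ?_) (hG 0)
    rw [hu0] at h
    exact ds_grad_zero hN S u₀ h
  have hn0 : 0 < ‖S.toL2 u₀‖ := hε0.trans hε
  have hD : 0 < ‖S.toL2 u₀‖ ^ 2 - ε ^ 2 := by nlinarith
  have hM : 0 < M₀ := by rw [hM₀]; positivity
  have hDM : (‖S.toL2 u₀‖ ^ 2 - ε ^ 2) * M₀ = 2 * ‖S.toL2 u₀‖ * gradSup S u Set.univ := by
    rw [hM₀]; field_simp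
  have hgrow : ∀ (a : EucSp N → ℝ) (L : ℝ≥0) (B : ℝ), ContDiff ℝ 1 a → LipschitzWith L a →
      (∀ x, |a x| ≤ B) → ∀ t, ∫ x in S.Ω, a x * ‖S.toL2 (u t) x‖ ^ 2 ≤
        (∫ x in S.Ω, a x * ‖S.toL2 u₀ x‖ ^ 2)
          + L * ((‖S.toL2 u₀‖ ^ 2 - ε ^ 2) * M₀) * |t| := by
    intro a L B hac hL hB t
    refine (ds_growth S hac hL hB lam α u₀ u hu0 hu_cont u' hu'_bdd hu'_deriv heq hcharge _ hG
      t).trans (le_of_eq ?_)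
    rw [hDM]; ring
  intro r hr c _
  exact ⟨ds_main hN S u₀ u hM hε0 hcharge hgrow c r hr atTop tendsto_abs_atTop_atTop,
    ds_main hN S u₀ u hM hε0 hcharge hgrow c r hr atBot tendsto_abs_atBot_atTop⟩

end
end
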